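/- arXiv:1509.08495 — 2 statements merged into one kernel-verified Lean document; each statement's English description precedes it below -/
import Mathlib

section
/- There exist a smooth function ρ : ℝ³ → (0,∞) and smooth functions a^{ij} : ℝ³ → ℝ (1 ≤ i,j ≤ 3) with a^{ij} = a^{ji} and (a^{ij}(x)) positive definite for every x, satisfying ρ(x) = 1 and a^{ij}(x) = δ^{ij} whenever |x| ≥ π, with the following property: for every function h : [0,∞) → [0,∞) such that h(t)·(log(2+t))² → 0 as t → ∞, there exists t₀ > 0 so that for every τ > t₀ one can find a smooth solution ψ : ℝ × ℝ³ → ℝ of ρ ∂_t²ψ = Σ_{i,j} ∂_i(ρ a^{ij} ∂_j ψ) with smooth compactly supported initial data ψ(0,·), ∂_tψ(0,·), such that ∫_{|x| ≤ 3π/4} ρ·(|∂_tψ(τ,x)|² + Σ a^{ij} ∂_iψ ∂_jψ(τ,x)) dx > h(τ) · ( ∫_{ℝ³} (1+|x|)·ρ·(|∂_tψ(0,x)|² + Σ a^{ij}∂_iψ∂_jψ(0,x)) dx + ∫_{ℝ³} ρ·(|∂_t²ψ(0,x)|² + Σ a^{ij} ∂_i∂_tψ ∂_j∂_tψ(0,x))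 dx ). -/
open MeasureTheory Set Filter

/-- The time derivative `∂_t ψ` of a function `ψ : ℝ × ℝ^d → ℝ`. -/
noncomputable def timeDeriv {d : ℕ} (ψ : ℝ × EuclideanSpace ℝ (Fin d) → ℝ) (t : ℝ)
    (x : EuclideanSpace ℝ (Fin d)) : ℝ :=
  deriv (fun s => ψ (s, x)) t

/-- The iterated time derivative `∂_t^j ψ` of a function `ψ : ℝ × ℝ^d → ℝ`. -/
noncomputable def timeIteratedDeriv {d : ℕ} (j : ℕ) (ψ : ℝ × EuclideanSpace ℝ (Fin d) → ℝ)
    (t : ℝ) (x : EuclideanSpace ℝ (Fin d)) : ℝ :=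
  iteratedDeriv j (fun s => ψ (s, x)) t

/-- The spatial partial derivative `∂_i f` of a function `f : ℝ^d → ℝ`. -/
noncomputable def spatialDeriv {d : ℕ} (i : Fin d) (f : EuclideanSpace ℝ (Fin d) → ℝ)
    (x : EuclideanSpace ℝ (Fin d)) : ℝ :=
  fderiv ℝ f x (EuclideanSpace.single i 1)

/-- Three-dimensional Euclidean space. -/
abbrev Space3 : Type := EuclideanSpace ℝ (Fin 3)

/-- The generator `x ↦ x_i e_j - x_j e_i` of the rotations in the `(i, j)` coordinate plane. -/
noncomputable def rotGen (i j : Fin 3) : Space3 →L[ℝ] Space3 :=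
  (EuclideanSpace.proj i).smulRight (EuclideanSpace.single j 1)
    - (EuclideanSpace.proj j).smulRight (EuclideanSpace.single i 1)

/-- The coordinate projection onto the `(i, j)` plane. -/
noncomputable def planeProj (i j : Fin 3) : Space3 →L[ℝ] Space3 :=
  (EuclideanSpace.proj i).smulRight (EuclideanSpace.single i 1)
    + (EuclideanSpace.proj j).smulRight (EuclideanSpace.single j 1)

/-- The rotation by the angle `θ` in the `(i, j)` coordinate plane. -/
noncomputable def planeRot (i j : Fin 3) (θ : ℝ) : Space3 →L[ℝ] Space3 :=
  ContinuousLinearMap.id ℝ Space3 + (Real.cos θ - 1) • planeProj i j + Real.sin θ • rotGen i j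

lemma rotGen_apply (i j k : Fin 3) (x : Space3) :
    rotGen i j x k = x i * (if k = j then 1 else 0) - x j * (if k = i then 1 else 0) := by
  simp [rotGen]

lemma planeRot_apply (i j k : Fin 3) (θ : ℝ) (x : Space3) :
    planeRot i j θ x k = x k
      + (Real.cos θ - 1) * (x i * (if k = i then 1 else 0) + x j * (if k = j then 1 else 0))
      + Real.sin θ * (x i * (if k = j then 1 else 0) - x j * (if k = i then 1 else 0)) := by
  simp [planeRot, planeProj, rotGen, mul_add]

lemma planeRot_zero (i j : Fin 3) : planeRot i j 0 = ContinuousLinearMap.id ℝ Space3 := by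
  ext x k
  simp [planeRot_apply]

lemma space3_norm_sq (x : Space3) : ‖x‖ ^ 2 = x 0 ^ 2 + x 1 ^ 2 + x 2 ^ 2 := by
  simp [EuclideanSpace.norm_sq_eq, Fin.sum_univ_three]

lemma norm_planeRot {i j : Fin 3} (hij : i ≠ j) (θ : ℝ) (x : Space3) :
    ‖planeRot i j θ x‖ = ‖x‖ := by
  have h : ‖planeRot i j θ x‖ ^ 2 = ‖x‖ ^ 2 := by
    have hsc := Real.sin_sq_add_cos_sq θ
    have hs : Real.sin θ ^ 2 = 1 - Real.cos θ ^ 2 := by linarith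
    simp only [space3_norm_sq, planeRot_apply]
    fin_cases i <;> fin_cases j <;> first | exact absurd rfl hij | skip
    all_goals
      simp
      ring_nf
      rw [hs]
      ring
  exact (sq_eq_sq₀ (norm_nonneg _) (norm_nonneg _)).1 h

/-- `planeRot` as a linear isometric equivalence. -/
noncomputable def planeRotIsometry {i j : Fin 3} (hij : i ≠ j) (θ : ℝ) : Space3 ≃ₗᵢ[ℝ] Space3 :=
  LinearIsometry.toLinearIsometryEquiv
    { toLinearMap := (planeRot i j θ : Space3 →ₗ[ℝ] Space3)
      norm_map' := norm_planeRot hij θ } rfl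

lemma planeRotIsometry_apply {i j : Fin 3} (hij : i ≠ j) (θ : ℝ) (x : Space3) :
    planeRotIsometry hij θ x = planeRot i j θ x := rfl

lemma hasDerivAt_planeRot {i j : Fin 3} (hij : i ≠ j) (x : Space3) (θ : ℝ) :
    HasDerivAt (fun s => planeRot i j s x) (rotGen i j (planeRot i j θ x)) θ := by
  have h : HasDerivAt (fun s => planeRot i j s x)
      ((-Real.sin θ) • planeProj i j x + Real.cos θ • rotGen i j x) θ := by
    have := (((Real.hasDerivAt_cos θ).sub_const 1).smul_const (planeProj i j x)).const_add x
      |>.add ((Real.hasDerivAt_sin θ).smul_const (rotGen i j x))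
    exact this
  convert h using 1
  ext k
  simp only [rotGen_apply, planeRot_apply, planeProj, PiLp.add_apply, PiLp.smul_apply,
    _root_.add_apply, ContinuousLinearMap.smulRight_apply, smul_eq_mul]
  fin_cases i <;> fin_cases j <;> first | exact absurd rfl hij | skip
  all_goals
    fin_cases k <;> simp <;> ring

/-- The uniform probability measure on the unit sphere, realized as the law of the direction of
a uniform random point of the unit ball. -/
noncomputable def sphereMeasure : Measure Space3 :=
  (ProbabilityTheory.cond volume (Metric.ball (0 : Space3) 1)).map fun y => ‖y‖⁻¹ • y

lemma measurable_direction : Measurable fun y : Space3 => ‖y‖⁻¹ • y := by fun_prop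

instance : IsProbabilityMeasure sphereMeasure := by
  have : IsProbabilityMeasure (ProbabilityTheory.cond volume (Metric.ball (0 : Space3) 1)) :=
    ProbabilityTheory.cond_isProbabilityMeasure_of_finite
      (Metric.measure_ball_pos volume _ one_pos).ne' measure_ball_lt_top.ne
  exact Measure.isProbabilityMeasure_map measurable_direction.aemeasurable

lemma ae_norm_sphereMeasure : ∀ᵐ y ∂sphereMeasure, ‖y‖ = 1 := by
  rw [sphereMeasure, ae_map_iff measurable_direction.aemeasurable
    (measurableSet_eq_fun measurable_norm measurable_const)]
  have h0 : ∀ᵐ y ∂(volume : Measure Space3), y ≠ 0 := by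
    simp [ae_iff]
  have h1 : ∀ᵐ y ∂(ProbabilityTheory.cond volume (Metric.ball (0 : Space3) 1)), y ≠ 0 :=
    ProbabilityTheory.cond_absolutelyContinuous.ae_le h0
  filter_upwards [h1] with y hy
  rw [norm_smul, norm_inv, norm_norm, inv_mul_cancel₀ (norm_ne_zero_iff.2 hy)]

lemma measurePreserving_sphereMeasure (L : Space3 ≃ₗᵢ[ℝ] Space3) :
    MeasurePreserving L sphereMeasure sphereMeasure := by
  refine ⟨L.continuous.measurable, ?_⟩
  have hb : L ⁻¹' Metric.ball (0 : Space3) 1 = Metric.ball 0 1 := by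
    ext y; simp
  have hr : (volume.restrict (Metric.ball (0 : Space3) 1)).map L
      = volume.restrict (Metric.ball (0 : Space3) 1) := by
    have := (L.measurePreserving.restrict_preimage (s := Metric.ball (0 : Space3) 1)
      measurableSet_ball).map_eq
    rwa [hb] at this
  rw [sphereMeasure, Measure.map_map L.continuous.measurable measurable_direction]
  have hc : (L ∘ fun y : Space3 => ‖y‖⁻¹ • y) = (fun y => ‖y‖⁻¹ • y) ∘ L := by
    ext y; simp
  rw [hc, ← Measure.map_map measurable_direction L.continuous.measurable,
    ProbabilityTheory.cond, Measure.map_smul, hr]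

lemma integrable_sphereMeasure_of_continuous {h : Space3 → ℝ} (hh : Continuous h) :
    Integrable h sphereMeasure := by
  obtain ⟨C, hC⟩ := (isCompact_closedBall (0 : Space3) 1).exists_bound_of_continuousOn
    hh.continuousOn
  refine Integrable.of_bound hh.aestronglyMeasurable C ?_
  filter_upwards [ae_norm_sphereMeasure] with y hy
  exact hC y (by simp [hy])

/-- Infinitesimal rotations have mean zero on the sphere. -/
lemma integral_fderiv_rotGen {h : Space3 → ℝ} (hh : ContDiff ℝ 1 h) {i j : Fin 3} (hij : i ≠ j) :
    ∫ y, fderiv ℝ h y (rotGen i j y) ∂sphereMeasure = 0 := by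
  have hd : Continuous (fderiv ℝ h) := hh.continuous_fderiv one_ne_zero
  obtain ⟨C, hC⟩ := (isCompact_closedBall (0 : Space3) 1).exists_bound_of_continuousOn
    (f := fun y => fderiv ℝ h y (rotGen i j y)) (by fun_prop)
  have hconst : (fun θ => ∫ y, h (planeRot i j θ y) ∂sphereMeasure)
      = fun _ => ∫ y, h y ∂sphereMeasure := by
    funext θ
    exact (measurePreserving_sphereMeasure (planeRotIsometry hij θ)).integral_comp
      (planeRotIsometry hij θ).toHomeomorph.measurableEmbedding h
  have key := (hasDerivAt_integral_of_dominated_loc_of_deriv_le (μ := sphereMeasure)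
    (F := fun θ y => h (planeRot i j θ y)) (x₀ := (0 : ℝ)) (s := univ) (bound := fun _ => C)
    (F' := fun θ y => fderiv ℝ h (planeRot i j θ y) (rotGen i j (planeRot i j θ y)))
    univ_mem (.of_forall fun θ => ?_) ?_ ?_ ?_ ?_ ?_).2
  · rw [hconst] at key
    have := key.unique (hasDerivAt_const 0 _)
    simpa [planeRot_zero] using this
  · exact (hh.continuous.comp (planeRot i j θ).continuous).aestronglyMeasurable
  · exact integrable_sphereMeasure_of_continuous (hh.continuous.comp (planeRot i j 0).continuous)
  · refine Continuous.aestronglyMeasurable ?_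
    fun_prop
  · filter_upwards [ae_norm_sphereMeasure] with y hy θ _
    exact hC _ (by simp [norm_planeRot hij, hy])
  · exact integrable_const C
  · refine .of_forall fun y θ _ => ?_
    exact ((hh.differentiable one_ne_zero _).hasFDerivAt).comp_hasDerivAt θ
      (hasDerivAt_planeRot hij y θ)

/-- Minkowski spacetime `ℝ × ℝ³`. -/
abbrev SpaceTime : Type := ℝ × Space3

/-- The backward light ray displacement with direction `ω` and length `s`. -/
noncomputable def lightRay (q : SpaceTime) : SpaceTime := (-q.1, q.1 • q.2)

/-- The measure `ds ⊗ dσ(ω)` on the parameters of the backward light cone. -/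
noncomputable def coneMeasure : Measure SpaceTime :=
  (volume.restrict (Ioi (0 : ℝ))).prod sphereMeasure

/-- The retarded potential of a source `F` in `ℝ³`. -/
noncomputable def retarded {G : Type} [NormedAddCommGroup G] [NormedSpace ℝ G]
    (F : SpaceTime → G) (z : SpaceTime) : G :=
  ∫ q, q.1 • F (z + lightRay q) ∂coneMeasure

/-- The derivatives of `F` up to order `k` are bounded by `K * exp (lam * t)`. -/
def ExpBdd {G : Type} [NormedAddCommGroup G] [NormedSpace ℝ G]
    (k : ℕ) (K lam : ℝ) (F : SpaceTime → G) : Prop :=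
  ∀ j ≤ k, ∀ z : SpaceTime, ‖iteratedFDeriv ℝ j F z‖ ≤ K * Real.exp (lam * z.1)

lemma continuous_lightRay : Continuous lightRay := by
  unfold lightRay; fun_prop

lemma ae_coneMeasure_fst_pos : ∀ᵐ q ∂coneMeasure, 0 < q.1 :=
  Measure.quasiMeasurePreserving_fst.ae (ae_restrict_mem measurableSet_Ioi)

lemma ae_coneMeasure_norm_snd : ∀ᵐ q ∂coneMeasure, ‖q.2‖ = 1 :=
  Measure.quasiMeasurePreserving_snd.ae ae_norm_sphereMeasure

lemma integrableOn_mul_exp_neg {lam : ℝ} (hl : 0 < lam) :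
    IntegrableOn (fun s : ℝ => s * Real.exp (-(lam * s))) (Ioi 0) := by
  have h := integrableOn_rpow_mul_exp_neg_mul_rpow (s := 1) (p := 1) (b := lam) (by norm_num)
    one_pos hl
  refine h.congr_fun (fun s _ => ?_) measurableSet_Ioi
  simp

lemma integral_mul_exp_neg {lam : ℝ} (hl : 0 < lam) :
    ∫ s in Ioi (0 : ℝ), s * Real.exp (-(lam * s)) = 1 / lam ^ 2 := by
  have h := Real.integral_rpow_mul_exp_neg_mul_Ioi (a := 2) (r := lam) two_pos hl
  rw [Real.Gamma_two, mul_one] at h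
  rw [show (1 / lam) ^ (2 : ℝ) = 1 / lam ^ 2 by
    rw [Real.rpow_two, div_pow, one_pow]] at h
  rw [← h]
  refine setIntegral_congr_fun measurableSet_Ioi fun s _ => ?_
  norm_num

lemma integrable_coneMeasure_weight {lam : ℝ} (hl : 0 < lam) :
    Integrable (fun q : SpaceTime => q.1 * Real.exp (-(lam * q.1))) coneMeasure :=
  (integrableOn_mul_exp_neg hl).integrable.comp_fst sphereMeasure

lemma integral_coneMeasure_weight {lam : ℝ} (hl : 0 < lam) :
    ∫ q, q.1 * Real.exp (-(lam * q.1)) ∂coneMeasure = 1 / lam ^ 2 := by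
  rw [coneMeasure, integral_fun_fst (f := fun s : ℝ => s * Real.exp (-(lam * s))),
    integral_mul_exp_neg hl]
  simp

section Retarded

variable {G : Type} [NormedAddCommGroup G] [NormedSpace ℝ G]

lemma norm_retarded_integrand_le {F : SpaceTime → G} {K lam : ℝ}
    (hF : ∀ z, ‖F z‖ ≤ K * Real.exp (lam * z.1)) (z q : SpaceTime) (hq : 0 < q.1) :
    ‖q.1 • F (z + lightRay q)‖
      ≤ K * Real.exp (lam * z.1) * (q.1 * Real.exp (-(lam * q.1))) := by
  rw [norm_smul, Real.norm_of_nonneg hq.le]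
  refine (mul_le_mul_of_nonneg_left (hF _) hq.le).trans_eq ?_
  have : lam * (z + lightRay q).1 = lam * z.1 + -(lam * q.1) := by
    simp [lightRay]; ring
  rw [this, Real.exp_add]
  ring

lemma aestronglyMeasurable_retarded {F : SpaceTime → G} (hc : Continuous F) (z : SpaceTime) :
    AEStronglyMeasurable (fun q : SpaceTime => q.1 • F (z + lightRay q)) coneMeasure := by
  have := continuous_lightRay
  exact Continuous.aestronglyMeasurable (by fun_prop)

lemma integrable_retarded {F : SpaceTime → G} {K lam : ℝ} (hl : 0 < lam) (hc : Continuous F)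
    (hF : ∀ z, ‖F z‖ ≤ K * Real.exp (lam * z.1)) (z : SpaceTime) :
    Integrable (fun q : SpaceTime => q.1 • F (z + lightRay q)) coneMeasure := by
  refine ((integrable_coneMeasure_weight hl).const_mul (K * Real.exp (lam * z.1))).mono'
    (aestronglyMeasurable_retarded hc z) ?_
  filter_upwards [ae_coneMeasure_fst_pos] with q hq
  exact norm_retarded_integrand_le hF z q hq

lemma norm_retarded_le {F : SpaceTime → G} {K lam : ℝ} (hl : 0 < lam)
    (hF : ∀ z, ‖F z‖ ≤ K * Real.exp (lam * z.1)) (z : SpaceTime) :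
    ‖retarded F z‖ ≤ K / lam ^ 2 * Real.exp (lam * z.1) := by
  refine (norm_integral_le_of_norm_le
    ((integrable_coneMeasure_weight hl).const_mul (K * Real.exp (lam * z.1))) ?_).trans_eq ?_
  · filter_upwards [ae_coneMeasure_fst_pos] with q hq
    exact norm_retarded_integrand_le hF z q hq
  · rw [integral_const_mul, integral_coneMeasure_weight hl]
    ring

lemma hasFDerivAt_retarded {F : SpaceTime → G} {K lam : ℝ} (hl : 0 < lam) (hc : ContDiff ℝ 1 F)
    (hF : ∀ z, ‖F z‖ ≤ K * Real.exp (lam * z.1))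
    (hF' : ∀ z, ‖fderiv ℝ F z‖ ≤ K * Real.exp (lam * z.1)) (z : SpaceTime) :
    HasFDerivAt (retarded F) (retarded (fderiv ℝ F) z) z := by
  have hK : 0 ≤ K := by
    have := (norm_nonneg _).trans (hF 0)
    simpa using this
  have hd := hc.continuous_fderiv one_ne_zero
  refine hasFDerivAt_integral_of_dominated_of_fderiv_le (s := Metric.ball z 1)
    (F' := fun w q => q.1 • fderiv ℝ F (w + lightRay q))
    (bound := fun q => K * Real.exp (lam * (z.1 + 1)) * (q.1 * Real.exp (-(lam * q.1))))
    (Metric.ball_mem_nhds z one_pos)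
    (.of_forall fun w => aestronglyMeasurable_retarded hc.continuous w)
    (integrable_retarded hl hc.continuous hF z)
    (aestronglyMeasurable_retarded hd z) ?_
    ((integrable_coneMeasure_weight hl).const_mul _) ?_
  · filter_upwards [ae_coneMeasure_fst_pos] with q hq w hw
    refine (norm_retarded_integrand_le hF' w q hq).trans ?_
    have h1 : w.1 ≤ z.1 + 1 := by
      have h2 : |w.1 - z.1| < 1 := by
        refine lt_of_le_of_lt ?_ (mem_ball_iff_norm.1 hw)
        exact norm_fst_le (w - z)
      linarith [(abs_lt.1 h2).2]
    gcongr
  · refine .of_forall fun q w _ => ?_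
    have h1 : HasFDerivAt F (fderiv ℝ F (w + lightRay q)) (w + lightRay q) :=
      (hc.differentiable one_ne_zero _).hasFDerivAt
    have h2 := h1.comp w ((hasFDerivAt_id w).add_const (lightRay q))
    exact h2.const_smul q.1

lemma ExpBdd.norm_le {F : SpaceTime → G} {k : ℕ} {K lam : ℝ} (h : ExpBdd k K lam F)
    (z : SpaceTime) : ‖F z‖ ≤ K * Real.exp (lam * z.1) := by
  simpa using h 0 (Nat.zero_le k) z

lemma ExpBdd.norm_fderiv_le {F : SpaceTime → G} {k : ℕ} {K lam : ℝ} (h : ExpBdd (k + 1) K lam F)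
    (z : SpaceTime) : ‖fderiv ℝ F z‖ ≤ K * Real.exp (lam * z.1) := by
  have h1 := h 1 (by omega) z
  rwa [← zero_add 1, ← norm_iteratedFDeriv_fderiv, norm_iteratedFDeriv_zero] at h1

lemma ExpBdd.fderiv {F : SpaceTime → G} {k : ℕ} {K lam : ℝ} (h : ExpBdd (k + 1) K lam F) :
    ExpBdd k K lam (fderiv ℝ F) := by
  intro j hj z
  rw [norm_iteratedFDeriv_fderiv]
  exact h (j + 1) (by omega) z

end Retarded

lemma contDiff_retarded {lam K : ℝ} (hl : 0 < lam) (k : ℕ) :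
    ∀ {G : Type} [NormedAddCommGroup G] [NormedSpace ℝ G] {F : SpaceTime → G},
      ContDiff ℝ (k + 1) F → ExpBdd (k + 1) K lam F →
      ContDiff ℝ k (retarded F) ∧ ExpBdd k (K / lam ^ 2) lam (retarded F) := by
  induction k with
  | zero =>
    intro G _ _ F hF hb
    have hF1 : ContDiff ℝ 1 F := by simpa using hF
    refine ⟨?_, fun j hj z => ?_⟩
    · have : Differentiable ℝ (retarded F) := fun z =>
        (hasFDerivAt_retarded hl hF1 hb.norm_le hb.norm_fderiv_le z).differentiableAt
      simpa using this.continuous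
    · obtain rfl : j = 0 := by omega
      simpa using norm_retarded_le hl hb.norm_le z
  | succ k ih =>
    intro G _ _ F hF hb
    have hF1 : ContDiff ℝ 1 F := hF.of_le (by norm_cast; omega)
    have hd : ∀ z, HasFDerivAt (retarded F) (retarded (fderiv ℝ F) z) z :=
      hasFDerivAt_retarded hl hF1 hb.norm_le hb.norm_fderiv_le
    have he : fderiv ℝ (retarded F) = retarded (fderiv ℝ F) := funext fun z => (hd z).fderiv
    have hF' : ContDiff ℝ (k + 1) (fderiv ℝ F) := by
      refine hF.fderiv_right ?_
      norm_cast
    obtain ⟨h1, h2⟩ := ih hF' hb.fderiv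
    refine ⟨?_, fun j hj z => ?_⟩
    · push_cast
      rw [contDiff_succ_iff_fderiv]
      exact ⟨fun z => (hd z).differentiableAt, by simp, he ▸ h1⟩
    · rcases j with _ | j
      · simpa using norm_retarded_le hl hb.norm_le z
      · rw [← norm_iteratedFDeriv_fderiv, he]
        exact h2 j (by omega) z

/-- The derivative of a function on spacetime in a fixed direction. -/
noncomputable def dirDeriv (v : SpaceTime) (F : SpaceTime → ℝ) (z : SpaceTime) : ℝ :=
  fderiv ℝ F z v

/-- The unit vector in the time direction. -/
def timeVec : SpaceTime := (1, 0)

/-- The unit vectors in the spatial coordinate directions. -/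
noncomputable def spaceVec (i : Fin 3) : SpaceTime := (0, EuclideanSpace.single i 1)

/-- The flat wave operator `∂_t² - Δ`. -/
noncomputable def box (F : SpaceTime → ℝ) (z : SpaceTime) : ℝ :=
  dirDeriv timeVec (dirDeriv timeVec F) z - ∑ i, dirDeriv (spaceVec i) (dirDeriv (spaceVec i) F) z

lemma contDiff_dirDeriv {F : SpaceTime → ℝ} {k : ℕ} (hF : ContDiff ℝ (k + 1) F) (v : SpaceTime) :
    ContDiff ℝ k (dirDeriv v F) :=
  (hF.fderiv_right (m := k) le_rfl).clm_apply contDiff_const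

lemma contDiff_top_dirDeriv {F : SpaceTime → ℝ} (hF : ContDiff ℝ (⊤ : ℕ∞) F) (v : SpaceTime) :
    ContDiff ℝ (⊤ : ℕ∞) (dirDeriv v F) :=
  (hF.fderiv_right (m := (⊤ : ℕ∞)) (by simp)).clm_apply contDiff_const

lemma dirDeriv_dirDeriv {F : SpaceTime → ℝ} (hF : ContDiff ℝ 2 F) (v w z : SpaceTime) :
    dirDeriv v (dirDeriv w F) z = fderiv ℝ (fderiv ℝ F) z v w := by
  have h : HasFDerivAt (fderiv ℝ F) (fderiv ℝ (fderiv ℝ F) z) z :=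
    ((hF.fderiv_right (m := 1) (by norm_num)).differentiable one_ne_zero z).hasFDerivAt
  have := (h.clm_apply (hasFDerivAt_const w z)).fderiv
  unfold dirDeriv
  rw [this]
  simp

lemma ExpBdd.dirDeriv {F : SpaceTime → ℝ} {k : ℕ} {K lam : ℝ} (hF : ContDiff ℝ (k + 1) F)
    (h : ExpBdd (k + 1) K lam F) (v : SpaceTime) :
    ExpBdd k (‖v‖ * K) lam (dirDeriv v F) := by
  intro j hj z
  have h1 : ContDiff ℝ k (_root_.fderiv ℝ F) := hF.fderiv_right le_rfl
  have h2 := (ContinuousLinearMap.apply ℝ ℝ v).norm_iteratedFDeriv_comp_left (x := z)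
    h1.contDiffAt (n := j) (by exact_mod_cast hj)
  have h3 : ‖ContinuousLinearMap.apply ℝ ℝ v‖ ≤ ‖v‖ :=
    ContinuousLinearMap.opNorm_le_bound _ (norm_nonneg _) fun L => by
      simpa [mul_comm] using L.le_opNorm v
  calc ‖iteratedFDeriv ℝ j (_root_.dirDeriv v F) z‖
      ≤ ‖ContinuousLinearMap.apply ℝ ℝ v‖ * ‖iteratedFDeriv ℝ j (_root_.fderiv ℝ F) z‖ := h2
    _ ≤ ‖v‖ * (K * Real.exp (lam * z.1)) :=
        mul_le_mul h3 (h.fderiv j hj z) (norm_nonneg _) (norm_nonneg _)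
    _ = _ := by ring

lemma dirDeriv_retarded {F : SpaceTime → ℝ} {K lam : ℝ} (hl : 0 < lam) (hF : ContDiff ℝ 1 F)
    (h : ExpBdd 1 K lam F) (v : SpaceTime) :
    dirDeriv v (retarded F) = retarded (dirDeriv v F) := by
  funext z
  have hd := hasFDerivAt_retarded hl hF h.norm_le (h.norm_fderiv_le (k := 0)) z
  unfold dirDeriv
  rw [hd.fderiv]
  unfold retarded
  rw [ContinuousLinearMap.integral_apply
    (integrable_retarded hl (hF.continuous_fderiv one_ne_zero) (h.norm_fderiv_le (k := 0)) z)]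
  rfl

lemma space3_eq_sum (y : Space3) :
    y = y 0 • EuclideanSpace.single 0 1 + y 1 • EuclideanSpace.single 1 1
      + y 2 • EuclideanSpace.single 2 1 := by
  ext k
  fin_cases k <;> simp

lemma rotGen_eq (i j : Fin 3) (y : Space3) :
    rotGen i j y = y i • EuclideanSpace.single j 1 - y j • EuclideanSpace.single i 1 := rfl

lemma sum_rotGen_bilinear (B : Space3 →L[ℝ] Space3 →L[ℝ] ℝ) (D : Space3 →L[ℝ] ℝ) (s : ℝ)
    {y : Space3} (hy : ‖y‖ = 1) :
    (s * B (rotGen 0 1 y) (rotGen 0 1 y) + D (rotGen 0 1 (rotGen 0 1 y)))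
      + (s * B (rotGen 0 2 y) (rotGen 0 2 y) + D (rotGen 0 2 (rotGen 0 2 y)))
      + (s * B (rotGen 1 2 y) (rotGen 1 2 y) + D (rotGen 1 2 (rotGen 1 2 y)))
      = s * (∑ i, B (EuclideanSpace.single i 1) (EuclideanSpace.single i 1)) - s * B y y
        - 2 * D y := by
  have h1 : y 0 ^ 2 + y 1 ^ 2 + y 2 ^ 2 = 1 := by rw [← space3_norm_sq, hy]; norm_num
  have hBy : B y y = B (y 0 • EuclideanSpace.single 0 1 + y 1 • EuclideanSpace.single 1 1
      + y 2 • EuclideanSpace.single 2 1) (y 0 • EuclideanSpace.single 0 1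
      + y 1 • EuclideanSpace.single 1 1 + y 2 • EuclideanSpace.single 2 1) := by
    rw [← space3_eq_sum y]
  have hDy : D y = D (y 0 • EuclideanSpace.single 0 1 + y 1 • EuclideanSpace.single 1 1
      + y 2 • EuclideanSpace.single 2 1) := by rw [← space3_eq_sum y]
  rw [hBy, hDy, Fin.sum_univ_three]
  simp only [rotGen_eq]
  simp
  linear_combination (s * B (EuclideanSpace.single 0 1) (EuclideanSpace.single 0 1)
    + s * B (EuclideanSpace.single 1 1) (EuclideanSpace.single 1 1)
    + s * B (EuclideanSpace.single 2 1) (EuclideanSpace.single 2 1)) * h1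

/-- The second derivative of a function on spacetime, as a bilinear form in spatial directions. -/
noncomputable def spatialHessian (F : SpaceTime → ℝ) (z : SpaceTime) :
    Space3 →L[ℝ] Space3 →L[ℝ] ℝ :=
  (fderiv ℝ (fderiv ℝ F) z).bilinearComp (ContinuousLinearMap.inr ℝ ℝ Space3)
    (ContinuousLinearMap.inr ℝ ℝ Space3)

lemma spatialHessian_apply (F : SpaceTime → ℝ) (z : SpaceTime) (v w : Space3) :
    spatialHessian F z v w = fderiv ℝ (fderiv ℝ F) z (0, v) (0, w) := rfl

/-- The spherical mean of the spherical Laplacian vanishes. -/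
lemma integral_sphere_laplacian {F : SpaceTime → ℝ} (hF : ContDiff ℝ 2 F) (z : SpaceTime) (s : ℝ) :
    ∫ y, (s * (∑ i, dirDeriv (spaceVec i) (dirDeriv (spaceVec i) F) (z + lightRay (s, y)))
      - s * fderiv ℝ (fderiv ℝ F) (z + lightRay (s, y)) (0, y) (0, y)
      - 2 * fderiv ℝ F (z + lightRay (s, y)) (0, y)) ∂sphereMeasure = 0 := by
  have hF1 : ContDiff ℝ 1 (fderiv ℝ F) := hF.fderiv_right (by norm_num)
  have hc1 := hF1.continuous
  have hc2 := hF1.continuous_fderiv one_ne_zero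
  have hcl := continuous_lightRay
  have hline : ∀ y : Space3, HasFDerivAt (fun y : Space3 => z + lightRay (s, y))
      (s • ContinuousLinearMap.inr ℝ ℝ Space3) y := by
    intro y
    have h : HasFDerivAt (fun y : Space3 => (z + (-s, 0)) + (s • ContinuousLinearMap.inr ℝ ℝ Space3) y)
        (s • ContinuousLinearMap.inr ℝ ℝ Space3) y :=
      (ContinuousLinearMap.hasFDerivAt (s • ContinuousLinearMap.inr ℝ ℝ Space3)).const_add _
    convert h using 2
    simp [lightRay, add_assoc]
  have hsmooth : ContDiff ℝ 1 fun y : Space3 => z + lightRay (s, y) := by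
    unfold lightRay; fun_prop
  have key : ∀ i j : Fin 3, i ≠ j →
      ∫ y, (s * spatialHessian F (z + lightRay (s, y)) (rotGen i j y) (rotGen i j y)
        + ((fderiv ℝ F (z + lightRay (s, y))).comp (ContinuousLinearMap.inr ℝ ℝ Space3))
          (rotGen i j (rotGen i j y))) ∂sphereMeasure = 0 := by
    intro i j hij
    have hh : ContDiff ℝ 1 fun y : Space3 =>
        fderiv ℝ F (z + lightRay (s, y)) (0, rotGen i j y) :=
      (hF1.comp hsmooth).clm_apply (contDiff_const.prodMk (rotGen i j).contDiff)
    rw [← integral_fderiv_rotGen hh hij]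
    refine integral_congr_ae (.of_forall fun y => ?_)
    have h1 : HasFDerivAt (fun y : Space3 => fderiv ℝ F (z + lightRay (s, y)))
        ((fderiv ℝ (fderiv ℝ F) (z + lightRay (s, y))).comp
          (s • ContinuousLinearMap.inr ℝ ℝ Space3)) y :=
      ((hF1.differentiable one_ne_zero _).hasFDerivAt).comp y (hline y)
    have h2 : HasFDerivAt (fun y : Space3 => ((0 : ℝ), rotGen i j y))
        ((ContinuousLinearMap.inr ℝ ℝ Space3).comp (rotGen i j)) y :=
      ((ContinuousLinearMap.inr ℝ ℝ Space3).comp (rotGen i j)).hasFDerivAt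
    simp only [(h1.clm_apply h2).fderiv]
    simp [spatialHessian_apply]
    ring
  have hinteg : ∀ i j : Fin 3, Integrable (fun y =>
      s * spatialHessian F (z + lightRay (s, y)) (rotGen i j y) (rotGen i j y)
        + ((fderiv ℝ F (z + lightRay (s, y))).comp (ContinuousLinearMap.inr ℝ ℝ Space3))
          (rotGen i j (rotGen i j y))) sphereMeasure := by
    intro i j
    refine integrable_sphereMeasure_of_continuous ?_
    simp only [spatialHessian_apply, ContinuousLinearMap.comp_apply,
      ContinuousLinearMap.inr_apply]
    fun_prop
  have hinteg' := (hinteg 0 1).add (hinteg 0 2)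
  simp only [Pi.add_def] at hinteg'
  have hsum := congrArg₂ (· + ·) (congrArg₂ (· + ·) (key 0 1 (by decide)) (key 0 2 (by decide)))
    (key 1 2 (by decide))
  simp only at hsum
  rw [← integral_add (hinteg 0 1) (hinteg 0 2), ← integral_add hinteg' (hinteg 1 2)]
    at hsum
  rw [show (0 : ℝ) + 0 + 0 = 0 by norm_num] at hsum
  refine Eq.trans (integral_congr_ae ?_) hsum
  filter_upwards [ae_norm_sphereMeasure] with y hy
  have := sum_rotGen_bilinear (spatialHessian F (z + lightRay (s, y)))
    ((fderiv ℝ F (z + lightRay (s, y))).comp (ContinuousLinearMap.inr ℝ ℝ Space3)) s hy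
  refine Eq.trans ?_ this.symm
  simp only [dirDeriv_dirDeriv hF, spaceVec, spatialHessian_apply,
    ContinuousLinearMap.comp_apply, ContinuousLinearMap.inr_apply]

lemma ExpBdd.norm_fderiv_fderiv_le {F : SpaceTime → ℝ} {K lam : ℝ} (h : ExpBdd 2 K lam F)
    (z : SpaceTime) : ‖_root_.fderiv ℝ (_root_.fderiv ℝ F) z‖ ≤ K * Real.exp (lam * z.1) :=
  ExpBdd.norm_fderiv_le (k := 0) (ExpBdd.fderiv (k := 1) h) z

/-- The derivative of `-(s * DF(1, y) + F)` along the light ray with direction `y`. -/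
noncomputable def rayDensity (F : SpaceTime → ℝ) (z : SpaceTime) (q : SpaceTime) : ℝ :=
  q.1 * fderiv ℝ (fderiv ℝ F) (z + lightRay q) timeVec timeVec
    - q.1 * fderiv ℝ (fderiv ℝ F) (z + lightRay q) (0, q.2) (0, q.2)
    - 2 * fderiv ℝ F (z + lightRay q) (0, q.2)

lemma continuous_rayDensity {F : SpaceTime → ℝ} (hF : ContDiff ℝ 2 F) (z : SpaceTime) :
    Continuous (rayDensity F z) := by
  have hF1 : ContDiff ℝ 1 (fderiv ℝ F) := hF.fderiv_right (by norm_num)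
  have hc1 := hF1.continuous
  have hc2 := hF1.continuous_fderiv one_ne_zero
  have hcl := continuous_lightRay
  unfold rayDensity
  fun_prop

lemma exp_add_lightRay (lam : ℝ) (z q : SpaceTime) :
    Real.exp (lam * (z + lightRay q).1) = Real.exp (lam * z.1) * Real.exp (-(lam * q.1)) := by
  rw [← Real.exp_add]
  simp [lightRay]
  ring

lemma abs_rayDensity_le {F : SpaceTime → ℝ} {K lam : ℝ} (h : ExpBdd 2 K lam F) (z : SpaceTime)
    {q : SpaceTime} (hq : 0 ≤ q.1) (hy : ‖q.2‖ = 1) :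
    ‖rayDensity F z q‖ ≤ 2 * (K * Real.exp (lam * z.1))
      * (q.1 * Real.exp (-(lam * q.1)) + Real.exp (-(lam * q.1))) := by
  have hv : ‖((0 : ℝ), q.2)‖ = 1 := by simp [Prod.norm_def, hy]
  have ht : ‖timeVec‖ = 1 := by simp [Prod.norm_def, timeVec]
  set w := z + lightRay q with hw
  have h2 := h.norm_fderiv_fderiv_le w
  have h1 := h.norm_fderiv_le (k := 1) w
  rw [hw, exp_add_lightRay, ← hw] at h1 h2
  have a1 : |fderiv ℝ (fderiv ℝ F) w timeVec timeVec| ≤ ‖fderiv ℝ (fderiv ℝ F) w‖ := by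
    simpa [ht] using (fderiv ℝ (fderiv ℝ F) w).le_opNorm₂ timeVec timeVec
  have a2 : |fderiv ℝ (fderiv ℝ F) w (0, q.2) (0, q.2)| ≤ ‖fderiv ℝ (fderiv ℝ F) w‖ := by
    simpa [hv] using (fderiv ℝ (fderiv ℝ F) w).le_opNorm₂ (0, q.2) (0, q.2)
  have a3 : |fderiv ℝ F w (0, q.2)| ≤ ‖fderiv ℝ F w‖ := by
    simpa [hv] using (fderiv ℝ F w).le_opNorm (0, q.2)
  have b1 := abs_le.1 (a1.trans h2)
  have b2 := abs_le.1 (a2.trans h2)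
  have b3 := abs_le.1 (a3.trans h1)
  rw [Real.norm_eq_abs, rayDensity, ← hw, abs_le]
  constructor <;>
  nlinarith [mul_le_mul_of_nonneg_left b1.1 hq, mul_le_mul_of_nonneg_left b1.2 hq,
    mul_le_mul_of_nonneg_left b2.1 hq, mul_le_mul_of_nonneg_left b2.2 hq]

lemma integrableOn_rayWeight {lam : ℝ} (hl : 0 < lam) (C : ℝ) :
    IntegrableOn (fun s : ℝ => C * (s * Real.exp (-(lam * s)) + Real.exp (-(lam * s)))) (Ioi 0) := by
  have h : IntegrableOn (fun s : ℝ => Real.exp (-(lam * s))) (Ioi 0) := by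
    simpa using exp_neg_integrableOn_Ioi 0 hl
  exact ((integrableOn_mul_exp_neg hl).add h).const_mul C

lemma hasDerivAt_ray {F : SpaceTime → ℝ} (hF : ContDiff ℝ 2 F) (z : SpaceTime) (y : Space3)
    (s : ℝ) :
    HasDerivAt (fun s => -(s * fderiv ℝ F (z + lightRay (s, y)) (1, y) + F (z + lightRay (s, y))))
      (rayDensity F z (s, y)) s := by
  have hF1 : ContDiff ℝ 1 (fderiv ℝ F) := hF.fderiv_right (by norm_num)
  have hγ : HasDerivAt (fun s => z + lightRay (s, y)) (-1, y) s := by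
    have h1 := (hasDerivAt_id s).neg.prodMk ((hasDerivAt_id s).smul_const y)
    simpa [lightRay] using h1.const_add z
  have h1 : HasDerivAt (fun s => fderiv ℝ F (z + lightRay (s, y)))
      (fderiv ℝ (fderiv ℝ F) (z + lightRay (s, y)) (-1, y)) s :=
    ((hF1.differentiable one_ne_zero _).hasFDerivAt).comp_hasDerivAt s hγ
  have h0 : HasDerivAt (fun s => F (z + lightRay (s, y)))
      (fderiv ℝ F (z + lightRay (s, y)) (-1, y)) s :=
    ((hF.differentiable two_ne_zero _).hasFDerivAt).comp_hasDerivAt s hγ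
  have h2 := ((hasDerivAt_id s).mul (h1.clm_apply (hasDerivAt_const s ((1 : ℝ), y)))).add h0
  refine h2.neg.congr_deriv ?_
  have hsym : IsSymmSndFDerivAt ℝ F (z + lightRay (s, y)) :=
    hF.contDiffAt.isSymmSndFDerivAt (by simp)
  have e1 : ((1 : ℝ), y) = timeVec + (0, y) := by simp [timeVec]
  have e2 : ((-1 : ℝ), y) = -timeVec + (0, y) := by simp [timeVec]
  rw [e1, e2]
  unfold rayDensity
  have := hsym.eq timeVec ((0 : ℝ), y)
  simp only [map_add, map_neg, _root_.add_apply, _root_.neg_apply, id, map_zero]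
  rw [this]
  ring

lemma integral_rayDensity {F : SpaceTime → ℝ} {K lam : ℝ} (hl : 0 < lam) (hF : ContDiff ℝ 2 F)
    (h : ExpBdd 2 K lam F) (z : SpaceTime) {y : Space3} (hy : ‖y‖ = 1) :
    ∫ s in Ioi (0 : ℝ), rayDensity F z (s, y) = F z := by
  have hK : 0 ≤ K := by simpa using (norm_nonneg _).trans (h.norm_le 0)
  have hinteg : IntegrableOn (fun s => rayDensity F z (s, y)) (Ioi 0) := by
    refine (integrableOn_rayWeight hl (2 * (K * Real.exp (lam * z.1)))).mono'
      ((continuous_rayDensity hF z).comp (by fun_prop : Continuous fun s : ℝ => (s, y))).aestronglyMeasurable ?_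
    filter_upwards [ae_restrict_mem measurableSet_Ioi] with s hs
    exact abs_rayDensity_le h z (q := (s, y)) (le_of_lt hs) hy
  have hlim : Tendsto (fun s => -(s * fderiv ℝ F (z + lightRay (s, y)) (1, y)
      + F (z + lightRay (s, y)))) atTop (nhds 0) := by
    have e0 : Tendsto (fun s : ℝ => Real.exp (-(lam * s))) atTop (nhds 0) :=
      Real.tendsto_exp_neg_atTop_nhds_zero.comp (tendsto_id.const_mul_atTop hl)
    have e1 : Tendsto (fun s : ℝ => s * Real.exp (-(lam * s))) atTop (nhds 0) := by
      have := Real.tendsto_pow_mul_exp_neg_atTop_nhds_zero 1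
      have := (this.comp (tendsto_id.const_mul_atTop hl)).const_mul (1 / lam)
      simp only [mul_zero] at this
      refine this.congr fun s => ?_
      simp
      field_simp
    have e2 := (e1.add e0).const_mul (K * Real.exp (lam * z.1))
    simp only [add_zero, mul_zero] at e2
    refine squeeze_zero_norm' ?_ e2
    filter_upwards [eventually_ge_atTop 0] with s hs
    have h1 := h.norm_fderiv_le (k := 1) (z + lightRay (s, y))
    have h0 := h.norm_le (z + lightRay (s, y))
    rw [exp_add_lightRay] at h1 h0
    have hv : ‖((1 : ℝ), y)‖ = 1 := by simp [Prod.norm_def, hy]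
    have h2 : ‖fderiv ℝ F (z + lightRay (s, y)) (1, y)‖ ≤ ‖fderiv ℝ F (z + lightRay (s, y))‖ := by
      simpa [hv] using (fderiv ℝ F (z + lightRay (s, y))).le_opNorm (1, y)
    rw [norm_neg]
    refine (norm_add_le _ _).trans ?_
    rw [norm_mul, Real.norm_of_nonneg hs]
    have := mul_le_mul_of_nonneg_left (h2.trans h1) hs
    dsimp only at *
    linarith
  have := integral_Ioi_of_hasDerivAt_of_tendsto
    (hasDerivAt_ray hF z y 0).continuousAt.continuousWithinAt
    (fun s _ => hasDerivAt_ray hF z y s) hinteg hlim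
  rw [this]
  have e : ((0 : ℝ), (0 : Space3)) = 0 := rfl
  simp [lightRay, e]

/-- The retarded potential solves the inhomogeneous wave equation. -/
lemma box_retarded {F : SpaceTime → ℝ} {K lam : ℝ} (hl : 0 < lam) (hF : ContDiff ℝ 2 F)
    (h : ExpBdd 2 K lam F) : box (retarded F) = F := by
  have hF1 : ContDiff ℝ 1 F := hF.of_le (by norm_num)
  have hd2 : ∀ v, dirDeriv v (dirDeriv v (retarded F)) = retarded (dirDeriv v (dirDeriv v F)) := by
    intro v
    rw [dirDeriv_retarded hl hF1 (fun j hj => h j (by omega)) v,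
      dirDeriv_retarded hl (contDiff_dirDeriv (k := 1) (by norm_num; exact hF) v)
        (ExpBdd.dirDeriv (k := 1) (by norm_num; exact hF) h v)]
  have hc : ∀ v, Continuous (dirDeriv v (dirDeriv v F)) := fun v =>
    (contDiff_dirDeriv (k := 0)
      (by simpa using contDiff_dirDeriv (k := 1) (by norm_num; exact hF) v) v).continuous
  have hi : ∀ v z, Integrable (fun q : SpaceTime =>
      q.1 • dirDeriv v (dirDeriv v F) (z + lightRay q)) coneMeasure := by
    intro v z
    refine integrable_retarded hl (hc v) (ExpBdd.norm_le (k := 0) (ExpBdd.dirDeriv (by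
        simpa using contDiff_dirDeriv (k := 1) (by norm_num; exact hF) v)
        (ExpBdd.dirDeriv (k := 1) (by norm_num; exact hF) h v) v)) z
  funext z
  unfold box
  simp only [hd2]
  unfold retarded
  rw [← integral_finsetSum _ fun i _ => hi (spaceVec i) z,
    ← integral_sub (hi timeVec z) (integrable_finsetSum _ fun i _ => hi (spaceVec i) z)]
  have hinteg := (hi timeVec z).sub (integrable_finsetSum Finset.univ fun i _ => hi (spaceVec i) z)
  simp only [Pi.sub_def] at hinteg
  have hray : Integrable (rayDensity F z) coneMeasure := by
    refine Integrable.mono' ((integrableOn_rayWeight hl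
      (2 * (K * Real.exp (lam * z.1)))).integrable.comp_fst sphereMeasure)
      (continuous_rayDensity hF z).aestronglyMeasurable ?_
    filter_upwards [ae_coneMeasure_fst_pos, ae_coneMeasure_norm_snd] with q hq hy
    exact abs_rayDensity_le h z hq.le hy
  have hcl := continuous_lightRay
  have hF1' : ContDiff ℝ 1 (fderiv ℝ F) := hF.fderiv_right (by norm_num)
  have hc1 := hF1'.continuous
  have hc2 := hF1'.continuous_fderiv one_ne_zero
  rw [coneMeasure, integral_prod _ hinteg]
  have hinner : ∀ s : ℝ, ∫ y, (s • dirDeriv timeVec (dirDeriv timeVec F) (z + lightRay (s, y))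
      - ∑ i, s • dirDeriv (spaceVec i) (dirDeriv (spaceVec i) F) (z + lightRay (s, y)))
      ∂sphereMeasure = ∫ y, rayDensity F z (s, y) ∂sphereMeasure := by
    intro s
    rw [← add_zero (∫ y, (_ - _) ∂sphereMeasure), ← integral_sphere_laplacian hF z s,
      ← integral_add]
    · refine integral_congr_ae (.of_forall fun y => ?_)
      simp only [rayDensity, dirDeriv_dirDeriv hF, smul_eq_mul, ← Finset.mul_sum]
      ring
    · refine integrable_sphereMeasure_of_continuous ?_
      have := hc timeVec
      have := fun i => hc (spaceVec i)
      fun_prop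
    · refine integrable_sphereMeasure_of_continuous ?_
      have := fun i => hc (spaceVec i)
      fun_prop
  simp only [hinner]
  rw [integral_integral_swap (f := fun s y => rayDensity F z (s, y)) hray]
  rw [integral_congr_ae (g := fun _ => F z) ?_]
  · simp
  · filter_upwards [ae_norm_sphereMeasure] with y hy
    exact integral_rayDensity hl hF h z hy

lemma ExpBdd.retarded_of_succ {lam : ℝ} (hl : 0 < lam) (k : ℕ) :
    ∀ {G : Type} [NormedAddCommGroup G] [NormedSpace ℝ G] {F : SpaceTime → G} {K K' : ℝ},
      ContDiff ℝ (k + 1) F → ExpBdd (k + 1) K' lam F → ExpBdd k K lam F →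
      ExpBdd k (K / lam ^ 2) lam (retarded F) := by
  induction k with
  | zero =>
    intro G _ _ F K K' hF hb' hb j hj z
    obtain rfl : j = 0 := by omega
    simpa using norm_retarded_le hl hb.norm_le z
  | succ k ih =>
    intro G _ _ F K K' hF hb' hb j hj z
    rcases j with _ | j
    · simpa using norm_retarded_le hl hb.norm_le z
    · have hF1 : ContDiff ℝ 1 F := hF.of_le (by norm_cast; omega)
      have he : _root_.fderiv ℝ (retarded F) = retarded (_root_.fderiv ℝ F) := funext fun z =>
        (hasFDerivAt_retarded hl hF1 hb'.norm_le hb'.norm_fderiv_le z).fderiv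
      rw [← norm_iteratedFDeriv_fderiv, he]
      refine ih ?_ hb'.fderiv hb.fderiv j (by omega) z
      exact hF.fderiv_right (by norm_cast)

/-- Smooth functions all of whose derivatives grow slower than any exponential `exp (lam * t)`
with `1 ≤ lam` as `t → ∞` and decay faster as `t → -∞`. -/
structure Tame (F : SpaceTime → ℝ) : Prop where
  smooth : ContDiff ℝ (⊤ : ℕ∞) F
  bdd : ∀ k : ℕ, ∀ lam : ℝ, 1 ≤ lam → ∃ K, ExpBdd k K lam F

/-- Smooth functions with globally bounded derivatives of each order. -/
structure BddDerivs (V : SpaceTime → ℝ) : Prop where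
  smooth : ContDiff ℝ (⊤ : ℕ∞) V
  bdd : ∀ k : ℕ, ∃ C, ∀ j ≤ k, ∀ z, ‖iteratedFDeriv ℝ j V z‖ ≤ C

lemma contDiff_nat {E F : Type*} [NormedAddCommGroup E] [NormedSpace ℝ E] [NormedAddCommGroup F]
    [NormedSpace ℝ F] {f : E → F} (h : ContDiff ℝ (⊤ : ℕ∞) f) (k : ℕ) : ContDiff ℝ k f :=
  h.of_le (by exact_mod_cast le_top)

lemma Tame.retarded {F : SpaceTime → ℝ} (h : Tame F) : Tame (retarded F) := by
  refine ⟨contDiff_infty.2 fun k => ?_, fun k lam hl => ?_⟩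
  · obtain ⟨K, hK⟩ := h.bdd (k + 1) 1 le_rfl
    exact (contDiff_retarded one_pos k (contDiff_nat h.smooth (k + 1)) hK).1
  · obtain ⟨K, hK⟩ := h.bdd (k + 1) lam hl
    exact ⟨_, (contDiff_retarded (one_pos.trans_le hl) k (contDiff_nat h.smooth (k + 1)) hK).2⟩

lemma ExpBdd.retarded {F : SpaceTime → ℝ} {k : ℕ} {K lam : ℝ} (hl : 1 ≤ lam) (h : Tame F)
    (hb : ExpBdd k K lam F) : ExpBdd k (K / lam ^ 2) lam (_root_.retarded F) := by
  obtain ⟨K', hK'⟩ := h.bdd (k + 1) lam hl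
  exact retarded_of_succ (one_pos.trans_le hl) k (contDiff_nat h.smooth (k + 1)) hK' hb

lemma ExpBdd.mul {V F : SpaceTime → ℝ} {k : ℕ} {C K lam : ℝ} (hV : ContDiff ℝ k V)
    (hF : ContDiff ℝ k F) (hC : ∀ j ≤ k, ∀ z, ‖iteratedFDeriv ℝ j V z‖ ≤ C)
    (h : ExpBdd k K lam F) : ExpBdd k (2 ^ k * C * K) lam fun z => V z * F z := by
  intro j hj z
  have hC0 : 0 ≤ C := (norm_nonneg _).trans (hC 0 (Nat.zero_le k) 0)
  have hK0 : 0 ≤ K * Real.exp (lam * z.1) := (norm_nonneg _).trans (h.norm_le z)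
  refine (norm_iteratedFDeriv_mul_le hV hF z (by exact_mod_cast hj)).trans ?_
  calc _ ≤ ∑ i ∈ Finset.range (j + 1), (j.choose i : ℝ) * C * (K * Real.exp (lam * z.1)) := by
        refine Finset.sum_le_sum fun i hi => ?_
        have hi' : i ≤ j := Nat.lt_succ_iff.1 (Finset.mem_range.1 hi)
        have h1 := hC i (hi'.trans hj) z
        have h2 := h (j - i) (by omega) z
        gcongr
    _ = 2 ^ j * C * (K * Real.exp (lam * z.1)) := by
        rw [← Finset.sum_mul, ← Finset.sum_mul]
        congr 2
        exact_mod_cast Nat.sum_range_choose j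
    _ ≤ 2 ^ k * C * (K * Real.exp (lam * z.1)) := by
        gcongr
        norm_num
    _ = _ := by ring

lemma ExpBdd.neg {F : SpaceTime → ℝ} {k : ℕ} {K lam : ℝ} (h : ExpBdd k K lam F) :
    ExpBdd k K lam fun z => -F z := by
  intro j hj z
  have : iteratedFDeriv ℝ j (fun z => -F z) z = -iteratedFDeriv ℝ j F z :=
    iteratedFDeriv_neg_apply
  rw [this, norm_neg]
  exact h j hj z

lemma Tame.mul {V F : SpaceTime → ℝ} (h : Tame F) (hV : BddDerivs V) :
    Tame fun z => V z * F z := by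
  refine ⟨hV.smooth.mul h.smooth, fun k lam hl => ?_⟩
  obtain ⟨K, hK⟩ := h.bdd k lam hl
  obtain ⟨C, hC⟩ := hV.bdd k
  exact ⟨_, hK.mul (contDiff_nat hV.smooth k) (contDiff_nat h.smooth k) hC⟩

lemma Tame.neg {F : SpaceTime → ℝ} (h : Tame F) : Tame fun z => -F z :=
  ⟨h.smooth.neg, fun k lam hl => (h.bdd k lam hl).imp fun _ hK => hK.neg⟩

lemma Tame.box_retarded {F : SpaceTime → ℝ} (h : Tame F) : box (_root_.retarded F) = F := by
  obtain ⟨K, hK⟩ := h.bdd 2 1 le_rfl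
  exact _root_.box_retarded one_pos (contDiff_nat h.smooth 2) hK

lemma Tame.dirDeriv_retarded {F : SpaceTime → ℝ} (h : Tame F) (v : SpaceTime) :
    _root_.dirDeriv v (_root_.retarded F) = _root_.retarded (_root_.dirDeriv v F) := by
  obtain ⟨K, hK⟩ := h.bdd 1 1 le_rfl
  exact _root_.dirDeriv_retarded one_pos (contDiff_nat h.smooth 1) hK v

/-- Sequences whose derivatives are bounded by geometric sequences, locally uniformly. -/
def GeomBdd {G : Type} [NormedAddCommGroup G] [NormedSpace ℝ G] (k : ℕ)
    (u : ℕ → SpaceTime → G) : Prop :=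
  ∃ lam K : ℝ, 0 ≤ lam ∧ ∀ n, ExpBdd k (K * (1 / 2) ^ n) lam (u n)

section Series

variable {G : Type} [NormedAddCommGroup G] [NormedSpace ℝ G] {u : ℕ → SpaceTime → G}

lemma summable_const_mul_geometric (C : ℝ) : Summable fun n : ℕ => C * (1 / 2 : ℝ) ^ n :=
  (summable_geometric_of_lt_one (by norm_num) (by norm_num)).mul_left C

lemma GeomBdd.mono {k l : ℕ} (h : GeomBdd k u) (hl : l ≤ k) : GeomBdd l u := by
  obtain ⟨lam, K, h0, hK⟩ := h
  exact ⟨lam, K, h0, fun n j hj => hK n j (hj.trans hl)⟩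

lemma GeomBdd.fderiv {k : ℕ} (h : GeomBdd (k + 1) u) :
    GeomBdd k fun n => _root_.fderiv ℝ (u n) := by
  obtain ⟨lam, K, h0, hK⟩ := h
  exact ⟨lam, K, h0, fun n => (hK n).fderiv⟩

lemma GeomBdd.summable [CompleteSpace G] {k : ℕ} (h : GeomBdd k u) (z : SpaceTime) :
    Summable fun n => u n z := by
  obtain ⟨lam, K, h0, hK⟩ := h
  refine Summable.of_norm_bounded (summable_const_mul_geometric (K * Real.exp (lam * z.1)))
    fun n => ((hK n).norm_le z).trans_eq (by ring)

lemma GeomBdd.hasFDerivAt_tsum [CompleteSpace G] (h : GeomBdd 1 u) (hu : ∀ n, ContDiff ℝ 1 (u n))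
    (z : SpaceTime) :
    HasFDerivAt (fun z => ∑' n, u n z) (∑' n, _root_.fderiv ℝ (u n) z) z := by
  have hs := h.summable z
  obtain ⟨lam, K, h0, hK⟩ := h
  have hK0 : 0 ≤ K := by simpa using (norm_nonneg _).trans ((hK 0).norm_le 0)
  have hconv : Convex ℝ {w : SpaceTime | w.1 < z.1 + 1} :=
    convex_halfSpace_lt (LinearMap.fst ℝ ℝ Space3).isLinear _
  refine hasFDerivAt_tsum_of_isPreconnected (x₀ := z)
    (summable_const_mul_geometric (K * Real.exp (lam * (z.1 + 1))))
    (isOpen_lt continuous_fst continuous_const) hconv.isPreconnected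
    (fun n w _ => ((hu n).differentiable one_ne_zero w).hasFDerivAt) (fun n w hw => ?_)
    (by simp) hs (by simp)
  refine (ExpBdd.norm_fderiv_le (k := 0) (hK n) w).trans ?_
  have hw' : w.1 ≤ z.1 + 1 := le_of_lt hw
  rw [mul_right_comm]
  gcongr

end Series

lemma GeomBdd.contDiff_tsum (k : ℕ) :
    ∀ {G : Type} [NormedAddCommGroup G] [NormedSpace ℝ G] [CompleteSpace G]
      {u : ℕ → SpaceTime → G}, GeomBdd (k + 1) u → (∀ n, ContDiff ℝ (k + 1) (u n)) →
      ContDiff ℝ k fun z => ∑' n, u n z := by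
  induction k with
  | zero =>
    intro G _ _ _ u h hu
    have : Differentiable ℝ fun z => ∑' n, u n z := fun z =>
      (h.hasFDerivAt_tsum (by simpa using hu) z).differentiableAt
    simpa using this.continuous
  | succ k ih =>
    intro G _ _ _ u h hu
    have hu1 : ∀ n, ContDiff ℝ 1 (u n) := fun n => (hu n).of_le (by norm_cast; omega)
    have hd := (h.mono (by omega : 1 ≤ k + 1 + 1)).hasFDerivAt_tsum hu1
    push_cast
    rw [contDiff_succ_iff_fderiv]
    refine ⟨fun z => (hd z).differentiableAt, by simp, ?_⟩
    have he : (_root_.fderiv ℝ fun z => ∑' n, u n z) = fun z => ∑' n, _root_.fderiv ℝ (u n) z :=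
      funext fun z => (hd z).fderiv
    rw [he]
    exact ih h.fderiv fun n => (hu n).fderiv_right (by norm_cast)

/-- Sequences of smooth functions whose series may be differentiated termwise. -/
structure GeomSeries (u : ℕ → SpaceTime → ℝ) : Prop where
  smooth : ∀ n, ContDiff ℝ (⊤ : ℕ∞) (u n)
  bdd : ∀ k, GeomBdd k u

namespace GeomSeries

variable {u : ℕ → SpaceTime → ℝ}

lemma dirDeriv (h : GeomSeries u) (v : SpaceTime) : GeomSeries fun n => dirDeriv v (u n) := by
  refine ⟨fun n => contDiff_top_dirDeriv (h.smooth n) v, fun k => ?_⟩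
  obtain ⟨lam, K, h0, hK⟩ := h.bdd (k + 1)
  refine ⟨lam, ‖v‖ * K, h0, fun n => ?_⟩
  rw [mul_assoc]
  exact (hK n).dirDeriv (contDiff_nat (h.smooth n) (k + 1)) v

lemma summable (h : GeomSeries u) (z : SpaceTime) : Summable fun n => u n z :=
  (h.bdd 0).summable z

lemma contDiff_tsum (h : GeomSeries u) : ContDiff ℝ (⊤ : ℕ∞) fun z => ∑' n, u n z :=
  contDiff_infty.2 fun k => (h.bdd (k + 1)).contDiff_tsum k fun n => contDiff_nat (h.smooth n) (k + 1)

lemma dirDeriv_tsum (h : GeomSeries u) (v : SpaceTime) :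
    _root_.dirDeriv v (fun z => ∑' n, u n z) = fun z => ∑' n, _root_.dirDeriv v (u n) z := by
  funext z
  unfold _root_.dirDeriv
  rw [((h.bdd 1).hasFDerivAt_tsum (fun n => contDiff_nat (h.smooth n) 1) z).fderiv]
  exact (ContinuousLinearMap.apply ℝ ℝ v).map_tsum ((h.bdd 1).fderiv.summable z)

lemma box_tsum (h : GeomSeries u) : box (fun z => ∑' n, u n z) = fun z => ∑' n, box (u n) z := by
  funext z
  unfold box
  simp only [h.dirDeriv_tsum, (h.dirDeriv _).dirDeriv_tsum]
  rw [← Summable.tsum_finsetSum fun i _ => ((h.dirDeriv (spaceVec i)).dirDeriv _).summable z,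
    ← Summable.tsum_sub (((h.dirDeriv timeVec).dirDeriv _).summable z)
      (summable_sum fun i _ => ((h.dirDeriv (spaceVec i)).dirDeriv _).summable z)]

end GeomSeries

/-- The Picard iterates for the wave equation with potential `V` and source `G`. -/
noncomputable def picard (V G : SpaceTime → ℝ) : ℕ → SpaceTime → ℝ
  | 0 => retarded G
  | n + 1 => retarded fun z => -(V z * picard V G n z)

/-- The solution of `□ w + V w = G` vanishing in the past. -/
noncomputable def retardedSolution (V G : SpaceTime → ℝ) (z : SpaceTime) : ℝ :=
  ∑' n, picard V G n z

section Picard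

variable {V G : SpaceTime → ℝ}

lemma tame_picard (hV : BddDerivs V) (hG : Tame G) (n : ℕ) : Tame (picard V G n) := by
  induction n with
  | zero => exact hG.retarded
  | succ n ih => exact (ih.mul hV).neg.retarded

lemma geomSeries_picard (hV : BddDerivs V) (hG : Tame G) : GeomSeries (picard V G) := by
  refine ⟨fun n => (tame_picard hV hG n).smooth, fun k => ?_⟩
  obtain ⟨C, hC⟩ := hV.bdd k
  have hC0 : 0 ≤ C := (norm_nonneg _).trans (hC 0 (Nat.zero_le k) 0)
  set lam := 1 + 2 * (2 ^ k * C) with hlam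
  have hp : 0 ≤ 2 ^ k * C := by positivity
  have hl1 : 1 ≤ lam := by linarith
  obtain ⟨K, hK⟩ := hG.bdd k lam hl1
  have hK0 : 0 ≤ K := by simpa using (norm_nonneg _).trans (hK.norm_le 0)
  refine ⟨lam, K, by linarith, fun n => ?_⟩
  have hmono : ∀ {a b : ℝ} {F : SpaceTime → ℝ}, a ≤ b → ExpBdd k a lam F → ExpBdd k b lam F :=
    fun hab hF j hj z => (hF j hj z).trans (by gcongr)
  induction n with
  | zero =>
    refine hmono ?_ (hK.retarded hl1 hG)
    rw [pow_zero, mul_one, div_le_iff₀ (by positivity)]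
    exact le_mul_of_one_le_right hK0 (one_le_pow₀ hl1)
  | succ n ih =>
    have hT := tame_picard hV hG n
    refine hmono ?_ (ExpBdd.retarded hl1 (hT.mul hV).neg
      (ih.mul (contDiff_nat hV.smooth k) (contDiff_nat hT.smooth k) hC).neg)
    rw [div_le_iff₀ (by positivity), pow_succ]
    have h2 : 2 ^ k * C ≤ 1 / 2 * lam ^ 2 := by nlinarith
    calc 2 ^ k * C * (K * (1 / 2) ^ n) ≤ 1 / 2 * lam ^ 2 * (K * (1 / 2) ^ n) := by gcongr
      _ = _ := by ring

lemma contDiff_retardedSolution (hV : BddDerivs V) (hG : Tame G) :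
    ContDiff ℝ (⊤ : ℕ∞) (retardedSolution V G) :=
  (geomSeries_picard hV hG).contDiff_tsum

lemma box_retardedSolution (hV : BddDerivs V) (hG : Tame G) (z : SpaceTime) :
    box (retardedSolution V G) z = G z - V z * retardedSolution V G z := by
  have hs := geomSeries_picard hV hG
  have h0 : box (picard V G 0) z = G z := congrFun hG.box_retarded z
  have h1 : ∀ n, box (picard V G (n + 1)) z = -(V z * picard V G n z) := fun n =>
    congrFun ((tame_picard hV hG n).mul hV).neg.box_retarded z
  have hsum : Summable fun n => box (picard V G n) z := by
    rw [← summable_nat_add_iff 1]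
    simp only [h1]
    exact ((hs.summable z).mul_left _).neg
  unfold retardedSolution
  rw [hs.box_tsum]
  simp only
  rw [hsum.tsum_eq_zero_add, h0]
  simp only [h1]
  rw [tsum_neg, tsum_mul_left]
  ring

lemma dirDeriv_time_retardedSolution (hV : BddDerivs V) (hVt : ∀ t x, V (t, x) = V (0, x))
    (hG : Tame G) :
    dirDeriv timeVec (retardedSolution V G) = retardedSolution V (dirDeriv timeVec G) := by
  have hV0 : dirDeriv timeVec V = 0 := by
    have hcomp : V = (fun x => V (0, x)) ∘ Prod.snd := funext fun z => hVt z.1 z.2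
    funext z
    have hd : DifferentiableAt ℝ (fun x : Space3 => V (0, x)) z.2 :=
      ((contDiff_nat hV.smooth 1).comp
        (contDiff_const.prodMk contDiff_id)).differentiable one_ne_zero _
    unfold dirDeriv
    rw [hcomp, fderiv_comp z hd differentiableAt_snd]
    simp [timeVec, fderiv_snd]
  have hn : ∀ n, dirDeriv timeVec (picard V G n) = picard V (dirDeriv timeVec G) n := by
    intro n
    induction n with
    | zero => exact hG.dirDeriv_retarded timeVec
    | succ n ih =>
      have hT := tame_picard hV hG n
      rw [picard, (hT.mul hV).neg.dirDeriv_retarded, picard]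
      congr 1
      funext z
      have h1 := (hV.smooth.differentiable (by simp) z).hasFDerivAt
      have h2 := (hT.smooth.differentiable (by simp) z).hasFDerivAt
      have h3 : fderiv ℝ V z timeVec = 0 := congrFun hV0 z
      rw [← ih]
      unfold dirDeriv
      have h4 : HasFDerivAt (fun z => -(V z * picard V G n z)) _ z := (h1.mul h2).neg
      rw [h4.fderiv]
      simp [h3]
  unfold retardedSolution
  rw [(geomSeries_picard hV hG).dirDeriv_tsum]
  simp only [hn]

end Picard

/-- Support in the solid forward cone `‖x‖ ≤ 4 + t`. -/
def ConeSupported (F : SpaceTime → ℝ) : Prop := ∀ z : SpaceTime, 4 + z.1 < ‖z.2‖ → F z = 0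

lemma ConeSupported.retarded {F : SpaceTime → ℝ} (h : ConeSupported F) :
    ConeSupported (retarded F) := by
  intro z hz
  refine integral_eq_zero_of_ae ?_
  filter_upwards [ae_coneMeasure_fst_pos, ae_coneMeasure_norm_snd] with q hq hy
  have h1 : ‖z.2‖ ≤ ‖z.2 + q.1 • q.2‖ + q.1 := by
    have h2 : ‖q.1 • q.2‖ = q.1 := by rw [norm_smul, hy, mul_one, Real.norm_of_nonneg hq.le]
    calc ‖z.2‖ = ‖(z.2 + q.1 • q.2) - q.1 • q.2‖ := by rw [add_sub_cancel_right]
      _ ≤ _ := (norm_sub_le _ _).trans_eq (by rw [h2])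
  have h3 : F (z + lightRay q) = 0 := by
    refine h _ ?_
    simp only [lightRay, Prod.fst_add, Prod.snd_add]
    linarith
  simp [h3]

lemma coneSupported_retardedSolution {V G : SpaceTime → ℝ} (hG : ConeSupported G) :
    ConeSupported (retardedSolution V G) := by
  have h : ∀ n, ConeSupported (picard V G n) := by
    intro n
    induction n with
    | zero => exact hG.retarded
    | succ n ih => exact ConeSupported.retarded fun z hz => by rw [ih z hz]; simp
  intro z hz
  simp [retardedSolution, h _ z hz]

/-- Functions in the span of the angular modes `e^{±imφ}` around the third axis. -/
def HasMode (m : ℕ) (F : SpaceTime → ℝ) : Prop :=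
  ∀ (θ t : ℝ) (x : Space3),
    F (t, planeRot 0 1 θ x) + F (t, planeRot 0 1 (-θ) x) = 2 * Real.cos (m * θ) * F (t, x)

lemma retarded_comp_isometry (F : SpaceTime → ℝ) (L : Space3 ≃ₗᵢ[ℝ] Space3) (t : ℝ) (x : Space3) :
    retarded F (t, L x) = retarded (fun z => F (z.1, L z.2)) (t, x) := by
  have hmp : MeasurePreserving (Prod.map id L) coneMeasure coneMeasure :=
    (MeasurePreserving.id _).prod (measurePreserving_sphereMeasure L)
  have hme : MeasurableEmbedding (Prod.map (id : ℝ → ℝ) L) :=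
    ((Homeomorph.refl ℝ).prodCongr L.toHomeomorph).measurableEmbedding
  unfold retarded
  rw [← hmp.integral_comp hme]
  refine integral_congr_ae (.of_forall fun q => ?_)
  simp [lightRay]

lemma HasMode.retarded {F : SpaceTime → ℝ} {m : ℕ} (hF : Tame F) (h : HasMode m F) :
    HasMode m (retarded F) := by
  intro θ t x
  have h01 : (0 : Fin 3) ≠ 1 := by decide
  obtain ⟨K, hK⟩ := hF.bdd 0 1 le_rfl
  have hc := hF.smooth.continuous
  have hi : ∀ θ, Integrable (fun q : SpaceTime => q.1 •
      (fun z : SpaceTime => F (z.1, planeRotIsometry h01 θ z.2)) ((t, x) + lightRay q))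
      coneMeasure := fun θ =>
    integrable_retarded one_pos (by fun_prop) (fun z => hK.norm_le (z.1, planeRotIsometry h01 θ z.2)) (t, x)
  have e : ∀ θ, planeRot 0 1 θ x = planeRotIsometry h01 θ x := fun θ => rfl
  rw [e, e, retarded_comp_isometry, retarded_comp_isometry]
  unfold _root_.retarded
  rw [← integral_add (hi θ) (hi (-θ)), ← integral_const_mul]
  refine integral_congr_ae (.of_forall fun q => ?_)
  have := h θ ((t, x) + lightRay q).1 ((t, x) + lightRay q).2
  simp only [planeRotIsometry_apply, smul_eq_mul] at this ⊢
  rw [← mul_add, this]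
  ring

lemma hasMode_retardedSolution {V G : SpaceTime → ℝ} {m : ℕ} (hV : BddDerivs V)
    (hVr : ∀ θ t x, V (t, planeRot 0 1 θ x) = V (t, x)) (hT : Tame G) (hG : HasMode m G) :
    HasMode m (retardedSolution V G) := by
  have h : ∀ n, HasMode m (picard V G n) := by
    intro n
    induction n with
    | zero => exact hG.retarded hT
    | succ n ih =>
      refine HasMode.retarded ((tame_picard hV hT n).mul hV).neg fun θ t x => ?_
      rw [hVr, hVr]
      linear_combination (-V (t, x)) * ih θ t x
  intro θ t x
  have hs := (geomSeries_picard hV hT).summable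
  unfold retardedSolution
  rw [← (hs _).tsum_add (hs _), ← tsum_mul_left]
  exact tsum_congr fun n => h n θ t x

/-- Smooth functions with bounded derivatives of each order. -/
def HasBddDerivs {E : Type*} [NormedAddCommGroup E] [NormedSpace ℝ E] (f : E → ℝ) : Prop :=
  ContDiff ℝ (⊤ : ℕ∞) f ∧ ∀ k : ℕ, ∃ C, ∀ z, ‖iteratedFDeriv ℝ k f z‖ ≤ C

namespace HasBddDerivs

section General

variable {E E' : Type*} [NormedAddCommGroup E] [NormedSpace ℝ E] [NormedAddCommGroup E']
  [NormedSpace ℝ E'] {f g : E → ℝ}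

lemma mul (hf : HasBddDerivs f) (hg : HasBddDerivs g) : HasBddDerivs fun x => f x * g x := by
  refine ⟨hf.1.mul hg.1, fun k => ?_⟩
  choose C hC using hf.2
  choose D hD using hg.2
  refine ⟨∑ i ∈ Finset.range (k + 1), (k.choose i : ℝ) * C i * D (k - i), fun z => ?_⟩
  refine (norm_iteratedFDeriv_mul_le (contDiff_nat hf.1 k) (contDiff_nat hg.1 k) z le_rfl).trans ?_
  refine Finset.sum_le_sum fun i _ => ?_
  have h1 := hC i z
  have h2 := hD (k - i) z
  have h3 := (norm_nonneg _).trans h1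
  gcongr

lemma comp_clm (hf : HasBddDerivs f) (L : E' →L[ℝ] E) : HasBddDerivs fun x => f (L x) := by
  refine ⟨hf.1.comp L.contDiff, fun k => ?_⟩
  obtain ⟨C, hC⟩ := hf.2 k
  refine ⟨C * ∏ _i : Fin k, ‖L‖, fun z => ?_⟩
  have := L.iteratedFDeriv_comp_right (f := f) (contDiff_nat hf.1 k) z (i := k) le_rfl
  change ‖iteratedFDeriv ℝ k (f ∘ L) z‖ ≤ _
  rw [this]
  refine (ContinuousMultilinearMap.norm_compContinuousLinearMap_le _ _).trans ?_
  have := hC (L z)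
  gcongr

lemma of_hasCompactSupport (hf : ContDiff ℝ (⊤ : ℕ∞) f) (hs : HasCompactSupport f) :
    HasBddDerivs f :=
  ⟨hf, fun k => (hs.iteratedFDeriv k).exists_bound_of_continuous
    (contDiff_nat hf k).continuous_iteratedFDeriv'⟩

end General

lemma of_deriv {f : ℝ → ℝ} (hf : ContDiff ℝ (⊤ : ℕ∞) f) {C : ℝ} (hC : ∀ t, |f t| ≤ C)
    (hf' : HasBddDerivs (deriv f)) : HasBddDerivs f := by
  refine ⟨hf, fun k => ?_⟩
  rcases k with _ | k
  · exact ⟨C, fun z => by simpa using hC z⟩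
  · obtain ⟨D, hD⟩ := hf'.2 k
    refine ⟨D, fun z => ?_⟩
    have := hD z
    rwa [norm_iteratedFDeriv_eq_norm_iteratedDeriv, ← iteratedDeriv_succ',
      ← norm_iteratedFDeriv_eq_norm_iteratedDeriv] at this

lemma iteratedDeriv_sin_le (w : ℝ) (k : ℕ) : ∀ (c s t : ℝ),
    |iteratedDeriv k (fun t => c * Real.sin (w * t + s)) t| ≤ |c| * |w| ^ k := by
  induction k with
  | zero =>
    intro c s t
    rw [iteratedDeriv_zero, abs_mul]
    simpa using mul_le_mul_of_nonneg_left (Real.abs_sin_le_one _) (abs_nonneg c)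
  | succ k ih =>
    intro c s t
    have hd : deriv (fun t => c * Real.sin (w * t + s))
        = fun t => (c * w) * Real.sin (w * t + (s + Real.pi / 2)) := by
      funext t
      have h := ((((hasDerivAt_id t).const_mul w).add_const s).sin).const_mul c
      refine h.deriv.trans ?_
      rw [← add_assoc, Real.sin_add_pi_div_two]
      simp
      ring
    rw [iteratedDeriv_succ', hd]
    refine (ih _ _ _).trans_eq ?_
    rw [abs_mul, pow_succ]
    ring

lemma sin (w s : ℝ) : HasBddDerivs fun t => Real.sin (w * t + s) := by
  refine ⟨by fun_prop, fun k => ⟨1 * |w| ^ k, fun t => ?_⟩⟩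
  rw [norm_iteratedFDeriv_eq_norm_iteratedDeriv]
  simpa using iteratedDeriv_sin_le w k 1 s t

lemma bddDerivs {V : SpaceTime → ℝ} (h : HasBddDerivs V) : BddDerivs V := by
  refine ⟨h.1, fun k => ?_⟩
  choose C hC using h.2
  refine ⟨∑ i ∈ Finset.range (k + 1), C i, fun j hj z => (hC j z).trans ?_⟩
  exact Finset.single_le_sum (f := C) (fun i _ => (norm_nonneg _).trans (hC i z))
    (Finset.mem_range.2 (by omega))

lemma tame {G : SpaceTime → ℝ} (h : HasBddDerivs G) (h0 : ∀ z : SpaceTime, z.1 < -1 → G z = 0) :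
    Tame G := by
  refine ⟨h.1, fun k lam hl => ?_⟩
  obtain ⟨C, hC⟩ := h.bddDerivs.bdd k
  have hC0 : 0 ≤ C := (norm_nonneg _).trans (hC 0 (Nat.zero_le k) 0)
  refine ⟨C * Real.exp lam, fun j hj z => ?_⟩
  rcases lt_or_ge z.1 (-1) with hz | hz
  · have he : G =ᶠ[nhds z] fun _ => 0 := by
      filter_upwards [(isOpen_lt continuous_fst continuous_const).mem_nhds hz] with w hw
      exact h0 w hw
    rw [(he.iteratedFDeriv ℝ j).self_of_nhds]
    have : iteratedFDeriv ℝ j (fun _ : SpaceTime => (0 : ℝ)) z = 0 := by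
      simp
    rw [this, norm_zero]
    positivity
  · refine (hC j hj z).trans ?_
    rw [mul_assoc, ← Real.exp_add]
    refine le_mul_of_one_le_right hC0 (Real.one_le_exp ?_)
    nlinarith

end HasBddDerivs

lemma dirDeriv_timeVec {u : SpaceTime → ℝ} (hu : ContDiff ℝ (⊤ : ℕ∞) u) (t : ℝ) (x : Space3) :
    timeDeriv u t x = dirDeriv timeVec u (t, x) := by
  have h1 := (hu.differentiable (by simp) (t, x)).hasFDerivAt
  have h2 : HasDerivAt (fun s : ℝ => (s, x)) timeVec t :=
    (hasDerivAt_id t).prodMk (hasDerivAt_const t x)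
  exact (h1.comp_hasDerivAt t h2).deriv

lemma iteratedDeriv_two_time {u : SpaceTime → ℝ} (hu : ContDiff ℝ (⊤ : ℕ∞) u) (t : ℝ)
    (x : Space3) :
    iteratedDeriv 2 (fun s => u (s, x)) t = dirDeriv timeVec (dirDeriv timeVec u) (t, x) := by
  rw [iteratedDeriv_succ, iteratedDeriv_one,
    ← dirDeriv_timeVec (contDiff_top_dirDeriv hu timeVec)]
  have : deriv (fun s => u (s, x)) = fun s => dirDeriv timeVec u (s, x) :=
    funext fun s => dirDeriv_timeVec hu s x
  rw [this]
  rfl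

lemma spatialDeriv_slice {u : SpaceTime → ℝ} (hu : ContDiff ℝ (⊤ : ℕ∞) u) (i : Fin 3) (t : ℝ)
    (x : Space3) :
    spatialDeriv i (fun y => u (t, y)) x = dirDeriv (spaceVec i) u (t, x) := by
  have h1 := (hu.differentiable (by simp) (t, x)).hasFDerivAt
  have h2 : HasFDerivAt (fun y : Space3 => (t, y)) (ContinuousLinearMap.inr ℝ ℝ Space3) x :=
    hasFDerivAt_prodMk_right t x
  have h3 : HasFDerivAt (fun y => u (t, y)) _ x := h1.comp x h2
  unfold spatialDeriv
  rw [h3.fderiv]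
  rfl

lemma contDiff_slice {u : SpaceTime → ℝ} (hu : ContDiff ℝ (⊤ : ℕ∞) u) (t : ℝ) :
    ContDiff ℝ (⊤ : ℕ∞) fun y => u (t, y) :=
  hu.comp (contDiff_const.prodMk contDiff_id)

lemma contDiff_spatialDeriv {f : Space3 → ℝ} (hf : ContDiff ℝ (⊤ : ℕ∞) f) (i : Fin 3) :
    ContDiff ℝ (⊤ : ℕ∞) (spatialDeriv i f) :=
  (hf.fderiv_right (m := (⊤ : ℕ∞)) (by simp)).clm_apply contDiff_const

/-- The radial profile of the perturbation of the flat metric. -/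
noncomputable def profile (s : ℝ) : ℝ := s * Real.smoothTransition (6 - s)

/-- The size of the perturbation of the flat metric. -/
noncomputable def perturbation (x : Space3) : ℝ := profile (‖x‖ ^ 2)

/-- The inverse metric `δ^{ij} + β T^i T^j`, where `T` generates rotations around the third
axis. -/
noncomputable def metricCoeff (i j : Fin 3) (x : Space3) : ℝ :=
  (if i = j then 1 else 0) + perturbation x * rotGen 0 1 x i * rotGen 0 1 x j

lemma contDiff_profile : ContDiff ℝ (⊤ : ℕ∞) profile :=
  contDiff_id.mul (Real.smoothTransition.contDiff.comp (contDiff_const.sub contDiff_id))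

lemma contDiff_perturbation : ContDiff ℝ (⊤ : ℕ∞) perturbation :=
  contDiff_profile.comp (contDiff_id.norm_sq ℝ)

lemma perturbation_nonneg (x : Space3) : 0 ≤ perturbation x :=
  mul_nonneg (sq_nonneg _) (Real.smoothTransition.nonneg _)

lemma profile_of_le {s : ℝ} (hs : s ≤ 5) : profile s = s := by
  rw [profile, Real.smoothTransition.one_of_one_le (by linarith), mul_one]

lemma profile_of_ge {s : ℝ} (hs : 6 ≤ s) : profile s = 0 := by
  rw [profile, Real.smoothTransition.zero_of_nonpos (by linarith), mul_zero]

lemma contDiff_metricCoeff (i j : Fin 3) : ContDiff ℝ (⊤ : ℕ∞) (metricCoeff i j) := by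
  have h : ∀ i, ContDiff ℝ (⊤ : ℕ∞) fun x : Space3 => rotGen 0 1 x i := fun i => by fun_prop
  exact contDiff_const.add ((contDiff_perturbation.mul (h i)).mul (h j))

lemma metricCoeff_symm (i j : Fin 3) (x : Space3) : metricCoeff i j x = metricCoeff j i x := by
  unfold metricCoeff
  simp only [eq_comm (a := i)]
  ring

lemma sum_metricCoeff_mul (x : Space3) (i : Fin 3) (v : Fin 3 → ℝ) :
    ∑ j, metricCoeff i j x * v j
      = v i + perturbation x * rotGen 0 1 x i * ∑ j, rotGen 0 1 x j * v j := by
  unfold metricCoeff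
  simp only [add_mul, Finset.sum_add_distrib, Finset.mul_sum]
  congr 1
  · simp
  · exact Finset.sum_congr rfl fun j _ => by ring

lemma sum_metricCoeff_mul_mul (x : Space3) (v : Fin 3 → ℝ) :
    ∑ i, ∑ j, metricCoeff i j x * v i * v j
      = ∑ i, v i ^ 2 + perturbation x * (∑ j, rotGen 0 1 x j * v j) ^ 2 := by
  have h : ∀ i, ∑ j, metricCoeff i j x * v i * v j = v i * ∑ j, metricCoeff i j x * v j :=
    fun i => by rw [Finset.mul_sum]; exact Finset.sum_congr rfl fun j _ => by ring
  simp only [h, sum_metricCoeff_mul, mul_add, Finset.sum_add_distrib]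
  congr 1
  · exact Finset.sum_congr rfl fun j _ => by ring
  · rw [sq, ← mul_assoc, Finset.mul_sum Finset.univ (fun j => rotGen 0 1 x j * v j)
      (perturbation x * _)]
    exact Finset.sum_congr rfl fun j _ => by ring

lemma metricCoeff_nonneg (x : Space3) (v : Fin 3 → ℝ) :
    0 ≤ ∑ i, ∑ j, metricCoeff i j x * v i * v j := by
  rw [sum_metricCoeff_mul_mul]
  have := perturbation_nonneg x
  positivity

lemma metricCoeff_pos (x : Space3) {v : Fin 3 → ℝ} (hv : v ≠ 0) :
    0 < ∑ i, ∑ j, metricCoeff i j x * v i * v j := by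
  rw [sum_metricCoeff_mul_mul]
  have h0 := perturbation_nonneg x
  obtain ⟨i, hi⟩ := Function.ne_iff.1 hv
  have : 0 < ∑ i, v i ^ 2 :=
    Finset.sum_pos' (fun i _ => sq_nonneg _) ⟨i, Finset.mem_univ i, sq_pos_of_ne_zero hi⟩
  positivity

lemma metricCoeff_of_pi_le {x : Space3} (hx : Real.pi ≤ ‖x‖) (i j : Fin 3) :
    metricCoeff i j x = if i = j then 1 else 0 := by
  have h : 6 ≤ ‖x‖ ^ 2 := by nlinarith [Real.pi_gt_three]
  simp [metricCoeff, perturbation, profile_of_ge h]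

lemma fderiv_radial_rotGen {g : ℝ → ℝ} (hg : Differentiable ℝ g) (x : Space3) :
    fderiv ℝ (fun x : Space3 => g (‖x‖ ^ 2)) x (rotGen 0 1 x) = 0 := by
  have h1 : HasFDerivAt (fun x : Space3 => ‖x‖ ^ 2) _ x := (hasStrictFDerivAt_norm_sq x).hasFDerivAt
  have h2 : HasFDerivAt (fun x : Space3 => g (‖x‖ ^ 2)) _ x :=
    (hg _).hasDerivAt.comp_hasFDerivAt x h1
  rw [h2.fderiv]
  have : inner ℝ x (rotGen 0 1 x) = 0 := by
    simp [rotGen_apply, PiLp.inner_apply, Fin.sum_univ_three]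
    ring
  simp [this]

lemma sum_rotGen_spatialDeriv (f : Space3 → ℝ) (x : Space3) :
    ∑ j, rotGen 0 1 x j * spatialDeriv j f x = fderiv ℝ f x (rotGen 0 1 x) := by
  conv_rhs => rw [space3_eq_sum (rotGen 0 1 x)]
  simp [spatialDeriv, Fin.sum_univ_three]

/-- The divergence form operator `∑ ∂_i (a^{ij} ∂_j f)`. -/
noncomputable def divForm (f : Space3 → ℝ) (x : Space3) : ℝ :=
  ∑ i, spatialDeriv i (fun y => ∑ j, metricCoeff i j y * spatialDeriv j f y) x

lemma divForm_eq {f : Space3 → ℝ} (hf : ContDiff ℝ (⊤ : ℕ∞) f) (x : Space3) :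
    divForm f x = ∑ i, spatialDeriv i (spatialDeriv i f) x
      + perturbation x * fderiv ℝ (fun y => fderiv ℝ f y (rotGen 0 1 y)) x (rotGen 0 1 x) := by
  set g : Space3 → ℝ := fun y => fderiv ℝ f y (rotGen 0 1 y) with hg
  have hgs : ContDiff ℝ (⊤ : ℕ∞) g :=
    (hf.fderiv_right (m := (⊤ : ℕ∞)) (by simp)).clm_apply (rotGen 0 1).contDiff
  have hgd := (hgs.differentiable (by simp) x).hasFDerivAt
  have hbd := (contDiff_perturbation.differentiable (by simp) x).hasFDerivAt
  have hT : ∀ i, HasFDerivAt (fun y : Space3 => rotGen 0 1 y i)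
      ((EuclideanSpace.proj i : Space3 →L[ℝ] ℝ).comp (rotGen 0 1)) x := fun i =>
    ((EuclideanSpace.proj i : Space3 →L[ℝ] ℝ).comp (rotGen 0 1)).hasFDerivAt
  have h1 : ∀ i, spatialDeriv i (fun y => ∑ j, metricCoeff i j y * spatialDeriv j f y) x
      = spatialDeriv i (spatialDeriv i f) x
        + (perturbation x * rotGen 0 1 x i * spatialDeriv i g x
          + g x * (perturbation x * rotGen 0 1 (EuclideanSpace.single i 1) i
            + rotGen 0 1 x i * spatialDeriv i perturbation x)) := by
    intro i
    have e : (fun y => ∑ j, metricCoeff i j y * spatialDeriv j f y)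
        = fun y => spatialDeriv i f y + perturbation y * rotGen 0 1 y i * g y := by
      funext y
      rw [sum_metricCoeff_mul, sum_rotGen_spatialDeriv]
    have hd := ((contDiff_spatialDeriv hf i).differentiable (by simp) x).hasFDerivAt
    have hfull : HasFDerivAt (fun y => spatialDeriv i f y + perturbation y * rotGen 0 1 y i * g y)
      _ x := hd.add ((hbd.mul (hT i)).mul hgd)
    rw [e]
    have e' : ∀ h : Space3 → ℝ, spatialDeriv i h x = fderiv ℝ h x (EuclideanSpace.single i 1) :=
      fun h => rfl
    rw [e', hfull.fderiv]
    simp [e']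
    ring
  have hβ := fderiv_radial_rotGen (contDiff_profile.differentiable (by simp)) x
  have hβ' := sum_rotGen_spatialDeriv perturbation x
  unfold perturbation at hβ'
  rw [hβ] at hβ'
  have hdiv : ∑ i, rotGen 0 1 (EuclideanSpace.single i (1 : ℝ) : Space3) i = 0 := by
    simp [rotGen_apply]
  have hTg := sum_rotGen_spatialDeriv g x
  unfold divForm
  simp only [h1, Finset.sum_add_distrib, ← Finset.mul_sum, mul_assoc]
  rw [hTg, hdiv]
  change _ + (_ + g x * (_ + ∑ i, rotGen 0 1 x i * spatialDeriv i (fun x => profile (‖x‖ ^ 2)) x))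
    = _
  rw [hβ']
  ring

lemma fderiv_rotGen_of_mode {f : Space3 → ℝ} {m : ℕ} (hf : ContDiff ℝ (⊤ : ℕ∞) f)
    (h : ∀ θ x, f (planeRot 0 1 θ x) + f (planeRot 0 1 (-θ) x) = 2 * Real.cos (m * θ) * f x)
    (x : Space3) :
    fderiv ℝ (fun y => fderiv ℝ f y (rotGen 0 1 y)) x (rotGen 0 1 x) = -(m : ℝ) ^ 2 * f x := by
  have h01 : (0 : Fin 3) ≠ 1 := by decide
  have hd : ∀ {g : Space3 → ℝ}, ContDiff ℝ (⊤ : ℕ∞) g → ∀ θ,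
      HasDerivAt (fun s => g (planeRot 0 1 s x))
        (fderiv ℝ g (planeRot 0 1 θ x) (rotGen 0 1 (planeRot 0 1 θ x))) θ := fun hg θ =>
    (hg.differentiable (by simp) _).hasFDerivAt.comp_hasDerivAt θ (hasDerivAt_planeRot h01 x θ)
  set g : Space3 → ℝ := fun y => fderiv ℝ f y (rotGen 0 1 y) with hg
  have hgs : ContDiff ℝ (⊤ : ℕ∞) g :=
    (hf.fderiv_right (m := (⊤ : ℕ∞)) (by simp)).clm_apply (rotGen 0 1).contDiff
  have h1 : ∀ θ, g (planeRot 0 1 θ x) - g (planeRot 0 1 (-θ) x)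
      = -(2 * m * Real.sin (m * θ) * f x) := by
    intro θ
    have a1 : HasDerivAt (fun θ => f (planeRot 0 1 θ x) + f (planeRot 0 1 (-θ) x))
        (g (planeRot 0 1 θ x) + g (planeRot 0 1 (-θ) x) * (-1)) θ :=
      (hd hf θ).add ((hd hf (-θ)).comp θ (hasDerivAt_neg θ))
    have a2 : HasDerivAt (fun θ => 2 * Real.cos (m * θ) * f x)
        (2 * (-Real.sin (m * θ) * (m * 1)) * f x) θ :=
      ((((hasDerivAt_id θ).const_mul (m : ℝ)).cos).const_mul 2).mul_const _
    have := a1.unique ((funext fun θ => h θ x :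
      (fun θ => f (planeRot 0 1 θ x) + f (planeRot 0 1 (-θ) x)) = _) ▸ a2)
    linarith
  have b1 : HasDerivAt (fun θ => g (planeRot 0 1 θ x) - g (planeRot 0 1 (-θ) x)) _ 0 :=
    (hd hgs 0).sub ((hd hgs (-0)).comp (0 : ℝ) (hasDerivAt_neg 0))
  have b2 : HasDerivAt (fun θ => -(2 * m * Real.sin (m * θ) * f x)) _ 0 :=
    (((((hasDerivAt_id (0 : ℝ)).const_mul (m : ℝ)).sin).const_mul (2 * (m : ℝ))).mul_const _).neg
  have b3 := b1.unique ((funext h1 :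
      (fun θ => g (planeRot 0 1 θ x) - g (planeRot 0 1 (-θ) x)) = _) ▸ b2)
  simp [planeRot_zero] at b3
  linarith

lemma divForm_of_mode {f : Space3 → ℝ} {m : ℕ} (hf : ContDiff ℝ (⊤ : ℕ∞) f)
    (h : ∀ θ x, f (planeRot 0 1 θ x) + f (planeRot 0 1 (-θ) x) = 2 * Real.cos (m * θ) * f x)
    (x : Space3) :
    divForm f x = ∑ i, spatialDeriv i (spatialDeriv i f) x
      - (m : ℝ) ^ 2 * perturbation x * f x := by
  rw [divForm_eq hf, fderiv_rotGen_of_mode hf h]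
  ring

/-- The potential seen by the `m`-th angular mode. -/
noncomputable def modePotential (m : ℕ) (z : SpaceTime) : ℝ := (m : ℝ) ^ 2 * perturbation z.2

lemma hasCompactSupport_perturbation : HasCompactSupport perturbation := by
  refine HasCompactSupport.intro (isCompact_closedBall (0 : Space3) 3) fun x hx => ?_
  have hx' : 3 < ‖x‖ := by simpa using hx
  exact profile_of_ge (by nlinarith)

lemma bddDerivs_modePotential (m : ℕ) : BddDerivs (modePotential m) := by
  refine HasBddDerivs.bddDerivs ?_
  have := HasBddDerivs.of_hasCompactSupport (f := fun x => (m : ℝ) ^ 2 * perturbation x)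
    (contDiff_const.mul contDiff_perturbation) hasCompactSupport_perturbation.mul_left
  exact this.comp_clm (ContinuousLinearMap.snd ℝ ℝ Space3)

lemma modePotential_planeRot (m : ℕ) (θ t : ℝ) (x : Space3) :
    modePotential m (t, planeRot 0 1 θ x) = modePotential m (t, x) := by
  simp [modePotential, perturbation, norm_planeRot (show (0 : Fin 3) ≠ 1 by decide)]

/-- On functions with a fixed angular mode the perturbed wave operator is the flat wave operator
with a potential. -/
lemma wave_of_mode {u : SpaceTime → ℝ} {m : ℕ} (hu : ContDiff ℝ (⊤ : ℕ∞) u) (h : HasMode m u)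
    (t : ℝ) (x : Space3) :
    dirDeriv timeVec (dirDeriv timeVec u) (t, x) - divForm (fun y => u (t, y)) x
      = box u (t, x) + modePotential m (t, x) * u (t, x) := by
  rw [divForm_of_mode (contDiff_slice hu t) (fun θ x => h θ t x), box, modePotential]
  have : ∀ i, spatialDeriv i (spatialDeriv i fun y => u (t, y)) x
      = dirDeriv (spaceVec i) (dirDeriv (spaceVec i) u) (t, x) := by
    intro i
    rw [← spatialDeriv_slice (contDiff_top_dirDeriv hu _)]
    congr 1
    exact funext fun y => spatialDeriv_slice hu i t y
  simp only [this]
  ring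

lemma ConeSupported.dirDeriv {u : SpaceTime → ℝ} (h : ConeSupported u) (v : SpaceTime) :
    ConeSupported (dirDeriv v u) := by
  intro z hz
  have ho : IsOpen {z : SpaceTime | 4 + z.1 < ‖z.2‖} :=
    isOpen_lt (by fun_prop) (by fun_prop)
  have he : u =ᶠ[nhds z] fun _ => 0 := by
    filter_upwards [ho.mem_nhds hz] with w hw
    exact h w hw
  unfold _root_.dirDeriv
  rw [he.fderiv_eq]
  simp

lemma ConeSupported.hasCompactSupport_slice {u : SpaceTime → ℝ} (h : ConeSupported u) (t : ℝ) :
    HasCompactSupport fun x => u (t, x) := by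
  refine HasCompactSupport.intro (isCompact_closedBall (0 : Space3) (4 + t)) fun x hx => h _ ?_
  simpa using hx

lemma dirDeriv_comm {u : SpaceTime → ℝ} (hu : ContDiff ℝ (⊤ : ℕ∞) u) (v w : SpaceTime) :
    dirDeriv v (dirDeriv w u) = dirDeriv w (dirDeriv v u) := by
  funext z
  have h2 := contDiff_nat hu 2
  rw [dirDeriv_dirDeriv h2, dirDeriv_dirDeriv h2]
  exact (h2.contDiffAt.isSymmSndFDerivAt (by simp)).eq v w

lemma integral_spatialDeriv_eq_zero {g : Space3 → ℝ} (hg : ContDiff ℝ (⊤ : ℕ∞) g)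
    (hs : HasCompactSupport g) (i : Fin 3) : ∫ x, spatialDeriv i g x = 0 := by
  have h1 : Integrable fun x => fderiv ℝ g x (EuclideanSpace.single i 1) :=
    (contDiff_spatialDeriv hg i).continuous.integrable_of_hasCompactSupport
      (hs.fderiv_apply ℝ _)
  have := integral_mul_fderiv_eq_neg_fderiv_mul_of_integrable (μ := (volume : Measure Space3))
    (f := fun _ : Space3 => (1 : ℝ)) (g := g) (v := EuclideanSpace.single i 1) (by simp)
    (by simpa using h1) (by simpa using hg.continuous.integrable_of_hasCompactSupport hs)
    (by fun_prop) (fun x _ => hg.differentiable (by simp) x)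
  simpa [spatialDeriv] using this

lemma hasDerivAt_integral_slice {g : SpaceTime → ℝ} (hg : ContDiff ℝ (⊤ : ℕ∞) g)
    (h : ConeSupported g) (t : ℝ) :
    HasDerivAt (fun t => ∫ x, g (t, x)) (∫ x, dirDeriv timeVec g (t, x)) t := by
  have hd := contDiff_top_dirDeriv hg timeVec
  have hds := h.dirDeriv timeVec
  obtain ⟨C, hC⟩ := ((isCompact_Icc (a := t - 1) (b := t + 1)).prod
    (isCompact_closedBall (0 : Space3) (5 + t))).exists_bound_of_continuousOn
    hd.continuous.continuousOn
  refine (hasDerivAt_integral_of_dominated_loc_of_deriv_le (s := Metric.ball t 1)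
    (F' := fun t x => dirDeriv timeVec g (t, x))
    (bound := (Metric.closedBall (0 : Space3) (5 + t)).indicator fun _ => C)
    (Metric.ball_mem_nhds t one_pos)
    (.of_forall fun s => (contDiff_slice hg s).continuous.aestronglyMeasurable)
    ((contDiff_slice hg t).continuous.integrable_of_hasCompactSupport (h.hasCompactSupport_slice t))
    (contDiff_slice hd t).continuous.aestronglyMeasurable
    (.of_forall fun x s hs => ?_) ?_ (.of_forall fun x s _ => ?_)).2
  · have hs' := abs_lt.1 (by simpa [Real.dist_eq] using hs : |s - t| < 1)
    by_cases hx : x ∈ Metric.closedBall (0 : Space3) (5 + t)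
    · rw [indicator_of_mem hx]
      exact hC (s, x) ⟨⟨by linarith, by linarith⟩, hx⟩
    · rw [indicator_of_notMem hx, hds (s, x) ?_, norm_zero]
      have : 5 + t < ‖x‖ := by simpa using hx
      simp only
      linarith
  · exact (integrable_indicator_iff measurableSet_closedBall).2
      (integrableOn_const (measure_closedBall_lt_top).ne)
  · have h1 := (hg.differentiable (by simp) (s, x)).hasFDerivAt
    have h2 : HasDerivAt (fun s : ℝ => (s, x)) timeVec s :=
      (hasDerivAt_id s).prodMk (hasDerivAt_const s x)
    exact h1.comp_hasDerivAt s h2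

/-- The energy density of `u` with respect to the perturbed metric. -/
noncomputable def energyDensity (u : SpaceTime → ℝ) (z : SpaceTime) : ℝ :=
  dirDeriv timeVec u z ^ 2
    + ∑ i, ∑ j, metricCoeff i j z.2 * dirDeriv (spaceVec i) u z * dirDeriv (spaceVec j) u z

/-- The energy of `u` on a time slice. -/
noncomputable def energy (u : SpaceTime → ℝ) (t : ℝ) : ℝ := ∫ x, energyDensity u (t, x)

lemma sq_dirDeriv_le_energyDensity (u : SpaceTime → ℝ) (z : SpaceTime) :
    dirDeriv timeVec u z ^ 2 ≤ energyDensity u z :=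
  le_add_of_nonneg_right (metricCoeff_nonneg z.2 _)

lemma energyDensity_nonneg (u : SpaceTime → ℝ) (z : SpaceTime) : 0 ≤ energyDensity u z :=
  (sq_nonneg _).trans (sq_dirDeriv_le_energyDensity u z)

lemma contDiff_energyDensity {u : SpaceTime → ℝ} (hu : ContDiff ℝ (⊤ : ℕ∞) u) :
    ContDiff ℝ (⊤ : ℕ∞) (energyDensity u) := by
  have h1 := contDiff_top_dirDeriv hu
  have h2 : ∀ i j, ContDiff ℝ (⊤ : ℕ∞) fun z : SpaceTime => metricCoeff i j z.2 := fun i j =>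
    (contDiff_metricCoeff i j).comp contDiff_snd
  exact ((h1 _).pow 2).add (ContDiff.sum fun i _ => ContDiff.sum fun j _ =>
    ((h2 i j).mul (h1 _)).mul (h1 _))

lemma ConeSupported.energyDensity {u : SpaceTime → ℝ} (h : ConeSupported u) :
    ConeSupported (energyDensity u) := by
  intro z hz
  simp [_root_.energyDensity, h.dirDeriv _ z hz]

lemma ConeSupported.energy_eq_zero {u : SpaceTime → ℝ} (h : ConeSupported u) {t : ℝ}
    (ht : t < -4) : energy u t = 0 := by
  unfold energy
  have : ∀ x, _root_.energyDensity u (t, x) = 0 := fun x =>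
    h.energyDensity _ (by have := norm_nonneg x; simp only; linarith)
  simp [this]

lemma dirDeriv_time_energyDensity {u : SpaceTime → ℝ} (hu : ContDiff ℝ (⊤ : ℕ∞) u) (t : ℝ)
    (x : Space3) :
    dirDeriv timeVec (energyDensity u) (t, x)
      = 2 * dirDeriv timeVec u (t, x) * (dirDeriv timeVec (dirDeriv timeVec u) (t, x)
          - divForm (fun y => u (t, y)) x)
        + 2 * ∑ i, spatialDeriv i (fun y => dirDeriv timeVec u (t, y)
            * ∑ j, metricCoeff i j y * spatialDeriv j (fun y => u (t, y)) y) x := by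
  have hd : ∀ v, ContDiff ℝ (⊤ : ℕ∞) (dirDeriv v u) := contDiff_top_dirDeriv hu
  have hf : ∀ v, HasFDerivAt (dirDeriv v u) _ (t, x) := fun v =>
    ((hd v).differentiable (by simp) (t, x)).hasFDerivAt
  have hA : ∀ i j, HasFDerivAt (fun z : SpaceTime => metricCoeff i j z.2) _ (t, x) := fun i j =>
    HasFDerivAt.comp (g := metricCoeff i j) (f := Prod.snd) (t, x)
      ((contDiff_metricCoeff i j).differentiable (by simp) x).hasFDerivAt hasFDerivAt_snd
  have h1 : dirDeriv timeVec (energyDensity u) (t, x)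
      = 2 * dirDeriv timeVec u (t, x) * dirDeriv timeVec (dirDeriv timeVec u) (t, x)
        + 2 * ∑ i, ∑ j, metricCoeff i j x * dirDeriv timeVec (dirDeriv (spaceVec i) u) (t, x)
          * dirDeriv (spaceVec j) u (t, x) := by
    have hfull : HasFDerivAt (energyDensity u) _ (t, x) :=
      ((hf timeVec).pow 2).add (HasFDerivAt.fun_sum fun i _ => HasFDerivAt.fun_sum fun j _ =>
        ((hA i j).mul (hf (spaceVec i))).mul (hf (spaceVec j)))
    have e : ∀ v, fderiv ℝ (dirDeriv v u) (t, x) timeVec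
        = dirDeriv timeVec (dirDeriv v u) (t, x) := fun v => rfl
    have e0 : timeVec.2 = 0 := rfl
    conv_lhs => unfold dirDeriv
    rw [hfull.fderiv]
    simp [Fin.sum_univ_three, e, e0]
    rw [metricCoeff_symm 1 0, metricCoeff_symm 2 0, metricCoeff_symm 2 1]
    ring
  have hs := contDiff_slice hu t
  have hW : ∀ i, ContDiff ℝ (⊤ : ℕ∞) fun y =>
      ∑ j, metricCoeff i j y * spatialDeriv j (fun y => u (t, y)) y := fun i =>
    ContDiff.sum fun j _ => (contDiff_metricCoeff i j).mul (contDiff_spatialDeriv hs j)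
  have h2 : ∀ i, spatialDeriv i (fun y => dirDeriv timeVec u (t, y)
      * ∑ j, metricCoeff i j y * spatialDeriv j (fun y => u (t, y)) y) x
      = dirDeriv timeVec u (t, x) * spatialDeriv i (fun y =>
          ∑ j, metricCoeff i j y * spatialDeriv j (fun y => u (t, y)) y) x
        + ∑ j, metricCoeff i j x * dirDeriv timeVec (dirDeriv (spaceVec i) u) (t, x)
          * dirDeriv (spaceVec j) u (t, x) := by
    intro i
    have a1 := ((contDiff_slice (hd timeVec) t).differentiable (by simp) x).hasFDerivAt
    have a2 := ((hW i).differentiable (by simp) x).hasFDerivAt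
    have a3 : HasFDerivAt (fun y => dirDeriv timeVec u (t, y)
      * ∑ j, metricCoeff i j y * spatialDeriv j (fun y => u (t, y)) y) _ x := a1.mul a2
    have a4 := spatialDeriv_slice (hd timeVec) i t x
    have a5 := fun j => spatialDeriv_slice hu j t x
    rw [dirDeriv_comm hu, ← a4]
    simp only [← a5]
    have e : ∀ h : Space3 → ℝ, spatialDeriv i h x = fderiv ℝ h x (EuclideanSpace.single i 1) :=
      fun h => rfl
    rw [e, a3.fderiv, e]
    simp only [_root_.add_apply, _root_.smul_apply, smul_eq_mul]
    rw [e, Finset.sum_mul]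
    congr 1
    exact Finset.sum_congr rfl fun j _ => by ring
  rw [h1]
  simp only [h2, Finset.sum_add_distrib, ← Finset.mul_sum]
  unfold divForm
  ring

lemma hasDerivAt_energy {u : SpaceTime → ℝ} (hu : ContDiff ℝ (⊤ : ℕ∞) u) (hc : ConeSupported u)
    {F : SpaceTime → ℝ} (hF : ∀ t x, dirDeriv timeVec (dirDeriv timeVec u) (t, x)
      - divForm (fun y => u (t, y)) x = F (t, x)) (t : ℝ) :
    HasDerivAt (energy u) (∫ x, 2 * dirDeriv timeVec u (t, x) * F (t, x)) t := by
  have h := hasDerivAt_integral_slice (contDiff_energyDensity hu) hc.energyDensity t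
  refine h.congr_deriv ?_
  have hd : ContDiff ℝ (⊤ : ℕ∞) (dirDeriv timeVec u) := contDiff_top_dirDeriv hu timeVec
  have hs := contDiff_slice hu t
  set X : Fin 3 → Space3 → ℝ := fun i y => dirDeriv timeVec u (t, y)
    * ∑ j, metricCoeff i j y * spatialDeriv j (fun y => u (t, y)) y with hX
  have hXs : ∀ i, ContDiff ℝ (⊤ : ℕ∞) (X i) := fun i => (contDiff_slice hd t).mul
    (ContDiff.sum fun j _ => (contDiff_metricCoeff i j).mul (contDiff_spatialDeriv hs j))
  have hXc : ∀ i, HasCompactSupport (X i) := fun i =>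
    ((hc.dirDeriv timeVec).hasCompactSupport_slice t).mul_right
  have hXi : ∀ i, Integrable (spatialDeriv i (X i)) := fun i =>
    (contDiff_spatialDeriv (hXs i) i).continuous.integrable_of_hasCompactSupport
      ((hXc i).fderiv_apply ℝ _)
  have hz : ∫ x, 2 * ∑ i, spatialDeriv i (X i) x = 0 := by
    rw [integral_const_mul, integral_finsetSum _ fun i _ => hXi i]
    simp [integral_spatialDeriv_eq_zero (hXs _) (hXc _)]
  have hi2 : Integrable fun x => 2 * ∑ i, spatialDeriv i (X i) x :=
    (integrable_finsetSum _ fun i _ => hXi i).const_mul 2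
  have hi1 : Integrable fun x => dirDeriv timeVec (energyDensity u) (t, x) :=
    (contDiff_slice (contDiff_top_dirDeriv (contDiff_energyDensity hu) _) t).continuous
      |>.integrable_of_hasCompactSupport
      ((hc.energyDensity.dirDeriv timeVec).hasCompactSupport_slice t)
  rw [← sub_zero (∫ x, dirDeriv timeVec (energyDensity u) (t, x)), ← hz, ← integral_sub hi1 hi2]
  refine integral_congr_ae (.of_forall fun x => ?_)
  simp only [dirDeriv_time_energyDensity hu, hF]
  ring

/-- The energy of a forced wave vanishing in the past grows at most quadratically. -/
lemma energy_le {u : SpaceTime → ℝ} (hu : ContDiff ℝ (⊤ : ℕ∞) u) (hc : ConeSupported u)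
    {a : ℝ → ℝ} {e : Space3 → ℝ} (he : Continuous e) (hes : HasCompactSupport e) {M : ℝ}
    (ha : ∀ t, |a t| ≤ M)
    (hF : ∀ t x, dirDeriv timeVec (dirDeriv timeVec u) (t, x)
      - divForm (fun y => u (t, y)) x = a t * e x) {t : ℝ} (ht : -5 < t) :
    energy u t ≤ 3 * (t + 5) ^ 2 * M ^ 2 * ∫ x, e x ^ 2 := by
  set D := t + 5 with hD
  have hD0 : 0 < D := by linarith
  set N := ∫ x, e x ^ 2 with hN
  have hN0 : 0 ≤ N := integral_nonneg fun x => sq_nonneg _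
  have hder := hasDerivAt_energy (F := fun z => a z.1 * e z.2) hu hc hF
  have hei : Integrable fun x => e x ^ 2 :=
    (he.pow 2).integrable_of_hasCompactSupport (by
      simpa only [sq] using hes.mul_right (f' := e))
  have hdc := contDiff_slice (contDiff_top_dirDeriv hu timeVec)
  have hbound : ∀ s, ∫ x, 2 * dirDeriv timeVec u (s, x) * (a s * e x)
      ≤ D⁻¹ * energy u s + D * M ^ 2 * N := by
    intro s
    have hi : Integrable fun x => energyDensity u (s, x) :=
      (contDiff_slice (contDiff_energyDensity hu) s).continuous.integrable_of_hasCompactSupport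
        (hc.energyDensity.hasCompactSupport_slice s)
    rw [energy, hN, ← integral_const_mul, ← integral_const_mul,
      ← integral_add (hi.const_mul _) (hei.const_mul _)]
    refine integral_mono ?_ ((hi.const_mul _).add (hei.const_mul _)) fun x => ?_
    · refine Continuous.integrable_of_hasCompactSupport ?_ ?_
      · have := (hdc s).continuous
        fun_prop
      · exact (hes.mul_left (f := fun _ => a s)).mul_left
    · have h1 := sq_dirDeriv_le_energyDensity u (s, x)
      have h2 : a s ^ 2 ≤ M ^ 2 := sq_le_sq' (by linarith [(abs_le.1 (ha s)).1]) (abs_le.1 (ha s)).2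
      set p := dirDeriv timeVec u (s, x)
      have h3 : 2 * p * (a s * e x) ≤ D⁻¹ * p ^ 2 + D * (a s * e x) ^ 2 := by
        have : 0 ≤ D⁻¹ * (p - D * (a s * e x)) ^ 2 := by positivity
        have h4 : D⁻¹ * (p - D * (a s * e x)) ^ 2
            = D⁻¹ * p ^ 2 + D * (a s * e x) ^ 2 - 2 * p * (a s * e x) := by
          field_simp
          ring
        linarith
      refine h3.trans (add_le_add (by gcongr) ?_)
      rw [mul_pow, ← mul_assoc]
      gcongr
  set Φ : ℝ → ℝ := fun s => Real.exp (-(D⁻¹ * s)) * (energy u s + D ^ 2 * M ^ 2 * N) with hΦ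
  have hΦd : ∀ s, HasDerivAt Φ (Real.exp (-(D⁻¹ * s)) * -(D⁻¹ * 1)
      * (energy u s + D ^ 2 * M ^ 2 * N) + Real.exp (-(D⁻¹ * s))
      * ∫ x, 2 * dirDeriv timeVec u (s, x) * (a s * e x)) s := fun s =>
    (((hasDerivAt_id s).const_mul D⁻¹).neg.exp).mul ((hder s).add_const _)
  have hanti : Antitone Φ := by
    refine antitone_of_deriv_nonpos (fun s => (hΦd s).differentiableAt) fun s => ?_
    rw [(hΦd s).deriv]
    have h1 := hbound s
    have h2 : D⁻¹ * (D ^ 2 * M ^ 2 * N) = D * M ^ 2 * N := by field_simp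
    have h3 := Real.exp_pos (-(D⁻¹ * s))
    have : Real.exp (-(D⁻¹ * s)) * (∫ x, 2 * dirDeriv timeVec u (s, x) * (a s * e x))
        ≤ Real.exp (-(D⁻¹ * s)) * (D⁻¹ * (energy u s + D ^ 2 * M ^ 2 * N)) := by
      gcongr
      rw [mul_add, h2]
      exact h1
    linarith
  have h0 := hanti (show -5 ≤ t by linarith)
  simp only [hΦ] at h0
  rw [hc.energy_eq_zero (by norm_num : (-5 : ℝ) < -4), zero_add] at h0
  have hexp : Real.exp (-(D⁻¹ * -5)) = Real.exp 1 * Real.exp (-(D⁻¹ * t)) := by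
    rw [← Real.exp_add]
    congr 1
    field_simp
    rw [hD]
    ring
  rw [hexp, mul_comm (Real.exp 1), mul_assoc (Real.exp (-(D⁻¹ * t))) (Real.exp 1)] at h0
  have h1 := le_of_mul_le_mul_left h0 (Real.exp_pos _)
  have h2 : Real.exp 1 ≤ 3 := Real.exp_one_lt_three.le
  have h3 : 0 ≤ D ^ 2 * M ^ 2 * N := by positivity
  nlinarith [mul_le_mul_of_nonneg_right h2 h3]

/-- The complex coordinate `x₀ + i x₁`. -/
noncomputable def planeCoord : Space3 →L[ℝ] ℂ :=
  Complex.ofRealCLM.comp (EuclideanSpace.proj 0)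
    + Complex.I • Complex.ofRealCLM.comp (EuclideanSpace.proj 1)

lemma planeCoord_apply (x : Space3) : planeCoord x = x 0 + x 1 * Complex.I := by
  simp [planeCoord, mul_comm]

lemma norm_planeCoord_sq (x : Space3) : ‖planeCoord x‖ ^ 2 = x 0 ^ 2 + x 1 ^ 2 := by
  rw [planeCoord_apply, Complex.sq_norm, Complex.normSq_add_mul_I]

lemma norm_planeCoord_le (x : Space3) : ‖planeCoord x‖ ≤ ‖x‖ := by
  refine le_of_sq_le_sq ?_ (norm_nonneg x)
  rw [norm_planeCoord_sq, space3_norm_sq]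
  nlinarith [sq_nonneg (x 2)]

/-- The harmonic polynomial `Re (c (x₀ + i x₁)^m)`. -/
noncomputable def planeMode (c : ℂ) (m : ℕ) (x : Space3) : ℝ := (c * planeCoord x ^ m).re

lemma contDiff_planeMode (c : ℂ) (m : ℕ) : ContDiff ℝ (⊤ : ℕ∞) (planeMode c m) :=
  Complex.reCLM.contDiff.comp (contDiff_const.mul (planeCoord.contDiff.pow m))

lemma fderiv_planeMode (c : ℂ) (m : ℕ) (x v : Space3) :
    fderiv ℝ (planeMode c m) x v = (c * m * planeCoord x ^ (m - 1) * planeCoord v).re := by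
  have h : HasFDerivAt (planeMode c m) _ x := Complex.reCLM.hasFDerivAt.comp x
    (((planeCoord.hasFDerivAt (x := x)).pow m).const_mul c)
  rw [h.fderiv]
  simp [mul_assoc]

lemma spatialDeriv_planeMode (c : ℂ) (m : ℕ) (i : Fin 3) :
    spatialDeriv i (planeMode c m)
      = planeMode (c * m * planeCoord (EuclideanSpace.single i 1)) (m - 1) := by
  funext x
  rw [spatialDeriv, fderiv_planeMode, planeMode]
  congr 1
  ring

lemma laplacian_planeMode (c : ℂ) (m : ℕ) (x : Space3) :
    ∑ i, spatialDeriv i (spatialDeriv i (planeMode c m)) x = 0 := by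
  simp only [spatialDeriv_planeMode, Fin.sum_univ_three, planeMode, ← Complex.add_re, ← add_mul]
  have : ∀ a b : ℂ, a * planeCoord (EuclideanSpace.single 0 1) * b
        * planeCoord (EuclideanSpace.single 0 1)
      + a * planeCoord (EuclideanSpace.single 1 1) * b * planeCoord (EuclideanSpace.single 1 1)
      + a * planeCoord (EuclideanSpace.single 2 1) * b * planeCoord (EuclideanSpace.single 2 1)
      = 0 := by
    intro a b
    simp only [planeCoord_apply]
    simp
    linear_combination a * b * Complex.I_mul_I
  rw [this]
  simp

lemma euler_planeMode (c : ℂ) (m : ℕ) (x : Space3) :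
    ∑ i, x i * spatialDeriv i (planeMode c m) x = m * planeMode c m x := by
  have h : fderiv ℝ (planeMode c m) x x = m * planeMode c m x := by
    rw [fderiv_planeMode]
    cases m with
    | zero => simp
    | succ n =>
      have : c * ((n + 1 : ℕ) : ℂ) * planeCoord x ^ (n + 1 - 1) * planeCoord x
          = (((n + 1 : ℕ) : ℝ) : ℂ) * (c * planeCoord x ^ (n + 1)) := by
        push_cast
        ring
      rw [this, Complex.re_ofReal_mul]
      rfl
  rw [← h, congrArg (fderiv ℝ (planeMode c m) x) (space3_eq_sum x)]
  simp [spatialDeriv, Fin.sum_univ_three]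

lemma planeMode_planeRot (c : ℂ) (m : ℕ) (θ : ℝ) (x : Space3) :
    planeMode c m (planeRot 0 1 θ x) + planeMode c m (planeRot 0 1 (-θ) x)
      = 2 * Real.cos (m * θ) * planeMode c m x := by
  have h : ∀ θ : ℝ, planeCoord (planeRot 0 1 θ x) = Complex.exp (θ * Complex.I) * planeCoord x := by
    intro θ
    rw [Complex.exp_mul_I, planeCoord_apply, planeCoord_apply]
    simp [planeRot_apply]
    linear_combination (-(Complex.sin θ * x 1)) * Complex.I_mul_I
  unfold planeMode
  rw [h, h, mul_pow, mul_pow, ← Complex.exp_nat_mul, ← Complex.exp_nat_mul, ← Complex.add_re]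
  have : c * (Complex.exp (m * (θ * Complex.I)) * planeCoord x ^ m)
      + c * (Complex.exp (m * ((-θ : ℝ) * Complex.I)) * planeCoord x ^ m)
      = ((2 * Real.cos (m * θ) : ℝ) : ℂ) * (c * planeCoord x ^ m) := by
    push_cast
    rw [Complex.two_cos]
    ring_nf
  rw [this, Complex.re_ofReal_mul]

lemma laplacian_planeMode_mul_radial (c : ℂ) (m : ℕ) {Q : ℝ → ℝ} (hQ : ContDiff ℝ (⊤ : ℕ∞) Q)
    (x : Space3) :
    ∑ i, spatialDeriv i (spatialDeriv i fun y => planeMode c m y * Q (‖y‖ ^ 2)) x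
      = planeMode c m x * (4 * ‖x‖ ^ 2 * deriv (deriv Q) (‖x‖ ^ 2)
        + (6 + 4 * m) * deriv Q (‖x‖ ^ 2)) := by
  have e' : ∀ (i : Fin 3) (h : Space3 → ℝ) (x : Space3),
      spatialDeriv i h x = fderiv ℝ h x (EuclideanSpace.single i 1) := fun _ _ _ => rfl
  have hp := fun x => ((contDiff_planeMode c m).differentiable (by simp) x).hasFDerivAt
  have hr : ∀ {Q : ℝ → ℝ}, ContDiff ℝ (⊤ : ℕ∞) Q → ∀ x : Space3,
      HasFDerivAt (fun y : Space3 => Q (‖y‖ ^ 2)) _ x := fun hQ x =>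
    (hQ.differentiable (by simp) _).hasDerivAt.comp_hasFDerivAt x
      (hasStrictFDerivAt_norm_sq x).hasFDerivAt
  have hQ' : ContDiff ℝ (⊤ : ℕ∞) (deriv Q) := (contDiff_infty_iff_deriv.1 hQ).2
  have h1 : ∀ i, spatialDeriv i (fun y => planeMode c m y * Q (‖y‖ ^ 2))
      = fun y => spatialDeriv i (planeMode c m) y * Q (‖y‖ ^ 2)
        + 2 * (planeMode c m y * y i * deriv Q (‖y‖ ^ 2)) := by
    intro i
    funext y
    have h : HasFDerivAt (fun y => planeMode c m y * Q (‖y‖ ^ 2)) _ y := (hp y).mul (hr hQ y)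
    rw [e', h.fderiv, e']
    simp [EuclideanSpace.inner_single_right]
    ring
  have h2 : ∀ i, spatialDeriv i (spatialDeriv i fun y => planeMode c m y * Q (‖y‖ ^ 2)) x
      = spatialDeriv i (spatialDeriv i (planeMode c m)) x * Q (‖x‖ ^ 2)
        + 4 * deriv Q (‖x‖ ^ 2) * (x i * spatialDeriv i (planeMode c m) x)
        + 2 * planeMode c m x * deriv Q (‖x‖ ^ 2)
        + 4 * planeMode c m x * deriv (deriv Q) (‖x‖ ^ 2) * x i ^ 2 := by
    intro i
    have hpi := ((contDiff_spatialDeriv (contDiff_planeMode c m) i).differentiable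
      (by simp) x).hasFDerivAt
    have hxi : HasFDerivAt (fun y : Space3 => y i) (EuclideanSpace.proj i : Space3 →L[ℝ] ℝ) x :=
      (EuclideanSpace.proj i : Space3 →L[ℝ] ℝ).hasFDerivAt
    have h : HasFDerivAt (fun y => spatialDeriv i (planeMode c m) y * Q (‖y‖ ^ 2)
        + 2 * (planeMode c m y * y i * deriv Q (‖y‖ ^ 2))) _ x :=
      (hpi.mul (hr hQ x)).add ((((hp x).mul hxi).mul (hr hQ' x)).const_mul 2)
    rw [h1, e', h.fderiv]
    simp [EuclideanSpace.inner_single_right, e']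
    ring
  simp only [h2, Finset.sum_add_distrib, ← Finset.sum_mul, ← Finset.mul_sum,
    laplacian_planeMode, euler_planeMode]
  rw [space3_norm_sq]
  simp [Fin.sum_univ_three]
  ring

/-- A smooth cutoff equal to `1` on `s ≤ 4` and to `0` on `5 ≤ s`. -/
noncomputable def radialCutoff (s : ℝ) : ℝ := Real.smoothTransition (5 - s)

lemma contDiff_radialCutoff : ContDiff ℝ (⊤ : ℕ∞) radialCutoff :=
  Real.smoothTransition.contDiff.comp (contDiff_const.sub contDiff_id)

lemma radialCutoff_of_le {s : ℝ} (hs : s ≤ 4) : radialCutoff s = 1 :=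
  Real.smoothTransition.one_of_one_le (by linarith)

lemma radialCutoff_of_ge {s : ℝ} (hs : 5 ≤ s) : radialCutoff s = 0 :=
  Real.smoothTransition.zero_of_nonpos (by linarith)

lemma deriv_radialCutoff_of_lt {s : ℝ} (hs : s < 4) :
    deriv radialCutoff s = 0 ∧ deriv (deriv radialCutoff) s = 0 := by
  have h : radialCutoff =ᶠ[nhds s] fun _ => 1 := by
    filter_upwards [Iio_mem_nhds hs] with t ht using radialCutoff_of_le (le_of_lt ht)
  exact ⟨by simp [h.deriv_eq], by simp [h.deriv.deriv_eq]⟩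

lemma deriv_radialCutoff_of_gt {s : ℝ} (hs : 5 < s) :
    deriv radialCutoff s = 0 ∧ deriv (deriv radialCutoff) s = 0 := by
  have h : radialCutoff =ᶠ[nhds s] fun _ => 0 := by
    filter_upwards [Ioi_mem_nhds hs] with t ht using radialCutoff_of_ge (le_of_lt ht)
  exact ⟨by simp [h.deriv_eq], by simp [h.deriv.deriv_eq]⟩

lemma exists_bound_deriv_radialCutoff :
    ∃ K : ℝ, 0 ≤ K ∧ ∀ s, |deriv radialCutoff s| ≤ K ∧ |deriv (deriv radialCutoff) s| ≤ K := by
  have h1 := (contDiff_infty_iff_deriv.1 contDiff_radialCutoff).2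
  have h2 := (contDiff_infty_iff_deriv.1 h1).2
  obtain ⟨A, hA⟩ := (isCompact_Icc (a := (4 : ℝ)) (b := 5)).exists_bound_of_continuousOn
    h1.continuous.continuousOn
  obtain ⟨B, hB⟩ := (isCompact_Icc (a := (4 : ℝ)) (b := 5)).exists_bound_of_continuousOn
    h2.continuous.continuousOn
  refine ⟨max 0 (max A B), le_max_left _ _, fun s => ?_⟩
  by_cases hs : s ∈ Icc (4 : ℝ) 5
  · exact ⟨(hA s hs).trans (by simp), (hB s hs).trans (by simp)⟩
  · rcases lt_or_ge s 4 with h | h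
    · simp [deriv_radialCutoff_of_lt h]
    · have : 5 < s := by
        by_contra! h'
        exact hs ⟨h, h'⟩
      simp [deriv_radialCutoff_of_gt this]

/-- The radial factor of the quasimodes. -/
noncomputable def gaussCutoff (m : ℕ) (s : ℝ) : ℝ := radialCutoff s * Real.exp (-(m / 2) * s)

lemma contDiff_gaussCutoff (m : ℕ) : ContDiff ℝ (⊤ : ℕ∞) (gaussCutoff m) :=
  contDiff_radialCutoff.mul (Real.contDiff_exp.comp (contDiff_const.mul contDiff_id))

lemma deriv_gaussCutoff (m : ℕ) (s : ℝ) :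
    deriv (gaussCutoff m) s
      = (deriv radialCutoff s - m / 2 * radialCutoff s) * Real.exp (-(m / 2) * s) := by
  have h1 := (contDiff_radialCutoff.differentiable (by simp) s).hasDerivAt
  have h2 : HasDerivAt (gaussCutoff m) _ s :=
    h1.mul (((hasDerivAt_id s).const_mul (-((m : ℝ) / 2))).exp)
  rw [h2.deriv]
  simp
  ring

lemma deriv_deriv_gaussCutoff (m : ℕ) (s : ℝ) :
    deriv (deriv (gaussCutoff m)) s
      = (deriv (deriv radialCutoff) s - m * deriv radialCutoff s
        + m ^ 2 / 4 * radialCutoff s) * Real.exp (-(m / 2) * s) := by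
  have h1 := (contDiff_radialCutoff.differentiable (by simp) s).hasDerivAt
  have h1' := ((contDiff_infty_iff_deriv.1 contDiff_radialCutoff).2.differentiable
    (by simp) s).hasDerivAt
  have h2 : HasDerivAt (fun s => (deriv radialCutoff s - m / 2 * radialCutoff s)
      * Real.exp (-(m / 2) * s)) _ s :=
    (h1'.sub (h1.const_mul _)).mul (((hasDerivAt_id s).const_mul (-((m : ℝ) / 2))).exp)
  rw [funext (deriv_gaussCutoff m), h2.deriv]
  simp
  ring

/-- A quasimode concentrated near the trapped geodesics. -/
noncomputable def quasimode (c : ℂ) (m : ℕ) (x : Space3) : ℝ :=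
  planeMode c m x * gaussCutoff m (‖x‖ ^ 2)

/-- The squared frequency of the quasimodes. -/
noncomputable def freqSq (m : ℕ) : ℝ := m * (2 * m + 3)

/-- The error made by a quasimode. -/
noncomputable def quasimodeError (c : ℂ) (m : ℕ) (x : Space3) : ℝ :=
  divForm (quasimode c m) x + freqSq m * quasimode c m x

lemma contDiff_quasimode (c : ℂ) (m : ℕ) : ContDiff ℝ (⊤ : ℕ∞) (quasimode c m) :=
  (contDiff_planeMode c m).mul ((contDiff_gaussCutoff m).comp (contDiff_id.norm_sq ℝ))

lemma contDiff_divForm {f : Space3 → ℝ} (hf : ContDiff ℝ (⊤ : ℕ∞) f) :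
    ContDiff ℝ (⊤ : ℕ∞) (divForm f) :=
  ContDiff.sum fun i _ => contDiff_spatialDeriv (ContDiff.sum fun j _ =>
    (contDiff_metricCoeff i j).mul (contDiff_spatialDeriv hf j)) i

lemma contDiff_quasimodeError (c : ℂ) (m : ℕ) : ContDiff ℝ (⊤ : ℕ∞) (quasimodeError c m) :=
  (contDiff_divForm (contDiff_quasimode c m)).add (contDiff_const.mul (contDiff_quasimode c m))

lemma quasimode_of_ge (c : ℂ) (m : ℕ) {x : Space3} (hx : 5 ≤ ‖x‖ ^ 2) : quasimode c m x = 0 := by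
  simp [quasimode, gaussCutoff, radialCutoff_of_ge hx]

lemma quasimode_planeRot (c : ℂ) (m : ℕ) (θ : ℝ) (x : Space3) :
    quasimode c m (planeRot 0 1 θ x) + quasimode c m (planeRot 0 1 (-θ) x)
      = 2 * Real.cos (m * θ) * quasimode c m x := by
  have h01 : (0 : Fin 3) ≠ 1 := by decide
  unfold quasimode
  rw [norm_planeRot h01, norm_planeRot h01, ← add_mul, planeMode_planeRot]
  ring

lemma quasimodeError_eq (c : ℂ) (m : ℕ) (x : Space3) :
    quasimodeError c m x = planeMode c m x * Real.exp (-(m / 2) * ‖x‖ ^ 2)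
      * (4 * ‖x‖ ^ 2 * deriv (deriv radialCutoff) (‖x‖ ^ 2)
        + (6 + 4 * m - 4 * m * ‖x‖ ^ 2) * deriv radialCutoff (‖x‖ ^ 2)) := by
  have hβ : perturbation x * radialCutoff (‖x‖ ^ 2) = ‖x‖ ^ 2 * radialCutoff (‖x‖ ^ 2) := by
    rcases le_total (‖x‖ ^ 2) 5 with h | h
    · rw [perturbation, profile_of_le h]
    · rw [radialCutoff_of_ge h, mul_zero, mul_zero]
  have h1 := divForm_of_mode (contDiff_quasimode c m) (quasimode_planeRot c m) x
  have h2 := laplacian_planeMode_mul_radial c m (contDiff_gaussCutoff m) x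
  rw [quasimodeError, h1]
  change ∑ i, spatialDeriv i (spatialDeriv i fun y => planeMode c m y * gaussCutoff m (‖y‖ ^ 2)) x
    - _ + _ = _
  rw [h2, deriv_gaussCutoff, deriv_deriv_gaussCutoff, freqSq, quasimode, gaussCutoff]
  linear_combination (-(m : ℝ) ^ 2 * planeMode c m x * Real.exp (-(m / 2) * ‖x‖ ^ 2)) * hβ

lemma quasimodeError_eq_zero (c : ℂ) (m : ℕ) {x : Space3} (hx : ‖x‖ ^ 2 ∉ Icc (4 : ℝ) 5) :
    quasimodeError c m x = 0 := by
  rw [quasimodeError_eq]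
  rcases lt_or_ge (‖x‖ ^ 2) 4 with h | h
  · simp [deriv_radialCutoff_of_lt h]
  · have : 5 < ‖x‖ ^ 2 := by
      by_contra! h'
      exact hx ⟨h, h'⟩
    simp [deriv_radialCutoff_of_gt this]

lemma quasimodeError_planeRot (c : ℂ) (m : ℕ) (θ : ℝ) (x : Space3) :
    quasimodeError c m (planeRot 0 1 θ x) + quasimodeError c m (planeRot 0 1 (-θ) x)
      = 2 * Real.cos (m * θ) * quasimodeError c m x := by
  have h01 : (0 : Fin 3) ≠ 1 := by decide
  simp only [quasimodeError_eq, norm_planeRot h01]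
  rw [← add_mul, ← add_mul, planeMode_planeRot]
  ring

lemma hasCompactSupport_of_norm_sq {f : Space3 → ℝ} (hf : ∀ x, 5 < ‖x‖ ^ 2 → f x = 0) :
    HasCompactSupport f := by
  refine HasCompactSupport.intro (isCompact_closedBall (0 : Space3) 3) fun x hx => hf x ?_
  have hx' : 3 < ‖x‖ := by simpa using hx
  nlinarith

lemma hasCompactSupport_quasimode (c : ℂ) (m : ℕ) : HasCompactSupport (quasimode c m) :=
  hasCompactSupport_of_norm_sq fun _ hx => quasimode_of_ge c m hx.le

lemma hasCompactSupport_quasimodeError (c : ℂ) (m : ℕ) : HasCompactSupport (quasimodeError c m) :=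
  hasCompactSupport_of_norm_sq fun _ hx => quasimodeError_eq_zero c m fun h => absurd h.2 hx.not_ge

lemma exp_half_sq (m : ℕ) (s : ℝ) : Real.exp (-(m / 2) * s) ^ 2 = Real.exp (-s) ^ m := by
  rw [← Real.exp_nat_mul, ← Real.exp_nat_mul]
  congr 1
  push_cast
  ring

lemma sq_planeMode_le {c : ℂ} (hc : ‖c‖ = 1) (m : ℕ) (x : Space3) :
    planeMode c m x ^ 2 ≤ (‖x‖ ^ 2) ^ m := by
  have h1 : |planeMode c m x| ≤ ‖x‖ ^ m := by
    refine (Complex.abs_re_le_norm _).trans ?_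
    rw [norm_mul, norm_pow, hc, one_mul]
    exact pow_le_pow_left₀ (norm_nonneg _) (norm_planeCoord_le x) m
  rw [← sq_abs, ← pow_mul, mul_comm 2 m, pow_mul]
  exact pow_le_pow_left₀ (abs_nonneg _) h1 2

/-- The squared error of a quasimode is of the size of the Gaussian factor on the cutoff region. -/
lemma exists_integral_sq_quasimodeError_le :
    ∃ K : ℝ, 0 ≤ K ∧ ∀ (c : ℂ) (m : ℕ), ‖c‖ = 1 → 1 ≤ m →
      ∫ x, quasimodeError c m x ^ 2 ≤ K * m ^ 2 * (4 * Real.exp (-4)) ^ m := by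
  obtain ⟨K, hK, hb⟩ := exists_bound_deriv_radialCutoff
  refine ⟨(42 * K) ^ 2 * (volume : Measure Space3).real (Metric.closedBall 0 3), by positivity,
    fun c m hc hm => ?_⟩
  have hm' : (1 : ℝ) ≤ m := by exact_mod_cast hm
  have hpt : ∀ x : Space3, quasimodeError c m x ^ 2
      ≤ (Metric.closedBall (0 : Space3) 3).indicator
        (fun _ => (42 * K * m) ^ 2 * (4 * Real.exp (-4)) ^ m) x := by
    intro x
    by_cases hx : ‖x‖ ^ 2 ∈ Icc (4 : ℝ) 5
    · have hx3 : x ∈ Metric.closedBall (0 : Space3) 3 := by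
        simpa using (abs_le_of_sq_le_sq (by linarith [hx.2]) (by norm_num) : |‖x‖| ≤ 3)
      rw [indicator_of_mem hx3, quasimodeError_eq]
      set s := ‖x‖ ^ 2 with hs
      have h1 : |4 * s * deriv (deriv radialCutoff) s
          + (6 + 4 * m - 4 * m * s) * deriv radialCutoff s| ≤ 42 * K * m := by
        obtain ⟨b1, b2⟩ := hb s
        have a1 : |4 * s| ≤ 20 := abs_le.2 ⟨by linarith [hx.1], by linarith [hx.2]⟩
        have a2 : |6 + 4 * (m : ℝ) - 4 * m * s| ≤ 22 * m :=
          abs_le.2 ⟨by nlinarith [hx.1, hx.2], by nlinarith [hx.1, hx.2]⟩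
        calc _ ≤ |4 * s * deriv (deriv radialCutoff) s|
              + |(6 + 4 * m - 4 * m * s) * deriv radialCutoff s| := abs_add_le _ _
          _ ≤ 20 * K + 22 * m * K := by
              rw [abs_mul (4 * s), abs_mul (6 + 4 * (m : ℝ) - 4 * m * s)]
              gcongr
          _ ≤ 42 * K * m := by nlinarith
      have h2 : s * Real.exp (-s) ≤ 4 * Real.exp (-4) := by
        have : s - 4 + 1 ≤ Real.exp (s - 4) := Real.add_one_le_exp _
        have e : Real.exp (-4) = Real.exp (s - 4) * Real.exp (-s) := by
          rw [← Real.exp_add]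
          congr 1
          ring
        rw [e, ← mul_assoc]
        gcongr
        linarith [hx.1]
      have hs0 : 0 ≤ s := sq_nonneg _
      calc _ = (planeMode c m x ^ 2 * Real.exp (-s) ^ m) * |4 * s * deriv (deriv radialCutoff) s
              + (6 + 4 * m - 4 * m * s) * deriv radialCutoff s| ^ 2 := by
              rw [sq_abs, ← exp_half_sq]
              ring
        _ ≤ (s ^ m * Real.exp (-s) ^ m) * (42 * K * m) ^ 2 := by
              gcongr
              exact sq_planeMode_le hc m x
        _ = (42 * K * m) ^ 2 * (s * Real.exp (-s)) ^ m := by rw [mul_pow s]; ring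
        _ ≤ _ := by gcongr
    · rw [quasimodeError_eq_zero c m hx, sq, mul_zero]
      exact indicator_nonneg (fun _ _ => by positivity) x
  calc _ ≤ ∫ x, (Metric.closedBall (0 : Space3) 3).indicator
        (fun _ => (42 * K * m) ^ 2 * (4 * Real.exp (-4)) ^ m) x := by
        refine integral_mono_of_nonneg (.of_forall fun x => sq_nonneg _) ?_ (.of_forall hpt)
        exact (integrable_indicator_iff measurableSet_closedBall).2
          (integrableOn_const (measure_closedBall_lt_top).ne)
    _ = _ := by
        rw [integral_indicator measurableSet_closedBall, setIntegral_const, smul_eq_mul]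
        ring

/-- One of the two quasimodes of a given angular frequency carries half of the mass. -/
lemma exists_le_integral_sq_quasimode :
    ∃ κ : ℝ, 0 < κ ∧ ∀ m : ℕ, ∃ c : ℂ, ‖c‖ = 1 ∧
      κ * (0.81 * Real.exp (-1.21)) ^ m ≤ ∫ x, quasimode c m x ^ 2 := by
  set B := Metric.closedBall (EuclideanSpace.single 0 1 : Space3) 0.1 with hB
  have hvol : 0 < (volume : Measure Space3).real B :=
    ENNReal.toReal_pos (Metric.measure_closedBall_pos _ _ (by norm_num)).ne'
      measure_closedBall_lt_top.ne
  refine ⟨(volume : Measure Space3).real B / 2, by positivity, fun m => ?_⟩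
  have hi : ∀ c, Integrable fun x => quasimode c m x ^ 2 := fun c =>
    ((contDiff_quasimode c m).continuous.pow 2).integrable_of_hasCompactSupport (by
      simpa only [sq] using (hasCompactSupport_quasimode c m).mul_right (f' := quasimode c m))
  have hpt : ∀ x ∈ B, (0.81 * Real.exp (-1.21)) ^ m
      ≤ quasimode 1 m x ^ 2 + quasimode (-Complex.I) m x ^ 2 := by
    intro x hx
    have hx' : ‖x - EuclideanSpace.single 0 1‖ ≤ 0.1 := by simpa [hB, dist_eq_norm] using hx
    have h1 : ‖x‖ ≤ 1.1 := by
      have := norm_le_norm_add_norm_sub' x (EuclideanSpace.single 0 1 : Space3)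
      have h1 : ‖(EuclideanSpace.single 0 1 : Space3)‖ = 1 := by simp
      rw [h1] at this
      norm_num at this hx' ⊢
      linarith
    have h2 : 0.9 ≤ ‖planeCoord x‖ := by
      have a1 := norm_planeCoord_le (x - EuclideanSpace.single 0 1)
      rw [map_sub] at a1
      have a2 : planeCoord (EuclideanSpace.single 0 1) = 1 := by simp [planeCoord_apply]
      rw [a2] at a1
      have a3 := norm_le_norm_add_norm_sub (planeCoord x) (1 : ℂ)
      rw [norm_one] at a3
      norm_num at hx' ⊢
      linarith
    have h3 : ‖x‖ ^ 2 ≤ 1.21 := by nlinarith [norm_nonneg x]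
    have h4 : quasimode 1 m x ^ 2 + quasimode (-Complex.I) m x ^ 2
        = (‖planeCoord x‖ ^ 2 * Real.exp (-‖x‖ ^ 2)) ^ m := by
      rw [mul_pow, ← exp_half_sq, ← pow_mul, mul_comm 2 m, pow_mul, ← norm_pow, Complex.sq_norm,
        Complex.normSq_apply]
      simp only [quasimode, gaussCutoff, planeMode, radialCutoff_of_le (h3.trans (by norm_num))]
      simp
      ring
    rw [h4]
    gcongr
    nlinarith
  have hsum : (volume : Measure Space3).real B * (0.81 * Real.exp (-1.21)) ^ m
      ≤ (∫ x, quasimode 1 m x ^ 2) + ∫ x, quasimode (-Complex.I) m x ^ 2 := by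
    rw [← integral_add (hi _) (hi _)]
    have hii := (hi 1).add (hi (-Complex.I))
    refine le_trans ?_ (setIntegral_le_integral (s := B) hii (.of_forall fun x => ?_))
    · rw [← smul_eq_mul, ← setIntegral_const]
      exact setIntegral_mono_on (integrableOn_const measure_closedBall_lt_top.ne) hii.integrableOn
        measurableSet_closedBall hpt
    · simp only [Pi.zero_apply]
      positivity
  rcases le_total (∫ x, quasimode 1 m x ^ 2) (∫ x, quasimode (-Complex.I) m x ^ 2) with h | h
  · exact ⟨-Complex.I, by simp, by linarith⟩
  · exact ⟨1, by simp, by linarith⟩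

lemma exp_ratio : 4 * Real.exp (-4) ≤ Real.exp (-1) * (0.81 * Real.exp (-1.21)) := by
  have e : Real.exp (-1) * Real.exp (-1.21) = Real.exp (-4) * Real.exp 1.79 := by
    rw [← Real.exp_add, ← Real.exp_add]
    norm_num
  have h : (5 : ℝ) ≤ Real.exp 1.79 := by
    have h1 : (1.79 / 2 : ℝ) ^ 2 / 2 + 1.79 / 2 + 1 ≤ Real.exp (1.79 / 2) := by
      linarith [Real.quadratic_le_exp_of_nonneg (show (0 : ℝ) ≤ 1.79 / 2 by norm_num)]
    have h2 : Real.exp 1.79 = Real.exp (1.79 / 2) * Real.exp (1.79 / 2) := by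
      rw [← Real.exp_add]
      norm_num
    rw [h2]
    norm_num at h1 ⊢
    nlinarith
  nlinarith [Real.exp_pos (-4)]

/-- There are quasimodes with exponentially small error. -/
lemma exists_quasimode :
    ∃ K : ℝ, 0 ≤ K ∧ ∀ m : ℕ, 1 ≤ m → ∃ c : ℂ, 0 < ∫ x, quasimode c m x ^ 2 ∧
      ∫ x, quasimodeError c m x ^ 2
        ≤ K * m ^ 2 * Real.exp (-m) * ∫ x, quasimode c m x ^ 2 := by
  obtain ⟨K, hK, hE⟩ := exists_integral_sq_quasimodeError_le
  obtain ⟨κ, hκ, hN⟩ := exists_le_integral_sq_quasimode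
  refine ⟨K / κ, by positivity, fun m hm => ?_⟩
  obtain ⟨c, hc, hcm⟩ := hN m
  have hpos : 0 < κ * (0.81 * Real.exp (-1.21)) ^ m := by positivity
  refine ⟨c, hpos.trans_le hcm, (hE c m hc hm).trans ?_⟩
  have h1 : (4 * Real.exp (-4)) ^ m ≤ Real.exp (-m) * (0.81 * Real.exp (-1.21)) ^ m := by
    refine (pow_le_pow_left₀ (by positivity) exp_ratio m).trans_eq ?_
    rw [mul_pow, ← Real.exp_nat_mul]
    simp
  calc _ ≤ K * m ^ 2 * (Real.exp (-m) * (0.81 * Real.exp (-1.21)) ^ m) := by gcongr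
    _ = K / κ * m ^ 2 * Real.exp (-m) * (κ * (0.81 * Real.exp (-1.21)) ^ m) := by
        field_simp
    _ ≤ _ := by gcongr

lemma HasBddDerivs.deriv {f : ℝ → ℝ} (hf : HasBddDerivs f) : HasBddDerivs (deriv f) := by
  refine ⟨(contDiff_infty_iff_deriv.1 hf.1).2, fun k => ?_⟩
  obtain ⟨C, hC⟩ := hf.2 (k + 1)
  refine ⟨C, fun z => ?_⟩
  have := hC z
  rwa [norm_iteratedFDeriv_eq_norm_iteratedDeriv, iteratedDeriv_succ'] at *

/-- A function with separated time and space variables. -/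
def separated (b : ℝ → ℝ) (f : Space3 → ℝ) (z : SpaceTime) : ℝ := b z.1 * f z.2

lemma contDiff_separated {b : ℝ → ℝ} {f : Space3 → ℝ} (hb : ContDiff ℝ (⊤ : ℕ∞) b)
    (hf : ContDiff ℝ (⊤ : ℕ∞) f) : ContDiff ℝ (⊤ : ℕ∞) (separated b f) :=
  (hb.comp contDiff_fst).mul (hf.comp contDiff_snd)

lemma fderiv_separated {b : ℝ → ℝ} {f : Space3 → ℝ} (hb : ContDiff ℝ (⊤ : ℕ∞) b)
    (hf : ContDiff ℝ (⊤ : ℕ∞) f) (z v : SpaceTime) :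
    dirDeriv v (separated b f) z = b z.1 * fderiv ℝ f z.2 v.2 + f z.2 * (deriv b z.1 * v.1) := by
  have h0 : HasFDerivAt (fun z : SpaceTime => z.1) (ContinuousLinearMap.fst ℝ ℝ Space3) z :=
    hasFDerivAt_fst
  have h1 : HasFDerivAt (fun z : SpaceTime => b z.1) _ z :=
    (hb.differentiable (by simp) z.1).hasDerivAt.comp_hasFDerivAt z h0
  have h2 : HasFDerivAt (fun z : SpaceTime => f z.2) _ z :=
    HasFDerivAt.comp (f := Prod.snd) z (hf.differentiable (by simp) z.2).hasFDerivAt hasFDerivAt_snd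
  have h : HasFDerivAt (separated b f) _ z := h1.mul h2
  rw [dirDeriv, h.fderiv]
  simp

lemma dirDeriv_time_separated {b : ℝ → ℝ} {f : Space3 → ℝ} (hb : ContDiff ℝ (⊤ : ℕ∞) b)
    (hf : ContDiff ℝ (⊤ : ℕ∞) f) :
    dirDeriv timeVec (separated b f) = separated (deriv b) f := by
  funext z
  simp [fderiv_separated hb hf, timeVec, separated, mul_comm]

lemma dirDeriv_space_separated {b : ℝ → ℝ} {f : Space3 → ℝ} (hb : ContDiff ℝ (⊤ : ℕ∞) b)
    (hf : ContDiff ℝ (⊤ : ℕ∞) f) (i : Fin 3) :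
    dirDeriv (spaceVec i) (separated b f) = separated b (spatialDeriv i f) := by
  funext z
  simp [fderiv_separated hb hf, spaceVec, separated, spatialDeriv]

lemma dirDeriv_add {u v : SpaceTime → ℝ} (hu : ContDiff ℝ (⊤ : ℕ∞) u)
    (hv : ContDiff ℝ (⊤ : ℕ∞) v) (w : SpaceTime) :
    dirDeriv w (u + v) = dirDeriv w u + dirDeriv w v := by
  funext z
  simp only [dirDeriv, Pi.add_apply]
  rw [fderiv_add (hu.differentiable (by simp) z) (hv.differentiable (by simp) z)]
  rfl

/-- The reflection of a function on spacetime in time. -/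
def timeReflect (u : SpaceTime → ℝ) (z : SpaceTime) : ℝ := u (-z.1, z.2)

lemma contDiff_timeReflect {u : SpaceTime → ℝ} (hu : ContDiff ℝ (⊤ : ℕ∞) u) :
    ContDiff ℝ (⊤ : ℕ∞) (timeReflect u) :=
  hu.comp (contDiff_fst.neg.prodMk contDiff_snd)

lemma dirDeriv_timeReflect {u : SpaceTime → ℝ} (hu : ContDiff ℝ (⊤ : ℕ∞) u) (v z : SpaceTime) :
    dirDeriv v (timeReflect u) z = dirDeriv (-v.1, v.2) u (-z.1, z.2) := by
  have h1 : HasFDerivAt (fun z : SpaceTime => (-z.1, z.2))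
      ((-ContinuousLinearMap.fst ℝ ℝ Space3).prod (ContinuousLinearMap.snd ℝ ℝ Space3)) z :=
    hasFDerivAt_fst.neg.prodMk hasFDerivAt_snd
  have h : HasFDerivAt (timeReflect u) _ z :=
    HasFDerivAt.comp z (hu.differentiable (by simp) (-z.1, z.2)).hasFDerivAt h1
  rw [dirDeriv, h.fderiv]
  rfl

lemma dirDeriv_time_timeReflect {u : SpaceTime → ℝ} (hu : ContDiff ℝ (⊤ : ℕ∞) u) :
    dirDeriv timeVec (timeReflect u) = -timeReflect (dirDeriv timeVec u) := by
  funext z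
  have : ((-timeVec.1, timeVec.2) : SpaceTime) = -timeVec := by simp [timeVec]
  rw [dirDeriv_timeReflect hu, this, dirDeriv, map_neg]
  rfl

lemma dirDeriv_space_timeReflect {u : SpaceTime → ℝ} (hu : ContDiff ℝ (⊤ : ℕ∞) u) (i : Fin 3) :
    dirDeriv (spaceVec i) (timeReflect u) = timeReflect (dirDeriv (spaceVec i) u) := by
  funext z
  rw [dirDeriv_timeReflect hu]
  simp [spaceVec, timeReflect]

lemma dirDeriv_neg (u : SpaceTime → ℝ) (v : SpaceTime) : dirDeriv v (-u) = -dirDeriv v u := by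
  funext z
  simp [dirDeriv, fderiv_neg]

lemma energyDensity_neg (u : SpaceTime → ℝ) : energyDensity (-u) = energyDensity u := by
  funext z
  simp [energyDensity, dirDeriv_neg]

lemma energyDensity_timeReflect {u : SpaceTime → ℝ} (hu : ContDiff ℝ (⊤ : ℕ∞) u) :
    energyDensity (timeReflect u) = timeReflect (energyDensity u) := by
  funext z
  simp [energyDensity, dirDeriv_time_timeReflect hu, dirDeriv_space_timeReflect hu, timeReflect]

lemma energyDensity_add_le {u v : SpaceTime → ℝ} (hu : ContDiff ℝ (⊤ : ℕ∞) u)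
    (hv : ContDiff ℝ (⊤ : ℕ∞) v) (z : SpaceTime) :
    energyDensity (u + v) z ≤ 2 * energyDensity u z + 2 * energyDensity v z := by
  simp only [energyDensity, dirDeriv_add hu hv, Pi.add_apply]
  have h := metricCoeff_nonneg z.2 fun i => dirDeriv (spaceVec i) u z - dirDeriv (spaceVec i) v z
  have h1 := sq_nonneg (dirDeriv timeVec u z - dirDeriv timeVec v z)
  simp only [Fin.sum_univ_three] at h ⊢
  linarith

/-- The Dirichlet form density. -/
noncomputable def gradSq (f : Space3 → ℝ) (x : Space3) : ℝ :=
  ∑ i, ∑ j, metricCoeff i j x * spatialDeriv i f x * spatialDeriv j f x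

lemma gradSq_nonneg (f : Space3 → ℝ) (x : Space3) : 0 ≤ gradSq f x :=
  metricCoeff_nonneg x _

lemma energyDensity_separated {b : ℝ → ℝ} {f : Space3 → ℝ} (hb : ContDiff ℝ (⊤ : ℕ∞) b)
    (hf : ContDiff ℝ (⊤ : ℕ∞) f) (z : SpaceTime) :
    energyDensity (separated b f) z
      = deriv b z.1 ^ 2 * f z.2 ^ 2 + b z.1 ^ 2 * gradSq f z.2 := by
  simp only [energyDensity, dirDeriv_time_separated hb hf, dirDeriv_space_separated hb hf,
    separated, gradSq, Finset.mul_sum]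
  congr 1
  · ring
  · exact Finset.sum_congr rfl fun i _ => Finset.sum_congr rfl fun j _ => by ring

/-- Green's identity for the divergence form operator. -/
lemma integral_gradSq {f : Space3 → ℝ} (hf : ContDiff ℝ (⊤ : ℕ∞) f) (hs : HasCompactSupport f) :
    ∫ x, gradSq f x = -∫ x, f x * divForm f x := by
  have hW : ∀ i, ContDiff ℝ (⊤ : ℕ∞) fun y => ∑ j, metricCoeff i j y * spatialDeriv j f y :=
    fun i => ContDiff.sum fun j _ => (contDiff_metricCoeff i j).mul (contDiff_spatialDeriv hf j)
  set X : Fin 3 → Space3 → ℝ := fun i y => f y * ∑ j, metricCoeff i j y * spatialDeriv j f y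
    with hX
  have hXs : ∀ i, ContDiff ℝ (⊤ : ℕ∞) (X i) := fun i => hf.mul (hW i)
  have hXc : ∀ i, HasCompactSupport (X i) := fun i => hs.mul_right
  have hXi : ∀ i, Integrable (spatialDeriv i (X i)) := fun i =>
    (contDiff_spatialDeriv (hXs i) i).continuous.integrable_of_hasCompactSupport
      ((hXc i).fderiv_apply ℝ _)
  have hz : ∫ x, ∑ i, spatialDeriv i (X i) x = 0 := by
    rw [integral_finsetSum _ fun i _ => hXi i]
    simp [integral_spatialDeriv_eq_zero (hXs _) (hXc _)]
  have hfi : Integrable fun x => f x * divForm f x :=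
    (hf.mul (contDiff_divForm hf)).continuous.integrable_of_hasCompactSupport hs.mul_right
  have hpt : ∀ x, gradSq f x = ∑ i, spatialDeriv i (X i) x - f x * divForm f x := by
    intro x
    have h1 : ∀ i, spatialDeriv i (X i) x = f x * spatialDeriv i (fun y =>
        ∑ j, metricCoeff i j y * spatialDeriv j f y) x
        + (∑ j, metricCoeff i j x * spatialDeriv j f x) * spatialDeriv i f x := by
      intro i
      have h := (hf.differentiable (by simp) x).hasFDerivAt.mul
        ((hW i).differentiable (by simp) x).hasFDerivAt
      have h' : HasFDerivAt (X i) _ x := h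
      rw [spatialDeriv, h'.fderiv]
      simp [spatialDeriv]
    simp only [h1, Finset.sum_add_distrib, ← Finset.mul_sum, divForm, gradSq, Finset.sum_mul]
    rw [add_sub_cancel_left]
    exact Finset.sum_congr rfl fun i _ => Finset.sum_congr rfl fun j _ => by ring
  simp only [hpt]
  rw [integral_sub (integrable_finsetSum _ fun i _ => hXi i) hfi, hz, zero_sub]

lemma divForm_add {f g : Space3 → ℝ} (hf : ContDiff ℝ (⊤ : ℕ∞) f) (hg : ContDiff ℝ (⊤ : ℕ∞) g)
    (x : Space3) : divForm (fun y => f y + g y) x = divForm f x + divForm g x := by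
  have hs : ∀ {f g : Space3 → ℝ}, ContDiff ℝ (⊤ : ℕ∞) f → ContDiff ℝ (⊤ : ℕ∞) g → ∀ i x,
      spatialDeriv i (fun y => f y + g y) x = spatialDeriv i f x + spatialDeriv i g x := by
    intro f g hf hg i x
    simp only [spatialDeriv]
    rw [fderiv_fun_add (hf.differentiable (by simp) x) (hg.differentiable (by simp) x)]
    rfl
  have hW : ∀ {f : Space3 → ℝ}, ContDiff ℝ (⊤ : ℕ∞) f → ∀ i,
      ContDiff ℝ (⊤ : ℕ∞) fun y => ∑ j, metricCoeff i j y * spatialDeriv j f y := fun hf i =>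
    ContDiff.sum fun j _ => (contDiff_metricCoeff i j).mul (contDiff_spatialDeriv hf j)
  simp only [divForm, hs hf hg, mul_add, Finset.sum_add_distrib]
  rw [← Finset.sum_add_distrib]
  exact Finset.sum_congr rfl fun i _ => hs (hW hf i) (hW hg i) i x

lemma divForm_const_mul {f : Space3 → ℝ} (hf : ContDiff ℝ (⊤ : ℕ∞) f) (a : ℝ) (x : Space3) :
    divForm (fun y => a * f y) x = a * divForm f x := by
  have hs : ∀ {f : Space3 → ℝ}, ContDiff ℝ (⊤ : ℕ∞) f → ∀ i x,
      spatialDeriv i (fun y => a * f y) x = a * spatialDeriv i f x := by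
    intro f hf i x
    simp only [spatialDeriv]
    rw [fderiv_const_mul (hf.differentiable (by simp) x)]
    rfl
  have hW : ∀ i, ContDiff ℝ (⊤ : ℕ∞) fun y => ∑ j, metricCoeff i j y * spatialDeriv j f y :=
    fun i => ContDiff.sum fun j _ => (contDiff_metricCoeff i j).mul (contDiff_spatialDeriv hf j)
  simp only [divForm, hs hf, mul_left_comm _ a, ← Finset.mul_sum]
  rw [Finset.mul_sum]
  exact Finset.sum_congr rfl fun i _ => hs (hW i) i x

/-- The wave operator of the perturbed metric. -/
noncomputable def waveOp (u : SpaceTime → ℝ) (z : SpaceTime) : ℝ :=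
  dirDeriv timeVec (dirDeriv timeVec u) z - divForm (fun y => u (z.1, y)) z.2

lemma waveOp_add {u v : SpaceTime → ℝ} (hu : ContDiff ℝ (⊤ : ℕ∞) u)
    (hv : ContDiff ℝ (⊤ : ℕ∞) v) : waveOp (u + v) = waveOp u + waveOp v := by
  funext z
  simp only [waveOp, dirDeriv_add hu hv, Pi.add_apply]
  rw [dirDeriv_add (contDiff_top_dirDeriv hu _) (contDiff_top_dirDeriv hv _), Pi.add_apply,
    divForm_add (contDiff_slice hu _) (contDiff_slice hv _)]
  ring

lemma waveOp_timeReflect {u : SpaceTime → ℝ} (hu : ContDiff ℝ (⊤ : ℕ∞) u) :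
    waveOp (timeReflect u) = timeReflect (waveOp u) := by
  have h : dirDeriv timeVec (dirDeriv timeVec (timeReflect u))
      = timeReflect (dirDeriv timeVec (dirDeriv timeVec u)) := by
    rw [dirDeriv_time_timeReflect hu, dirDeriv_neg,
      dirDeriv_time_timeReflect (contDiff_top_dirDeriv hu _), neg_neg]
  funext z
  rw [waveOp, h]
  simp only [waveOp, timeReflect]

lemma waveOp_separated {b : ℝ → ℝ} {f : Space3 → ℝ} (hb : ContDiff ℝ (⊤ : ℕ∞) b)
    (hf : ContDiff ℝ (⊤ : ℕ∞) f) (z : SpaceTime) :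
    waveOp (separated b f) z = deriv (deriv b) z.1 * f z.2 - b z.1 * divForm f z.2 := by
  have hb' := (contDiff_infty_iff_deriv.1 hb).2
  have h := divForm_const_mul hf (b z.1) z.2
  rw [waveOp, dirDeriv_time_separated hb hf, dirDeriv_time_separated hb' hf]
  simp only [separated, h]

/-- A time profile vanishing in the past with bounded derivatives. -/
structure Forcing (a : ℝ → ℝ) : Prop where
  bdd : HasBddDerivs a
  past : ∀ t < -1, a t = 0

lemma Forcing.deriv {a : ℝ → ℝ} (ha : Forcing a) : Forcing (deriv a) := by
  refine ⟨ha.bdd.deriv, fun t ht => ?_⟩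
  have h : a =ᶠ[nhds t] fun _ => 0 := by
    filter_upwards [Iio_mem_nhds ht] with s hs using ha.past s hs
  simp [h.deriv_eq]

/-- The retarded solution of the perturbed wave equation in the `m`-th angular mode. -/
noncomputable def forcedWave (m : ℕ) (a : ℝ → ℝ) (e : Space3 → ℝ) : SpaceTime → ℝ :=
  retardedSolution (modePotential m) (separated a e)

section ForcedWave

variable {m : ℕ} {a : ℝ → ℝ} {e : Space3 → ℝ}

lemma Forcing.tame (ha : Forcing a) (he : ContDiff ℝ (⊤ : ℕ∞) e) (hs : HasCompactSupport e) :
    Tame (separated a e) := by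
  refine HasBddDerivs.tame ?_ fun z hz => by simp [separated, ha.past _ hz]
  exact (ha.bdd.comp_clm (ContinuousLinearMap.fst ℝ ℝ Space3)).mul
    ((HasBddDerivs.of_hasCompactSupport he hs).comp_clm (ContinuousLinearMap.snd ℝ ℝ Space3))

lemma contDiff_forcedWave (ha : Forcing a) (he : ContDiff ℝ (⊤ : ℕ∞) e)
    (hs : HasCompactSupport e) : ContDiff ℝ (⊤ : ℕ∞) (forcedWave m a e) :=
  contDiff_retardedSolution (bddDerivs_modePotential m) (ha.tame he hs)

lemma coneSupported_forcedWave (ha : Forcing a) (h5 : ∀ x, 5 < ‖x‖ ^ 2 → e x = 0) :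
    ConeSupported (forcedWave m a e) := by
  refine coneSupported_retardedSolution fun z hz => ?_
  rcases lt_or_ge z.1 (-1) with h | h
  · simp [separated, ha.past _ h]
  · have : 5 < ‖z.2‖ ^ 2 := by nlinarith
    simp [separated, h5 _ this]

lemma dirDeriv_time_forcedWave (ha : Forcing a) (he : ContDiff ℝ (⊤ : ℕ∞) e)
    (hs : HasCompactSupport e) :
    dirDeriv timeVec (forcedWave m a e) = forcedWave m (deriv a) e := by
  rw [forcedWave, dirDeriv_time_retardedSolution (bddDerivs_modePotential m) (fun _ _ => rfl)
    (ha.tame he hs), dirDeriv_time_separated ha.bdd.1 he]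
  rfl

lemma waveOp_forcedWave (ha : Forcing a) (he : ContDiff ℝ (⊤ : ℕ∞) e)
    (hs : HasCompactSupport e)
    (hm : ∀ θ x, e (planeRot 0 1 θ x) + e (planeRot 0 1 (-θ) x) = 2 * Real.cos (m * θ) * e x) :
    waveOp (forcedWave m a e) = separated a e := by
  funext z
  have hmode : HasMode m (separated a e) := fun θ t x => by
    simp only [separated]
    linear_combination a t * hm θ x
  have h1 := wave_of_mode (contDiff_forcedWave (m := m) ha he hs)
    (hasMode_retardedSolution (bddDerivs_modePotential m) (modePotential_planeRot m)
      (ha.tame he hs) hmode) z.1 z.2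
  have h2 := box_retardedSolution (bddDerivs_modePotential m) (ha.tame he hs) z
  change waveOp (forcedWave m a e) z = _ at h1
  rw [h1, forcedWave, h2]
  ring

lemma energy_forcedWave_le (ha : Forcing a) (he : ContDiff ℝ (⊤ : ℕ∞) e)
    (h5 : ∀ x, 5 < ‖x‖ ^ 2 → e x = 0)
    (hm : ∀ θ x, e (planeRot 0 1 θ x) + e (planeRot 0 1 (-θ) x) = 2 * Real.cos (m * θ) * e x)
    {M : ℝ} (hM : ∀ t, |a t| ≤ M) {t : ℝ} (ht : -5 < t) :
    energy (forcedWave m a e) t ≤ 3 * (t + 5) ^ 2 * M ^ 2 * ∫ x, e x ^ 2 := by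
  have hs := hasCompactSupport_of_norm_sq h5
  exact energy_le (contDiff_forcedWave ha he hs) (coneSupported_forcedWave ha h5) he.continuous hs
    hM (fun t x => congrFun (waveOp_forcedWave ha he hs hm) (t, x)) ht

end ForcedWave

/-- A smooth cutoff in time equal to `0` for `t ≤ -1` and to `1` for `1 ≤ t`. -/
noncomputable def timeCutoff (t : ℝ) : ℝ := Real.smoothTransition ((t + 1) / 2)

lemma contDiff_timeCutoff : ContDiff ℝ (⊤ : ℕ∞) timeCutoff :=
  Real.smoothTransition.contDiff.comp ((contDiff_id.add contDiff_const).div_const 2)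

lemma timeCutoff_add_neg (t : ℝ) : timeCutoff t + timeCutoff (-t) = 1 := by
  have h : 1 - (t + 1) / 2 = (-t + 1) / 2 := by ring
  have h' : 1 - (-t + 1) / 2 = (t + 1) / 2 := by ring
  have hpos := Real.smoothTransition.pos_denom ((t + 1) / 2)
  rw [h] at hpos
  rw [timeCutoff, timeCutoff, Real.smoothTransition, Real.smoothTransition, h, h',
    add_comm (expNegInvGlue ((-t + 1) / 2)), ← add_div, div_self hpos.ne']

lemma abs_timeCutoff_le (t : ℝ) : |timeCutoff t| ≤ 1 := by
  have h : 0 ≤ timeCutoff t := Real.smoothTransition.nonneg _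
  exact abs_le.2 ⟨by linarith, Real.smoothTransition.le_one _⟩

lemma timeCutoff_of_le {t : ℝ} (ht : t ≤ -1) : timeCutoff t = 0 :=
  Real.smoothTransition.zero_of_nonpos (by linarith)

lemma timeCutoff_of_ge {t : ℝ} (ht : 1 ≤ t) : timeCutoff t = 1 :=
  Real.smoothTransition.one_of_one_le (by linarith)

lemma hasCompactSupport_deriv_timeCutoff : HasCompactSupport (deriv timeCutoff) := by
  refine HasCompactSupport.intro (isCompact_Icc (a := (-1 : ℝ)) (b := 1)) fun t ht => ?_
  rcases lt_or_ge t (-1) with h | h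
  · have : timeCutoff =ᶠ[nhds t] fun _ => 0 := by
      filter_upwards [Iio_mem_nhds h] with s hs using timeCutoff_of_le (le_of_lt hs)
    simp [this.deriv_eq]
  · have h' : 1 < t := by
      by_contra! h'
      exact ht ⟨h, h'⟩
    have : timeCutoff =ᶠ[nhds t] fun _ => 1 := by
      filter_upwards [Ioi_mem_nhds h'] with s hs using timeCutoff_of_ge (le_of_lt hs)
    simp [this.deriv_eq]

lemma hasBddDerivs_timeCutoff : HasBddDerivs timeCutoff :=
  HasBddDerivs.of_deriv contDiff_timeCutoff abs_timeCutoff_le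
    (HasBddDerivs.of_hasCompactSupport (contDiff_infty_iff_deriv.1 contDiff_timeCutoff).2
      hasCompactSupport_deriv_timeCutoff)

/-- A sine wave switched on near time zero. -/
noncomputable def switchedSine (w s t : ℝ) : ℝ := timeCutoff t * Real.sin (w * t + s)

lemma forcing_switchedSine (w s : ℝ) : Forcing (switchedSine w s) :=
  ⟨hasBddDerivs_timeCutoff.mul (HasBddDerivs.sin w s), fun t ht => by
    simp [switchedSine, timeCutoff_of_le ht.le]⟩

lemma abs_switchedSine_le (w s t : ℝ) : |switchedSine w s t| ≤ 1 := by
  rw [switchedSine, abs_mul]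
  exact mul_le_one₀ (abs_timeCutoff_le t) (abs_nonneg _) (Real.abs_sin_le_one _)

lemma hasDerivAt_sin_affine (w s t : ℝ) :
    HasDerivAt (fun t => Real.sin (w * t + s)) (w * Real.cos (w * t + s)) t := by
  have h := (((hasDerivAt_id t).const_mul w).add_const s).sin
  simpa [mul_comm] using h

lemma hasDerivAt_cos_affine (w s t : ℝ) :
    HasDerivAt (fun t => w * Real.cos (w * t + s)) (-(w ^ 2 * Real.sin (w * t + s))) t := by
  have h := (((hasDerivAt_id t).const_mul w).add_const s).cos.const_mul w
  refine h.congr_deriv ?_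
  simp
  ring

lemma exists_abs_deriv_switchedSine_le :
    ∃ K : ℝ, 0 ≤ K ∧ ∀ w s t, |deriv (switchedSine w s) t| ≤ K + |w| := by
  obtain ⟨K, hK⟩ := hasCompactSupport_deriv_timeCutoff.exists_bound_of_continuous
    (contDiff_infty_iff_deriv.1 contDiff_timeCutoff).2.continuous
  refine ⟨K, (norm_nonneg _).trans (hK 0), fun w s t => ?_⟩
  have h : HasDerivAt (switchedSine w s) _ t :=
    ((contDiff_timeCutoff.differentiable (by simp) t).hasDerivAt).mul (hasDerivAt_sin_affine w s t)
  rw [h.deriv]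
  refine (abs_add_le _ _).trans ?_
  rw [abs_mul, abs_mul, abs_mul]
  have h1 := hK t
  rw [Real.norm_eq_abs] at h1
  have h2 := Real.abs_sin_le_one (w * t + s)
  have h3 := Real.abs_cos_le_one (w * t + s)
  have h4 := abs_timeCutoff_le t
  have h5 := abs_nonneg (deriv timeCutoff t)
  have h6 := abs_nonneg w
  have h7 : |w| * |Real.cos (w * t + s)| ≤ |w| := mul_le_of_le_one_right h6 h3
  refine add_le_add ((mul_le_of_le_one_right h5 h2).trans h1) ?_
  exact (mul_le_of_le_one_left (by positivity) h4).trans h7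

/-- The standing wave built on a quasimode. -/
noncomputable def standingWave (c : ℂ) (m : ℕ) (w s : ℝ) : SpaceTime → ℝ :=
  separated (fun t => Real.sin (w * t + s)) (quasimode c m)

/-- The exact solution obtained from a standing wave by removing its error, forwards in time for
positive times and backwards in time for negative times. -/
noncomputable def trappedWave (c : ℂ) (m : ℕ) (w s : ℝ) : SpaceTime → ℝ :=
  standingWave c m w s + (forcedWave m (switchedSine w s) (quasimodeError c m)
    + timeReflect (forcedWave m (switchedSine (-w) s) (quasimodeError c m)))

section TrappedWave

variable (c : ℂ) (m : ℕ) (w s : ℝ)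

lemma contDiff_sin_affine : ContDiff ℝ (⊤ : ℕ∞) fun t : ℝ => Real.sin (w * t + s) := by fun_prop

lemma contDiff_standingWave : ContDiff ℝ (⊤ : ℕ∞) (standingWave c m w s) :=
  contDiff_separated (contDiff_sin_affine w s) (contDiff_quasimode c m)

lemma contDiff_forcedWave_quasimodeError {a : ℝ → ℝ} (ha : Forcing a) :
    ContDiff ℝ (⊤ : ℕ∞) (forcedWave m a (quasimodeError c m)) :=
  contDiff_forcedWave ha (contDiff_quasimodeError c m) (hasCompactSupport_quasimodeError c m)

lemma quasimodeError_of_gt {x : Space3} (hx : 5 < ‖x‖ ^ 2) : quasimodeError c m x = 0 :=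
  quasimodeError_eq_zero c m fun h => absurd h.2 hx.not_ge

lemma coneSupported_forcedWave_quasimodeError {a : ℝ → ℝ} (ha : Forcing a) :
    ConeSupported (forcedWave m a (quasimodeError c m)) :=
  coneSupported_forcedWave ha fun _ => quasimodeError_of_gt c m

lemma contDiff_trappedWave : ContDiff ℝ (⊤ : ℕ∞) (trappedWave c m w s) :=
  (contDiff_standingWave c m w s).add
    ((contDiff_forcedWave_quasimodeError c m (forcing_switchedSine w s)).add
      (contDiff_timeReflect (contDiff_forcedWave_quasimodeError c m (forcing_switchedSine (-w) s))))

lemma deriv_sin_affine : deriv (fun t : ℝ => Real.sin (w * t + s))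
    = fun t => w * Real.cos (w * t + s) :=
  funext fun t => (hasDerivAt_sin_affine w s t).deriv

lemma deriv_cos_affine : deriv (fun t : ℝ => w * Real.cos (w * t + s))
    = fun t => -(w ^ 2 * Real.sin (w * t + s)) :=
  funext fun t => (hasDerivAt_cos_affine w s t).deriv

lemma waveOp_trappedWave {c : ℂ} {m : ℕ} {w s : ℝ} (hw : w ^ 2 = freqSq m) (z : SpaceTime) :
    waveOp (trappedWave c m w s) z = 0 := by
  have h1 := contDiff_forcedWave_quasimodeError c m (forcing_switchedSine w s)
  have h2 := contDiff_forcedWave_quasimodeError c m (forcing_switchedSine (-w) s)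
  have h12 : ContDiff ℝ (⊤ : ℕ∞) (forcedWave m (switchedSine w s) (quasimodeError c m)
      + timeReflect (forcedWave m (switchedSine (-w) s) (quasimodeError c m))) :=
    h1.add (contDiff_timeReflect h2)
  have hm : ∀ a, Forcing a → waveOp (forcedWave m a (quasimodeError c m))
      = separated a (quasimodeError c m) := fun a ha =>
    waveOp_forcedWave ha (contDiff_quasimodeError c m) (hasCompactSupport_quasimodeError c m)
      (quasimodeError_planeRot c m)
  rw [trappedWave, waveOp_add (contDiff_standingWave c m w s) h12,
    waveOp_add h1 (contDiff_timeReflect h2), waveOp_timeReflect h2, hm _ (forcing_switchedSine w s),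
    hm _ (forcing_switchedSine (-w) s)]
  simp only [Pi.add_apply]
  rw [standingWave, waveOp_separated (contDiff_sin_affine w s) (contDiff_quasimode c m),
    deriv_sin_affine, deriv_cos_affine]
  have h3 := timeCutoff_add_neg z.1
  simp only [separated, timeReflect, switchedSine, neg_mul_neg, quasimodeError, hw]
  linear_combination Real.sin (w * z.1 + s) * (divForm (quasimode c m) z.2
    + freqSq m * quasimode c m z.2) * h3

lemma dirDeriv_time_trappedWave : dirDeriv timeVec (trappedWave c m w s)
    = separated (fun t => w * Real.cos (w * t + s)) (quasimode c m)
      + (forcedWave m (deriv (switchedSine w s)) (quasimodeError c m)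
        + -timeReflect (forcedWave m (deriv (switchedSine (-w) s)) (quasimodeError c m))) := by
  have h1 := contDiff_forcedWave_quasimodeError c m (forcing_switchedSine w s)
  have h2 := contDiff_forcedWave_quasimodeError c m (forcing_switchedSine (-w) s)
  have h12 : ContDiff ℝ (⊤ : ℕ∞) (forcedWave m (switchedSine w s) (quasimodeError c m)
      + timeReflect (forcedWave m (switchedSine (-w) s) (quasimodeError c m))) :=
    h1.add (contDiff_timeReflect h2)
  have he := contDiff_quasimodeError c m
  have hes := hasCompactSupport_quasimodeError c m
  rw [trappedWave, dirDeriv_add (contDiff_standingWave c m w s) h12,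
    dirDeriv_add h1 (contDiff_timeReflect h2), dirDeriv_time_timeReflect h2,
    dirDeriv_time_forcedWave (forcing_switchedSine w s) he hes,
    dirDeriv_time_forcedWave (forcing_switchedSine (-w) s) he hes, standingWave,
    dirDeriv_time_separated (contDiff_sin_affine w s) (contDiff_quasimode c m), deriv_sin_affine]

lemma gradSq_quasimode_of_gt {x : Space3} (hx : 5 < ‖x‖ ^ 2) : gradSq (quasimode c m) x = 0 := by
  have ho : IsOpen {x : Space3 | 5 < ‖x‖ ^ 2} := isOpen_lt (by fun_prop) (by fun_prop)
  have h : quasimode c m =ᶠ[nhds x] fun _ => 0 := by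
    filter_upwards [ho.mem_nhds hx] with y hy using quasimode_of_ge c m (le_of_lt hy)
  simp [gradSq, spatialDeriv, h.fderiv_eq]

lemma hasCompactSupport_trappedWave : HasCompactSupport fun x => trappedWave c m w s (0, x) := by
  refine HasCompactSupport.intro (isCompact_closedBall (0 : Space3) 4) fun x hx => ?_
  have hx' : 4 < ‖x‖ := by simpa using hx
  have h1 : 5 ≤ ‖x‖ ^ 2 := by nlinarith
  have h2 := fun w => coneSupported_forcedWave_quasimodeError c m (forcing_switchedSine w s)
    (0, x) (by simpa using hx')
  simp [trappedWave, standingWave, separated, timeReflect, quasimode_of_ge c m h1, h2]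

lemma hasCompactSupport_dirDeriv_time_trappedWave :
    HasCompactSupport fun x => dirDeriv timeVec (trappedWave c m w s) (0, x) := by
  refine HasCompactSupport.intro (isCompact_closedBall (0 : Space3) 4) fun x hx => ?_
  have hx' : 4 < ‖x‖ := by simpa using hx
  have h1 : 5 ≤ ‖x‖ ^ 2 := by nlinarith
  have h2 := fun w => coneSupported_forcedWave_quasimodeError c m (forcing_switchedSine w s).deriv
    (0, x) (by simpa using hx')
  simp [dirDeriv_time_trappedWave, separated, timeReflect, quasimode_of_ge c m h1, h2]

end TrappedWave

lemma ConeSupported.integrable_energyDensity {u : SpaceTime → ℝ} (hc : ConeSupported u)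
    (hu : ContDiff ℝ (⊤ : ℕ∞) u) (t : ℝ) : Integrable fun x => _root_.energyDensity u (t, x) :=
  (contDiff_slice (contDiff_energyDensity hu) t).continuous.integrable_of_hasCompactSupport
    (hc.energyDensity.hasCompactSupport_slice t)

/-- Weighted bound for the initial energy of a sum of functions supported in a fixed ball. -/
lemma integral_weight_mul_energyDensity_le {u v w w' : SpaceTime → ℝ}
    (hu : ContDiff ℝ (⊤ : ℕ∞) u) (hv : ContDiff ℝ (⊤ : ℕ∞) v) (hw : ContDiff ℝ (⊤ : ℕ∞) w)
    (hw' : ContDiff ℝ (⊤ : ℕ∞) w') (hus : ∀ x, 4 < ‖x‖ → energyDensity u (0, x) = 0)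
    (hvs : ConeSupported v) (hws : ConeSupported w)
    (he : ∀ x, energyDensity w' (0, x) = energyDensity w (0, x)) {k : Space3 → ℝ} {B : ℝ}
    (hk : ∀ x, 0 ≤ k x) (hB : ∀ x, ‖x‖ ≤ 4 → k x ≤ B) :
    ∫ x, k x * energyDensity (u + (v + w')) (0, x)
      ≤ B * (2 * energy u 0 + 4 * energy v 0 + 4 * energy w 0) := by
  have iu : Integrable fun x => energyDensity u (0, x) :=
    (contDiff_slice (contDiff_energyDensity hu) 0).continuous.integrable_of_hasCompactSupport
      (HasCompactSupport.intro (isCompact_closedBall (0 : Space3) 4) fun x hx =>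
        hus x (by simpa using hx))
  have iv := hvs.integrable_energyDensity hv 0
  have iw := hws.integrable_energyDensity hw 0
  have iuv : Integrable fun x => 2 * energyDensity u (0, x) + 4 * energyDensity v (0, x) :=
    (iu.const_mul 2).add (iv.const_mul 4)
  have hsum : B * (2 * energy u 0 + 4 * energy v 0 + 4 * energy w 0)
      = ∫ x, B * (2 * energyDensity u (0, x) + 4 * energyDensity v (0, x)
        + 4 * energyDensity w (0, x)) := by
    rw [integral_const_mul, integral_add iuv (iw.const_mul 4),
      integral_add (iu.const_mul 2) (iv.const_mul 4), integral_const_mul, integral_const_mul,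
      integral_const_mul]
    rfl
  rw [hsum]
  refine integral_mono_of_nonneg (.of_forall fun x => mul_nonneg (hk x) (energyDensity_nonneg _ _))
    ((iuv.add (iw.const_mul 4)).const_mul B)
    (.of_forall fun x => ?_)
  have hvw : ContDiff ℝ (⊤ : ℕ∞) (v + w') := hv.add hw'
  have h1 := energyDensity_add_le hu hvw (0, x)
  have h2 := energyDensity_add_le hv hw' (0, x)
  rw [he] at h2
  have h0 := energyDensity_nonneg (u + (v + w')) (0, x)
  simp only
  rcases le_or_gt ‖x‖ 4 with hx | hx
  · exact mul_le_mul (hB x hx) (by linarith) h0 ((hk x).trans (hB x hx))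
  · have e1 := hus x hx
    have e2 := hvs.energyDensity (0, x) (by simpa using hx)
    have e3 := hws.energyDensity (0, x) (by simpa using hx)
    have : energyDensity (u + (v + w')) (0, x) = 0 := by linarith
    simp [this, e1, e2, e3]

section Estimates

variable (c : ℂ) (m : ℕ)

lemma integrable_sq_quasimode : Integrable fun x => quasimode c m x ^ 2 :=
  ((contDiff_quasimode c m).continuous.pow 2).integrable_of_hasCompactSupport (by
    simpa only [sq] using (hasCompactSupport_quasimode c m).mul_right (f' := quasimode c m))

lemma integrable_sq_quasimodeError : Integrable fun x => quasimodeError c m x ^ 2 :=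
  ((contDiff_quasimodeError c m).continuous.pow 2).integrable_of_hasCompactSupport (by
    simpa only [sq] using
      (hasCompactSupport_quasimodeError c m).mul_right (f' := quasimodeError c m))

lemma integrable_gradSq_quasimode : Integrable (gradSq (quasimode c m)) := by
  refine Continuous.integrable_of_hasCompactSupport ?_
    (hasCompactSupport_of_norm_sq fun _ => gradSq_quasimode_of_gt c m)
  have h1 := fun i => (contDiff_spatialDeriv (contDiff_quasimode c m) i).continuous
  have h2 := fun i j => (contDiff_metricCoeff i j).continuous
  exact continuous_finsetSum _ fun i _ => continuous_finsetSum _ fun j _ =>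
    ((h2 i j).mul (h1 i)).mul (h1 j)

lemma integral_gradSq_quasimode_le :
    ∫ x, gradSq (quasimode c m) x ≤ freqSq m * (∫ x, quasimode c m x ^ 2)
      + ((∫ x, quasimode c m x ^ 2) + ∫ x, quasimodeError c m x ^ 2) / 2 := by
  have i1 := integrable_sq_quasimode c m
  have i2 := integrable_sq_quasimodeError c m
  have i3 : Integrable fun x => -(quasimode c m x * divForm (quasimode c m) x) :=
    ((contDiff_quasimode c m).mul (contDiff_divForm (contDiff_quasimode c m))).neg.continuous
      |>.integrable_of_hasCompactSupport (hasCompactSupport_quasimode c m).mul_right.neg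
  have i4 : Integrable fun x => (quasimode c m x ^ 2 + quasimodeError c m x ^ 2) / 2 :=
    (i1.add i2).div_const 2
  rw [integral_gradSq (contDiff_quasimode c m) (hasCompactSupport_quasimode c m),
    ← integral_neg, ← integral_const_mul, ← integral_add i1 i2, ← integral_div,
    ← integral_add (i1.const_mul _) i4]
  refine integral_mono i3 ((i1.const_mul _).add i4) fun x => ?_
  have : divForm (quasimode c m) x = quasimodeError c m x - freqSq m * quasimode c m x := by
    rw [quasimodeError]
    ring
  simp only [this]
  nlinarith [sq_nonneg (quasimode c m x + quasimodeError c m x)]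

lemma energy_separated_quasimode {b : ℝ → ℝ} (hb : ContDiff ℝ (⊤ : ℕ∞) b) (t : ℝ) :
    energy (separated b (quasimode c m)) t = deriv b t ^ 2 * (∫ x, quasimode c m x ^ 2)
      + b t ^ 2 * ∫ x, gradSq (quasimode c m) x := by
  rw [energy, ← integral_const_mul, ← integral_const_mul,
    ← integral_add ((integrable_sq_quasimode c m).const_mul _)
      ((integrable_gradSq_quasimode c m).const_mul _)]
  exact integral_congr_ae (.of_forall fun x =>
    energyDensity_separated hb (contDiff_quasimode c m) (t, x))

lemma energyDensity_separated_quasimode_of_gt {b : ℝ → ℝ} (hb : ContDiff ℝ (⊤ : ℕ∞) b)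
    {x : Space3} (hx : 4 < ‖x‖) (t : ℝ) :
    energyDensity (separated b (quasimode c m)) (t, x) = 0 := by
  have h : 5 < ‖x‖ ^ 2 := by nlinarith
  rw [energyDensity_separated hb (contDiff_quasimode c m)]
  simp [quasimode_of_ge c m h.le, gradSq_quasimode_of_gt c m h]

lemma energy_forcedWave_quasimodeError_le {a : ℝ → ℝ} (ha : Forcing a) {M : ℝ}
    (hM : ∀ t, |a t| ≤ M) {t : ℝ} (ht : -5 < t) :
    energy (forcedWave m a (quasimodeError c m)) t
      ≤ 3 * (t + 5) ^ 2 * M ^ 2 * ∫ x, quasimodeError c m x ^ 2 :=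
  energy_forcedWave_le ha (contDiff_quasimodeError c m) (fun _ => quasimodeError_of_gt c m)
    (quasimodeError_planeRot c m) hM ht

variable {c m}

lemma weighted_energy_trappedWave_le {w : ℝ} (s : ℝ) (hw : w ^ 2 = freqSq m) :
    ∫ x, (1 + ‖x‖) * energyDensity (trappedWave c m w s) (0, x)
      ≤ 5 * (2 * (freqSq m * (∫ x, quasimode c m x ^ 2) + ∫ x, gradSq (quasimode c m) x)
        + 600 * ∫ x, quasimodeError c m x ^ 2) := by
  have h1 := fun w => contDiff_forcedWave_quasimodeError c m (forcing_switchedSine w s)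
  have hc := fun w => coneSupported_forcedWave_quasimodeError c m (forcing_switchedSine w s)
  have hE := fun w => energy_forcedWave_quasimodeError_le c m (forcing_switchedSine w s)
    (abs_switchedSine_le w s) (t := 0) (by norm_num)
  have hb := contDiff_sin_affine w s
  refine (integral_weight_mul_energyDensity_le (contDiff_standingWave c m w s) (h1 w) (h1 (-w))
    (contDiff_timeReflect (h1 (-w)))
    (fun x hx => energyDensity_separated_quasimode_of_gt c m hb hx 0) (hc w) (hc (-w)) (fun x => ?_)
    (k := fun x => 1 + ‖x‖) (B := 5) (fun x => by positivity) (fun x hx => by linarith)).trans ?_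
  · rw [energyDensity_timeReflect (h1 (-w))]
    simp [timeReflect]
  · have h2 := energy_separated_quasimode c m hb 0
    have hN : 0 ≤ ∫ x, quasimode c m x ^ 2 := integral_nonneg fun x => sq_nonneg _
    have hD : 0 ≤ ∫ x, gradSq (quasimode c m) x := integral_nonneg (gradSq_nonneg _)
    have h3 : energy (standingWave c m w s) 0
        ≤ freqSq m * (∫ x, quasimode c m x ^ 2) + 1 * ∫ x, gradSq (quasimode c m) x := by
      simp only [standingWave, h2, deriv_sin_affine, ← hw]
      refine add_le_add (mul_le_mul_of_nonneg_right ?_ hN) (mul_le_mul_of_nonneg_right ?_ hD)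
      · rw [mul_pow]
        exact mul_le_of_le_one_right (sq_nonneg w) (Real.cos_sq_le_one _)
      · exact Real.sin_sq_le_one _
    linarith [hE w, hE (-w)]

lemma energy_dirDeriv_trappedWave_le {w K : ℝ} (s : ℝ) (hw : w ^ 2 = freqSq m)
    (hK : ∀ w s t, |deriv (switchedSine w s) t| ≤ K + |w|) :
    ∫ x, energyDensity (dirDeriv timeVec (trappedWave c m w s)) (0, x)
      ≤ 2 * (freqSq m ^ 2 * (∫ x, quasimode c m x ^ 2)
          + freqSq m * ∫ x, gradSq (quasimode c m) x)
        + 600 * (K + |w|) ^ 2 * ∫ x, quasimodeError c m x ^ 2 := by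
  have hf := fun w => (forcing_switchedSine w s).deriv
  have h1 := fun w => contDiff_forcedWave_quasimodeError c m (hf w)
  have hc := fun w => coneSupported_forcedWave_quasimodeError c m (hf w)
  have hE := fun w => energy_forcedWave_quasimodeError_le c m (hf w) (hK w s) (t := 0)
    (by norm_num)
  have hb : ContDiff ℝ (⊤ : ℕ∞) fun t : ℝ => w * Real.cos (w * t + s) := by fun_prop
  have h := integral_weight_mul_energyDensity_le (contDiff_separated hb (contDiff_quasimode c m))
    (h1 w) (h1 (-w)) (contDiff_timeReflect (h1 (-w))).neg
    (fun x hx => energyDensity_separated_quasimode_of_gt c m hb hx 0) (hc w) (hc (-w)) (fun x => ?_)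
    (k := fun _ => 1) (B := 1) (fun x => zero_le_one) (fun x _ => le_rfl)
  · simp only [one_mul] at h
    rw [dirDeriv_time_trappedWave]
    refine h.trans ?_
    have h2 := energy_separated_quasimode c m hb 0
    have hN : 0 ≤ ∫ x, quasimode c m x ^ 2 := integral_nonneg fun x => sq_nonneg _
    have hD : 0 ≤ ∫ x, gradSq (quasimode c m) x := integral_nonneg (gradSq_nonneg _)
    have h3 : energy (separated (fun t : ℝ => w * Real.cos (w * t + s)) (quasimode c m)) 0
        ≤ freqSq m ^ 2 * (∫ x, quasimode c m x ^ 2)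
          + freqSq m * ∫ x, gradSq (quasimode c m) x := by
      simp only [h2, deriv_cos_affine, ← hw]
      refine add_le_add (mul_le_mul_of_nonneg_right ?_ hN) (mul_le_mul_of_nonneg_right ?_ hD)
      · rw [neg_sq, mul_pow]
        exact mul_le_of_le_one_right (by positivity) (Real.sin_sq_le_one _)
      · rw [mul_pow]
        exact mul_le_of_le_one_right (sq_nonneg w) (Real.cos_sq_le_one _)
    have h4 := hE (-w)
    rw [abs_neg] at h4
    linarith [hE w]
  · change energyDensity (-timeReflect _) _ = _
    rw [energyDensity_neg, energyDensity_timeReflect (h1 (-w))]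
    simp [timeReflect]

/-- The local energy of a trapped wave at a time when its velocity is maximal. -/
lemma le_local_energy_trappedWave {w τ R : ℝ} (hw : w ^ 2 = freqSq m) (hτ : 4 < τ)
    (hR : 0 ≤ R) (hR5 : 5 ≤ R ^ 2) :
    freqSq m / 2 * (∫ x, quasimode c m x ^ 2) - 3 * (τ + 5) ^ 2 * ∫ x, quasimodeError c m x ^ 2
      ≤ ∫ x in {x : Space3 | ‖x‖ ≤ R}, energyDensity (trappedWave c m w (-(w * τ))) (τ, x) := by
  set s := -(w * τ) with hs
  have hf := forcing_switchedSine
  set w₁ := forcedWave m (switchedSine w s) (quasimodeError c m) with hw₁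
  have h1 : ContDiff ℝ (⊤ : ℕ∞) w₁ := contDiff_forcedWave_quasimodeError c m (hf w s)
  have hc : ConeSupported w₁ := coneSupported_forcedWave_quasimodeError c m (hf w s)
  have hE := energy_forcedWave_quasimodeError_le c m (hf w s)
    (abs_switchedSine_le w s) (t := τ) (by linarith)
  rw [one_pow, mul_one] at hE
  have hball : {x : Space3 | ‖x‖ ≤ R} = Metric.closedBall 0 R := by
    ext x
    simp
  have hpt : ∀ x, freqSq m / 2 * quasimode c m x ^ 2 - energyDensity w₁ (τ, x)
      ≤ energyDensity (trappedWave c m w s) (τ, x) := by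
    intro x
    have a1 := sq_dirDeriv_le_energyDensity (trappedWave c m w s) (τ, x)
    have a2 := sq_dirDeriv_le_energyDensity w₁ (τ, x)
    have a3 : forcedWave m (deriv (switchedSine (-w) s)) (quasimodeError c m) (-τ, x) = 0 :=
      coneSupported_forcedWave_quasimodeError c m (hf (-w) s).deriv _
        (by have := norm_nonneg x; simp only; linarith)
    have a4 : dirDeriv timeVec (trappedWave c m w s) (τ, x)
        = w * quasimode c m x + dirDeriv timeVec w₁ (τ, x) := by
      rw [dirDeriv_time_trappedWave, hw₁, dirDeriv_time_forcedWave (hf w s)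
        (contDiff_quasimodeError c m) (hasCompactSupport_quasimodeError c m)]
      have hcos : Real.cos (w * τ + s) = 1 := by simp [hs]
      simp [separated, timeReflect, a3, hcos]
    rw [a4] at a1
    rw [← hw]
    nlinarith [sq_nonneg (w * quasimode c m x + 2 * dirDeriv timeVec w₁ (τ, x))]
  have i1 := (integrable_sq_quasimode c m).const_mul (freqSq m / 2)
  have i2 := hc.integrable_energyDensity h1 τ
  have i3 : IntegrableOn (fun x => energyDensity (trappedWave c m w s) (τ, x))
      {x : Space3 | ‖x‖ ≤ R} := by
    rw [hball]
    exact (contDiff_slice (contDiff_energyDensity (contDiff_trappedWave c m w s)) τ).continuous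
      |>.continuousOn.integrableOn_compact (isCompact_closedBall _ _)
  refine le_trans ?_ (setIntegral_mono (i1.sub i2).integrableOn i3 hpt)
  simp only [Pi.sub_apply]
  rw [integral_sub i1.integrableOn i2.integrableOn]
  have b1 : ∫ x in {x : Space3 | ‖x‖ ≤ R}, freqSq m / 2 * quasimode c m x ^ 2
      = freqSq m / 2 * ∫ x, quasimode c m x ^ 2 := by
    rw [setIntegral_eq_integral_of_forall_compl_eq_zero, integral_const_mul]
    intro x hx
    have hx' : R < ‖x‖ := by simpa using hx
    rw [quasimode_of_ge c m (by nlinarith)]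
    simp
  have b2 : ∫ x in {x : Space3 | ‖x‖ ≤ R}, energyDensity w₁ (τ, x) ≤ energy w₁ τ :=
    setIntegral_le_integral i2 (.of_forall fun x => energyDensity_nonneg _ _)
  rw [b1]
  linarith

end Estimates

lemma sq_le_two_mul_exp {t : ℝ} (ht : 0 ≤ t) : t ^ 2 * Real.exp (-t) ≤ 2 := by
  have h := Real.quadratic_le_exp_of_nonneg ht
  rw [Real.exp_neg, ← div_eq_mul_inv, div_le_iff₀ (Real.exp_pos t)]
  linarith

/-- Trapped waves of frequency comparable to `m`: their weighted initial energy is at most of order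
`m ^ 4`, while their local energy at time `τ` is at least of order `m ^ 2`, up to an error
exponentially small in `m`. -/
lemma exists_trapped_wave : ∃ C K : ℝ, 0 < C ∧ 0 ≤ K ∧ ∀ m : ℕ, 1 ≤ m → ∃ N : ℝ, 0 < N ∧
    ∀ τ R : ℝ, 4 < τ → 0 ≤ R → 5 ≤ R ^ 2 → ∃ ψ : SpaceTime → ℝ,
      ContDiff ℝ (⊤ : ℕ∞) ψ ∧ (∀ z, waveOp ψ z = 0) ∧
      HasCompactSupport (fun x => ψ (0, x)) ∧
      HasCompactSupport (fun x => dirDeriv timeVec ψ (0, x)) ∧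
      (∫ x, (1 + ‖x‖) * energyDensity ψ (0, x))
        + (∫ x, energyDensity (dirDeriv timeVec ψ) (0, x)) ≤ C * (m : ℝ) ^ 4 * N ∧
      (m : ℝ) ^ 2 * N * (1 - K * (τ + 5) ^ 2 * Real.exp (-m))
        ≤ ∫ x in {x : Space3 | ‖x‖ ≤ R}, energyDensity ψ (τ, x) := by
  obtain ⟨K, hK, hq⟩ := exists_quasimode
  obtain ⟨L, hL, hsw⟩ := exists_abs_deriv_switchedSine_le
  refine ⟨220 + 6020 * K + 1200 * K * (2 * L ^ 2 + 10), 3 * K, by positivity, by positivity,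
    fun m hm => ?_⟩
  obtain ⟨c, hN, hε⟩ := hq m hm
  set N := ∫ x, quasimode c m x ^ 2
  set ε := ∫ x, quasimodeError c m x ^ 2
  set D := ∫ x, gradSq (quasimode c m) x
  have hm1 : (1 : ℝ) ≤ m := by exact_mod_cast hm
  have hF : freqSq m = m * (2 * m + 3) := rfl
  have hF0 : 0 ≤ freqSq m := by rw [hF]; positivity
  have hw : Real.sqrt (freqSq m) ^ 2 = freqSq m := Real.sq_sqrt hF0
  have hD : D ≤ freqSq m * N + (N + ε) / 2 := integral_gradSq_quasimode_le c m
  have hε0 : 0 ≤ ε := integral_nonneg fun x => sq_nonneg _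
  refine ⟨N, hN, fun τ R hτ hR hR5 => ⟨trappedWave c m (Real.sqrt (freqSq m))
    (-(Real.sqrt (freqSq m) * τ)), contDiff_trappedWave _ _ _ _, waveOp_trappedWave hw,
    hasCompactSupport_trappedWave _ _ _ _, hasCompactSupport_dirDeriv_time_trappedWave _ _ _ _,
    ?_, ?_⟩⟩
  · refine (add_le_add (weighted_energy_trappedWave_le _ hw)
      (energy_dirDeriv_trappedWave_le _ hw hsw)).trans ?_
    rw [abs_of_nonneg (Real.sqrt_nonneg _)]
    have hε2 : ε ≤ 2 * K * N := by
      refine hε.trans ?_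
      have h := mul_le_mul_of_nonneg_left (sq_le_two_mul_exp (Nat.cast_nonneg m))
        (mul_nonneg hK hN.le)
      linarith
    have hFm : freqSq m ≤ 5 * (m : ℝ) ^ 2 := by
      rw [hF]
      nlinarith
    have h1 : 1 ≤ (m : ℝ) ^ 2 := one_le_pow₀ hm1
    have hLw : (L + Real.sqrt (freqSq m)) ^ 2 ≤ (2 * L ^ 2 + 10) * (m : ℝ) ^ 2 := by
      nlinarith [sq_nonneg (L - Real.sqrt (freqSq m)),
        mul_nonneg (sq_nonneg L) (sub_nonneg.2 h1)]
    generalize (L + Real.sqrt (freqSq m)) ^ 2 = W at hLw ⊢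
    rw [show (m : ℝ) ^ 4 = (m ^ 2) ^ 2 by ring]
    generalize (m : ℝ) ^ 2 = M at *
    have hD0 : 0 ≤ D := integral_nonneg (gradSq_nonneg _)
    have hM0 : 0 ≤ M := zero_le_one.trans h1
    have hKN : 0 ≤ K * N := mul_nonneg hK hN.le
    have hMM : M ≤ M ^ 2 := by nlinarith
    have e1 : freqSq m * N ≤ 5 * M * N := mul_le_mul_of_nonneg_right hFm hN.le
    have e2 : D ≤ (6 + K) * M * N := by nlinarith
    have e3 : freqSq m ^ 2 * N ≤ (5 * M) ^ 2 * N := by gcongr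
    have e4 : freqSq m * D ≤ 5 * M * ((6 + K) * M * N) := by gcongr
    have e5 : W * ε ≤ (2 * L ^ 2 + 10) * M * (2 * K * N) := by gcongr
    have f1 : M * N ≤ M ^ 2 * N := mul_le_mul_of_nonneg_right hMM hN.le
    have f2 : K * N * M ≤ K * N * M ^ 2 := mul_le_mul_of_nonneg_left hMM hKN
    have f3 : K * N ≤ K * N * M := le_mul_of_one_le_right hKN h1
    have f4 := mul_le_mul_of_nonneg_left f2 (by positivity : 0 ≤ 2 * L ^ 2 + 10)
    linarith
  · have h := le_local_energy_trappedWave (c := c) hw hτ hR hR5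
    refine le_trans ?_ h
    have h2 : (m : ℝ) ^ 2 * N ≤ freqSq m / 2 * N := by
      refine mul_le_mul_of_nonneg_right ?_ hN.le
      rw [hF]
      nlinarith
    have h3 := mul_le_mul_of_nonneg_left hε (by positivity : 0 ≤ 3 * (τ + 5) ^ 2)
    linarith

lemma timeDeriv_energyDensity_eq {u : SpaceTime → ℝ} (hu : ContDiff ℝ (⊤ : ℕ∞) u) (t : ℝ)
    (x : Space3) :
    timeDeriv u t x ^ 2 + ∑ i, ∑ j, metricCoeff i j x * spatialDeriv i (fun y => u (t, y)) x
      * spatialDeriv j (fun y => u (t, y)) x = energyDensity u (t, x) := by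
  simp only [dirDeriv_timeVec hu, spatialDeriv_slice hu, energyDensity]

lemma timeIteratedDeriv_two_energyDensity_eq {u : SpaceTime → ℝ} (hu : ContDiff ℝ (⊤ : ℕ∞) u)
    (t : ℝ) (x : Space3) :
    timeIteratedDeriv 2 u t x ^ 2
      + ∑ i, ∑ j, metricCoeff i j x * spatialDeriv i (fun y => timeDeriv u t y) x
        * spatialDeriv j (fun y => timeDeriv u t y) x
      = energyDensity (dirDeriv timeVec u) (t, x) := by
  simp only [timeIteratedDeriv, iteratedDeriv_two_time hu, dirDeriv_timeVec hu,
    spatialDeriv_slice (contDiff_top_dirDeriv hu timeVec), energyDensity]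

/-- A rate decaying faster than `log ^ (-2)` is eventually beaten by waves of frequency comparable
to `log τ`. -/
lemma exists_frequency {C K : ℝ} (hC : 0 < C) (hK : 0 ≤ K) {h : ℝ → ℝ}
    (hnn : ∀ t, 0 ≤ t → 0 ≤ h t)
    (hlim : Tendsto (fun t => h t * Real.log (2 + t) ^ 2) atTop (nhds 0)) :
    ∀ᶠ τ in atTop, ∃ m : ℕ, 1 ≤ m ∧ h τ * (C * (m : ℝ) ^ 2) < 1 / 2 ∧
      K * (τ + 5) ^ 2 * Real.exp (-m) ≤ 1 / 2 := by
  filter_upwards [hlim.eventually_lt_const (by positivity : 0 < 1 / (32 * C)),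
    eventually_ge_atTop (18 * K), eventually_ge_atTop 4] with τ h1 h2 h3
  have hτ : 0 < 2 + τ := by linarith
  have hl : 1 ≤ Real.log (2 + τ) := by
    rw [Real.le_log_iff_exp_le hτ]
    linarith [Real.exp_one_lt_d9]
  set l := Real.log (2 + τ) with hldef
  have hm3 : 3 * l ≤ ⌈3 * l⌉₊ := Nat.le_ceil _
  have hm4 : (⌈3 * l⌉₊ : ℝ) < 3 * l + 1 := Nat.ceil_lt_add_one (by linarith)
  refine ⟨⌈3 * l⌉₊, Nat.one_le_ceil_iff.2 (by linarith), ?_, ?_⟩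
  · generalize (⌈3 * l⌉₊ : ℝ) = m at *
    have hm : m ^ 2 ≤ 16 * l ^ 2 := by nlinarith
    rw [lt_div_iff₀ (by positivity)] at h1
    have := mul_le_mul_of_nonneg_left hm (mul_nonneg (hnn τ (by linarith)) hC.le)
    linarith
  · have he : Real.exp (-⌈3 * l⌉₊) ≤ ((2 + τ) ^ 3)⁻¹ := by
      calc Real.exp (-⌈3 * l⌉₊) ≤ Real.exp (-(3 * l)) := Real.exp_le_exp.2 (by linarith)
        _ = ((2 + τ) ^ 3)⁻¹ := by
          rw [Real.exp_neg, mul_comm, Real.exp_mul, Real.exp_log hτ]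
          norm_cast
    calc K * (τ + 5) ^ 2 * Real.exp (-⌈3 * l⌉₊) ≤ K * (τ + 5) ^ 2 * ((2 + τ) ^ 3)⁻¹ := by gcongr
      _ ≤ 1 / 2 := by
        rw [← div_eq_mul_inv, div_le_iff₀ (by positivity)]
        have e1 : (τ + 5) ^ 2 ≤ 9 * (2 + τ) ^ 2 := by nlinarith
        have e2 := mul_le_mul_of_nonneg_left e1 hK
        have e3 : 18 * K * (2 + τ) ^ 2 ≤ (2 + τ) * (2 + τ) ^ 2 := by
          gcongr
          linarith
        linarith

/-- Sharpness of the logarithmic decay rate: there is a smooth density `ρ` and a smooth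
symmetric positive definite coefficient matrix `a^{ij}` on `ℝ³`, equal to `1` resp. the
identity outside the ball of radius `π`, such that no local energy decay rate faster than
`(log(2+t))⁻²` (relative to the weighted initial energy plus the initial energy of `∂_t ψ`)
holds for solutions of `ρ ∂_t² ψ = ∑_{i,j} ∂_i (ρ a^{ij} ∂_j ψ)`. -/
theorem logarithmic_decay_is_sharp :
    ∃ ρ : EuclideanSpace ℝ (Fin 3) → ℝ,
    ∃ A : Fin 3 → Fin 3 → EuclideanSpace ℝ (Fin 3) → ℝ,
      ContDiff ℝ (⊤ : ℕ∞) ρ ∧ (∀ x, 0 < ρ x) ∧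
      (∀ i j, ContDiff ℝ (⊤ : ℕ∞) (A i j)) ∧
      (∀ i j x, A i j x = A j i x) ∧
      (∀ (x : EuclideanSpace ℝ (Fin 3)) (v : Fin 3 → ℝ), v ≠ 0 →
        0 < ∑ i, ∑ j, A i j x * v i * v j) ∧
      (∀ x : EuclideanSpace ℝ (Fin 3), Real.pi ≤ ‖x‖ →
        ρ x = 1 ∧ ∀ i j, A i j x = if i = j then 1 else 0) ∧
      (∀ h : ℝ → ℝ, (∀ t : ℝ, 0 ≤ t → 0 ≤ h t) →
        Tendsto (fun t => h t * (Real.log (2 + t)) ^ 2) atTop (nhds 0) →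
        ∃ t₀ > 0, ∀ τ : ℝ, t₀ < τ →
          ∃ ψ : ℝ × EuclideanSpace ℝ (Fin 3) → ℝ,
            ContDiff ℝ (⊤ : ℕ∞) ψ ∧
            -- the wave equation ρ ∂_t²ψ = ∑_{i,j} ∂_i (ρ a^{ij} ∂_j ψ)
            (∀ (t : ℝ) (x : EuclideanSpace ℝ (Fin 3)),
              ρ x * iteratedDeriv 2 (fun s => ψ (s, x)) t
                = ∑ i, spatialDeriv i
                    (fun y => ρ y * ∑ j, A i j y * spatialDeriv j (fun z => ψ (t, z)) y) x) ∧
            -- compactly supported smooth initial data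
            HasCompactSupport (fun x => ψ (0, x)) ∧
            HasCompactSupport (fun x => timeDeriv ψ 0 x) ∧
            (∫ x in {x : EuclideanSpace ℝ (Fin 3) | ‖x‖ ≤ 3 * Real.pi / 4},
                ρ x * ((timeDeriv ψ τ x) ^ 2
                  + ∑ i, ∑ j, A i j x * spatialDeriv i (fun y => ψ (τ, y)) x
                      * spatialDeriv j (fun y => ψ (τ, y)) x))
              > h τ *
                ((∫ x : EuclideanSpace ℝ (Fin 3),
                    (1 + ‖x‖) * (ρ x * ((timeDeriv ψ 0 x) ^ 2
                      + ∑ i, ∑ j, A i j x * spatialDeriv i (fun y => ψ (0, y)) x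
                          * spatialDeriv j (fun y => ψ (0, y)) x)))
                  + ∫ x : EuclideanSpace ℝ (Fin 3),
                      ρ x * ((timeIteratedDeriv 2 ψ 0 x) ^ 2
                        + ∑ i, ∑ j, A i j x * spatialDeriv i (fun y => timeDeriv ψ 0 y) x
                            * spatialDeriv j (fun y => timeDeriv ψ 0 y) x))) := by
  obtain ⟨C, K, hC, hK, hwave⟩ := exists_trapped_wave
  refine ⟨fun _ => 1, metricCoeff, contDiff_const, fun _ => one_pos, contDiff_metricCoeff,
    metricCoeff_symm, fun x v hv => metricCoeff_pos x hv,
    fun x hx => ⟨rfl, metricCoeff_of_pi_le hx⟩, fun h hnn hlim => ?_⟩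
  obtain ⟨t₀, ht₀⟩ := eventually_atTop.1 (exists_frequency hC hK hnn hlim)
  refine ⟨max t₀ 4, by positivity, fun τ hτ => ?_⟩
  have hτ4 : 4 < τ := (le_max_right _ _).trans_lt hτ
  obtain ⟨m, hm, h1, h2⟩ := ht₀ τ ((le_max_left _ _).trans hτ.le)
  obtain ⟨N, hN, hψ⟩ := hwave m hm
  have hR : 9 / 4 ≤ 3 * Real.pi / 4 := by linarith [Real.pi_gt_three]
  obtain ⟨ψ, hs, heq, hc1, hc2, hinit, hloc⟩ :=
    hψ τ (3 * Real.pi / 4) hτ4 (by linarith) (by nlinarith)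
  refine ⟨ψ, hs, fun t x => ?_, hc1, ?_, ?_⟩
  · simp only [one_mul]
    rw [iteratedDeriv_two_time hs]
    exact sub_eq_zero.1 (heq (t, x))
  · simpa only [dirDeriv_timeVec hs] using hc2
  · simp only [one_mul, timeDeriv_energyDensity_eq hs, timeIteratedDeriv_two_energyDensity_eq hs]
    refine (lt_of_le_of_lt (mul_le_mul_of_nonneg_left hinit (hnn τ (by linarith))) ?_).trans_le hloc
    have hmN : 0 < (m : ℝ) ^ 2 * N := by positivity
    nlinarith [mul_lt_mul_of_pos_left h1 hmN, mul_le_mul_of_nonneg_left h2 hmN.le]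
end

section
/- There exists a constant C > 0 such that for every λ > 0 and every T ≥ 1: |∫_1^T e^{iλy} y^{-1} dy| ≤ C·(1 + |log λ|). -/
open MeasureTheory

lemma norm_exp_I_mul_ofReal_mul_ofReal (lam y : ℝ) :
    ‖Complex.exp (Complex.I * (lam : ℂ) * (y : ℂ))‖ = 1 := by
  rw [mul_assoc, mul_comm, ← Complex.ofReal_mul, Complex.norm_exp_ofReal_mul_I]

lemma pos_of_mem_uIcc {a b y : ℝ} (ha : 0 < a) (hab : a ≤ b) (hy : y ∈ Set.uIcc a b) : 0 < y := by
  rw [Set.uIcc_of_le hab] at hy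
  exact ha.trans_le hy.1

lemma intervalIntegrable_exp_div {a b : ℝ} (ha : 0 < a) (hab : a ≤ b) (lam : ℝ) :
    IntervalIntegrable (fun y : ℝ ↦ Complex.exp (Complex.I * (lam : ℂ) * (y : ℂ)) / (y : ℂ))
      volume a b := by
  apply ContinuousOn.intervalIntegrable
  refine ContinuousOn.div (by fun_prop) (by fun_prop) fun y hy ↦ ?_
  exact_mod_cast (pos_of_mem_uIcc ha hab hy).ne'

/-- The trivial bound, ignoring oscillation. -/
lemma norm_integral_exp_div_le_log {a b : ℝ} (ha : 0 < a) (hab : a ≤ b) (lam : ℝ) :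
    ‖∫ y in a..b, Complex.exp (Complex.I * (lam : ℂ) * (y : ℂ)) / (y : ℂ)‖
      ≤ Real.log (b / a) := by
  rw [← integral_inv_of_pos ha (ha.trans_le hab)]
  refine intervalIntegral.norm_integral_le_of_norm_le hab (ae_of_all _ fun y hy ↦ ?_) ?_
  · rw [norm_div, norm_exp_I_mul_ofReal_mul_ofReal, Complex.norm_real, Real.norm_eq_abs,
      abs_of_pos (ha.trans hy.1), one_div]
  · exact (continuousOn_id.inv₀ fun y hy ↦ (pos_of_mem_uIcc ha hab hy).ne').intervalIntegrable

/-- The bound gained from the oscillation by one integration by parts. -/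
lemma norm_integral_exp_div_le_two_div {a b : ℝ} (ha : 0 < a) (hab : a ≤ b) {lam : ℝ}
    (hlam : 0 < lam) :
    ‖∫ y in a..b, Complex.exp (Complex.I * (lam : ℂ) * (y : ℂ)) / (y : ℂ)‖
      ≤ 2 / (lam * a) := by
  have hb : 0 < b := ha.trans_le hab
  have hlamC : (lam : ℂ) ≠ 0 := by exact_mod_cast hlam.ne'
  set F : ℝ → ℂ := fun y ↦
    Complex.exp (Complex.I * (lam : ℂ) * (y : ℂ)) / (Complex.I * lam * y) with hF
  set g : ℝ → ℂ := fun y ↦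
    Complex.exp (Complex.I * (lam : ℂ) * (y : ℂ)) / (Complex.I * lam * (y : ℂ) ^ 2) with hg
  have hnF (y : ℝ) (hy : 0 < y) : ‖F y‖ = 1 / (lam * y) := by
    simp only [hF]
    rw [norm_div, norm_exp_I_mul_ofReal_mul_ofReal]
    simp [abs_of_pos hlam, abs_of_pos hy]
  have hng (y : ℝ) : ‖g y‖ = 1 / (lam * y ^ 2) := by
    simp only [hg]
    rw [norm_div, norm_exp_I_mul_ofReal_mul_ofReal]
    simp [abs_of_pos hlam]
  have hFd (y : ℝ) (hy : y ∈ Set.uIcc a b) : HasDerivAt F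
      (Complex.exp (Complex.I * (lam : ℂ) * (y : ℂ)) / (y : ℂ) - g y) y := by
    have hyC : (y : ℂ) ≠ 0 := by exact_mod_cast (pos_of_mem_uIcc ha hab hy).ne'
    have h1 : HasDerivAt (fun y : ℝ ↦ Complex.I * (lam : ℂ) * (y : ℂ)) (Complex.I * lam) y := by
      simpa using (Complex.ofRealCLM.hasDerivAt (x := y)).const_mul (Complex.I * (lam : ℂ))
    have hne : Complex.I * (lam : ℂ) * (y : ℂ) ≠ 0 := by simp [hlamC, hyC]
    convert! h1.cexp.div h1 hne using 1
    simp only [hg]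
    field_simp
  have hgi : IntervalIntegrable g volume a b := by
    apply ContinuousOn.intervalIntegrable
    refine ContinuousOn.div (by fun_prop) (by fun_prop) fun y hy ↦ ?_
    have hyC : (y : ℂ) ≠ 0 := by exact_mod_cast (pos_of_mem_uIcc ha hab hy).ne'
    simp [hlamC, hyC]
  have hi := intervalIntegrable_exp_div ha hab lam
  have hparts := intervalIntegral.integral_eq_sub_of_hasDerivAt hFd (hi.sub hgi)
  rw [intervalIntegral.integral_sub hi hgi, sub_eq_iff_eq_add] at hparts
  have hmi : IntervalIntegrable (fun y : ℝ ↦ 1 / (lam * y ^ 2)) volume a b := by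
    apply ContinuousOn.intervalIntegrable
    refine ContinuousOn.div (by fun_prop) (by fun_prop) fun y hy ↦ ?_
    have := pos_of_mem_uIcc ha hab hy
    positivity
  have hm : ∫ y in a..b, 1 / (lam * y ^ 2) = -(1 / (lam * b)) - -(1 / (lam * a)) := by
    refine intervalIntegral.integral_eq_sub_of_hasDerivAt
      (f := fun y ↦ -(1 / (lam * y))) (fun y hy ↦ ?_) hmi
    have hy0 := (pos_of_mem_uIcc ha hab hy).ne'
    convert! ((hasDerivAt_const y (1 : ℝ)).div ((hasDerivAt_id y).const_mul lam)
      (mul_ne_zero hlam.ne' hy0)).neg using 1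
    simp only [id]
    field_simp
    ring
  have hgle : ‖∫ y in a..b, g y‖ ≤ ∫ y in a..b, 1 / (lam * y ^ 2) :=
    intervalIntegral.norm_integral_le_of_norm_le hab
      (ae_of_all _ fun y _ ↦ (hng y).le) hmi
  calc _ = ‖F b - F a + ∫ y in a..b, g y‖ := by rw [hparts]
    _ ≤ ‖F b‖ + ‖F a‖ + ‖∫ y in a..b, g y‖ :=
      (norm_add_le _ _).trans (add_le_add_left (norm_sub_le _ _) _)
    _ ≤ 1 / (lam * b) + 1 / (lam * a) + (-(1 / (lam * b)) - -(1 / (lam * a))) := by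
      rw [hnF b hb, hnF a ha, ← hm]
      gcongr
    _ = 2 / (lam * a) := by ring

/-- Oscillatory integral bound: `|∫_1^T e^{iλy} y^{-1} dy| ≤ C (1 + |log λ|)`,
uniformly in `T ≥ 1` and `λ > 0`. -/
theorem oscillatory_integral_log_bound :
    ∃ C > 0, ∀ lam : ℝ, 0 < lam → ∀ T : ℝ, 1 ≤ T →
      ‖∫ y in (1:ℝ)..T, Complex.exp (Complex.I * (lam : ℂ) * (y : ℂ)) / (y : ℂ)‖
        ≤ C * (1 + |Real.log lam|) := by
  refine ⟨2, two_pos, fun lam hlam T hT ↦ ?_⟩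
  have habs := abs_nonneg (Real.log lam)
  set M : ℝ := max 1 lam⁻¹
  have hM1 : 1 ≤ M := le_max_left _ _
  have hM0 : 0 < M := one_pos.trans_le hM1
  have hlogM : Real.log M ≤ |Real.log lam| := by
    rcases max_choice 1 lam⁻¹ with h | h
    · simp [M, h]
    · simp only [M, h, Real.log_inv]
      exact neg_le_abs _
  rcases le_total T M with hTM | hMT
  · have h := norm_integral_exp_div_le_log one_pos hT lam
    rw [div_one] at h
    linarith [Real.log_le_log (one_pos.trans_le hT) hTM]
  · have hnear := norm_integral_exp_div_le_log one_pos hM1 lam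
    have hfar := norm_integral_exp_div_le_two_div hM0 hMT hlam
    have hlamM : 1 ≤ lam * M := by
      calc 1 = lam * lam⁻¹ := (mul_inv_cancel₀ hlam.ne').symm
        _ ≤ lam * M := by gcongr; exact le_max_right _ _
    have htwo : 2 / (lam * M) ≤ 2 := div_le_self two_pos.le hlamM
    rw [div_one] at hnear
    rw [← intervalIntegral.integral_add_adjacent_intervals
      (intervalIntegrable_exp_div one_pos hM1 lam) (intervalIntegrable_exp_div hM0 hMT lam)]
    refine (norm_add_le _ _).trans ?_
    linarith
end
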